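/- arXiv:2207.01957 — 2 statements merged into one kernel-verified Lean document; each statement's English description precedes it below -/
import Mathlib

section
/- If a state ω on a unital C*-algebra A annihilates an intersection M₁ ∩ M₂ ∩ … ∩ Mₙ of finitely many maximal closed two-sided ideals of A, then ω is maximally mixed. Consequently, the set S_m(A) of all maximally mixed states on A is weak*-dense in the set of all states on A that annihilate the strong radical J_A. -/
universe u

open scoped ComplexConjugate ComplexOrder

noncomputable section

variable {A : Type u} [NormedRing A] [StarRing A] [CStarRing A]
  [NormedAlgebra ℂ A] [StarModule ℂ A] [CompleteSpace A]

/-- A linear functional on a C*-algebra is positive if it is nonnegative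
on all elements of the form `a* a`. -/
def IsPositiveFunctional (ω : A →L[ℂ] ℂ) : Prop :=
  ∀ a : A, 0 ≤ ω (star a * a)

/-- A state is a positive unital linear functional. -/
def IsState (ω : A →L[ℂ] ℂ) : Prop :=
  IsPositiveFunctional ω ∧ ω 1 = 1

/-- A hermitian (self-adjoint) linear functional. -/
def IsHermitianFunctional (ω : A →L[ℂ] ℂ) : Prop :=
  ∀ a : A, ω (star a) = conj (ω a)

/-- `ωp`, `ωm` form the Jordan decomposition of the hermitian functional `ω`. -/
def IsJordanDecomposition (ω ωp ωm : A →L[ℂ] ℂ) : Prop :=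
  IsPositiveFunctional ωp ∧ IsPositiveFunctional ωm ∧ ω = ωp - ωm ∧ ‖ω‖ = ‖ωp‖ + ‖ωm‖

/-- An element of a C*-algebra is positive iff it is of the form `b* b`. -/
def IsPositiveElem (c : A) : Prop :=
  ∃ b : A, c = star b * b

/-- `E(A)`: the unital completely positive elementary maps
`x ↦ ∑ i, (a i)* x (a i)` with `∑ i, (a i)* (a i) = 1`. -/
def IsElementaryUCP (φ : A →L[ℂ] A) : Prop :=
  ∃ (n : ℕ) (a : Fin n → A), (∑ i, star (a i) * a i) = 1 ∧
    ∀ x : A, φ x = ∑ i, star (a i) * x * a i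

/-- The set `ω ∘ E(A) = {ω ∘ φ : φ ∈ E(A)}`. -/
def mixSet (ω : A →L[ℂ] ℂ) : Set (A →L[ℂ] ℂ) :=
  {ρ | ∃ φ : A →L[ℂ] A, IsElementaryUCP φ ∧ ρ = ω.comp φ}

/-- Membership in the weak* closure of a set of functionals: every basic weak*
neighbourhood of `ρ` (given by finitely many points and `ε > 0`) meets `S`. -/
def InWeakStarClosure (S : Set (A →L[ℂ] ℂ)) (ρ : A →L[ℂ] ℂ) : Prop :=
  ∀ ε : ℝ, 0 < ε → ∀ (n : ℕ) (x : Fin n → A), ∃ σ ∈ S, ∀ i, ‖ρ (x i) - σ (x i)‖ < ε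

/-- Norm-closed two-sided ideals (which in a C*-algebra are automatically
`*`-closed `ℂ`-submodules). -/
def IsClosedIdeal (J : Set A) : Prop :=
  IsClosed J ∧ (0 : A) ∈ J ∧ (∀ x ∈ J, ∀ y ∈ J, x + y ∈ J) ∧
    (∀ (c : ℂ), ∀ x ∈ J, c • x ∈ J) ∧ (∀ (a : A), ∀ x ∈ J, a * x ∈ J ∧ x * a ∈ J)

/-- The norm `‖ω|J‖` of the restriction of a functional `ω` to a subset `J`. -/
def normRestrict (ω : A →L[ℂ] ℂ) (J : Set A) : ℝ :=
  sSup {r : ℝ | ∃ x ∈ J, ‖x‖ ≤ 1 ∧ r = ‖ω x‖}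

/-- The norm `‖cω‖` of the functional `x ↦ ω (c * x)`. -/
def mulNorm (ω : A →L[ℂ] ℂ) (c : A) : ℝ :=
  sSup {r : ℝ | ∃ x : A, ‖x‖ ≤ 1 ∧ r = ‖ω (c * x)‖}

/-- A state `ω` is maximally mixed if every state `ρ` that is more mixed than `ω`
(i.e. `ρ` lies in the weak* closure of `ω ∘ E(A)`) satisfies in turn that `ω` is
more mixed than `ρ`. -/
def IsMaximallyMixed (ω : A →L[ℂ] ℂ) : Prop :=
  IsState ω ∧ ∀ ρ : A →L[ℂ] ℂ, IsState ρ →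
    InWeakStarClosure (mixSet ω) ρ → InWeakStarClosure (mixSet ρ) ω

/-- Maximal (norm-closed two-sided) ideals. -/
def IsMaximalIdeal (N : Set A) : Prop :=
  IsClosedIdeal N ∧ N ≠ Set.univ ∧
    ∀ N' : Set A, IsClosedIdeal N' → N' ≠ Set.univ → N ⊆ N' → N' = N

/-- The strong radical: the intersection of all maximal ideals. -/
def strongRadical (A : Type u) [NormedRing A] [StarRing A] [CStarRing A]
    [NormedAlgebra ℂ A] [StarModule ℂ A] [CompleteSpace A] : Set A :=
  ⋂₀ {N : Set A | IsMaximalIdeal N}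

namespace MMAux

section Ideals

variable {B : Type u} [CStarAlgebra B]

/-- Algebraic (not necessarily closed) two-sided ideals. -/
def AlgIdeal (J : Set B) : Prop :=
  (0 : B) ∈ J ∧ (∀ x ∈ J, ∀ y ∈ J, x + y ∈ J) ∧
    (∀ (c : ℂ), ∀ x ∈ J, c • x ∈ J) ∧ (∀ (a : B), ∀ x ∈ J, a * x ∈ J ∧ x * a ∈ J)

lemma ci_alg {N : Set B} (h : IsClosedIdeal N) : AlgIdeal N := h.2

lemma ci_zero {N : Set B} (h : IsClosedIdeal N) : (0 : B) ∈ N := h.2.1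

lemma ci_add {N : Set B} (h : IsClosedIdeal N) {x y : B} (hx : x ∈ N) (hy : y ∈ N) :
    x + y ∈ N := h.2.2.1 x hx y hy

lemma ci_left {N : Set B} (h : IsClosedIdeal N) (a : B) {x : B} (hx : x ∈ N) :
    a * x ∈ N := (h.2.2.2.2 a x hx).1

lemma ci_right {N : Set B} (h : IsClosedIdeal N) (a : B) {x : B} (hx : x ∈ N) :
    x * a ∈ N := (h.2.2.2.2 a x hx).2

lemma ci_neg {N : Set B} (h : IsClosedIdeal N) {x : B} (hx : x ∈ N) : -x ∈ N := by
  simpa using ci_left h (-1) hx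

lemma ci_sub {N : Set B} (h : IsClosedIdeal N) {x y : B} (hx : x ∈ N) (hy : y ∈ N) :
    x - y ∈ N := by
  rw [sub_eq_add_neg]; exact ci_add h hx (ci_neg h hy)

lemma ci_sum {ι : Type*} {N : Set B} (h : IsClosedIdeal N) (s : Finset ι) {f : ι → B}
    (hf : ∀ i ∈ s, f i ∈ N) : ∑ i ∈ s, f i ∈ N := by
  classical
  induction s using Finset.induction_on with
  | empty => simpa using ci_zero h
  | insert a s ha ih =>
    rw [Finset.sum_insert ha]
    exact ci_add h (hf a (by simp)) (ih fun i hi => hf i (by simp [hi]))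

/-- Closed two-sided ideals are self-adjoint. -/
lemma ci_star {N : Set B} (h : IsClosedIdeal N) {x : B} (hx : x ∈ N) : star x ∈ N := by
  let _ := CStarAlgebra.spectralOrder B
  have := CStarAlgebra.spectralOrderedRing B
  rw [← h.1.closure_eq, Metric.mem_closure_iff]
  intro ε hε
  set a : B := x * star x with ha_def
  have ha : 0 ≤ a := mul_star_self_nonneg x
  have hsa : IsSelfAdjoint a := ha.isSelfAdjoint
  set δ : ℝ := (ε / 2) ^ 2 with hδd
  have hδ : 0 < δ := by positivity
  have hspec : ∀ t ∈ spectrum ℝ a, 0 ≤ t := fun t ht => spectrum_nonneg_of_nonneg ha ht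
  have hcont : ContinuousOn (fun t : ℝ => (δ + t)⁻¹) (spectrum ℝ a) := by
    refine ContinuousOn.inv₀ (by fun_prop) ?_
    intro t ht
    have := hspec t ht
    positivity
  set c : B := cfc (fun t : ℝ => (δ + t)⁻¹) a with hc
  have hcsa : IsSelfAdjoint c := cfc_predicate _ a
  have h1 : δ • c + a * c = 1 := by
    have e1 : a * c = cfc (fun t : ℝ => t * (δ + t)⁻¹) a := by
      rw [cfc_mul (fun t : ℝ => t) (fun t : ℝ => (δ + t)⁻¹) a (by fun_prop) hcont, cfc_id' ℝ a]
    have e2 : δ • c = cfc (fun t : ℝ => δ * (δ + t)⁻¹) a := by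
      rw [cfc_const_mul δ (fun t : ℝ => (δ + t)⁻¹) a hcont]
    rw [e1, e2, ← cfc_add _ _ _ (by fun_prop) (by fun_prop), ← cfc_one ℝ a]
    apply cfc_congr
    intro t ht
    have := hspec t ht
    have : δ + t ≠ 0 := by positivity
    simp only [Pi.one_apply]
    field_simp
  have h2 : ‖c * a * c‖ ≤ δ⁻¹ := by
    have e1 : c * a * c = cfc (fun t : ℝ => (δ + t)⁻¹ * t * (δ + t)⁻¹) a := by
      rw [cfc_mul (fun t : ℝ => (δ + t)⁻¹ * t) (fun t : ℝ => (δ + t)⁻¹) a (by fun_prop) hcont,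
        cfc_mul (fun t : ℝ => (δ + t)⁻¹) (fun t : ℝ => t) a hcont (by fun_prop), cfc_id' ℝ a]
    rw [e1]
    apply norm_cfc_le (by positivity)
    intro t ht
    have h0 := hspec t ht
    rw [Real.norm_of_nonneg (by positivity)]
    have hp : 0 < δ + t := by positivity
    have : (δ + t)⁻¹ * t ≤ 1 := by
      rw [inv_mul_le_iff₀ hp]; linarith
    calc (δ + t)⁻¹ * t * (δ + t)⁻¹ ≤ 1 * (δ + t)⁻¹ := by gcongr
      _ ≤ δ⁻¹ := by rw [one_mul]; gcongr; linarith
  refine ⟨star x * (a * c), ?_, ?_⟩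
  · rw [ha_def]
    exact ci_left h _ (by rw [mul_assoc]; exact ci_right h _ hx)
  · have e : star x - star x * (a * c) = δ • (star x * c) := by
      calc star x - star x * (a * c) = star x * (1 - a * c) := by noncomm_ring
        _ = star x * (δ • c) := by rw [← h1]; simp
        _ = _ := by simp
    rw [dist_eq_norm, e, norm_smul, Real.norm_of_nonneg hδ.le]
    have h3 : ‖star x * c‖ * ‖star x * c‖ ≤ δ⁻¹ := by
      rw [← CStarRing.norm_star_mul_self]
      have e3 : star (star x * c) * (star x * c) = c * a * c := by
        rw [star_mul, star_star, hcsa.star_eq, ha_def]; noncomm_ring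
      rw [e3]; exact h2
    have h4 : (δ * ‖star x * c‖) ^ 2 ≤ δ := by
      calc (δ * ‖star x * c‖) ^ 2 = δ ^ 2 * (‖star x * c‖ * ‖star x * c‖) := by ring
        _ ≤ δ ^ 2 * δ⁻¹ := by gcongr
        _ = δ := by field_simp
    have h5 : δ * ‖star x * c‖ ≤ ε / 2 := by
      refine le_of_sq_le_sq ?_ (by positivity)
      rw [← hδd]; exact h4
    linarith

lemma one_mem_of_alg {N I : Set B} (hN : IsMaximalIdeal N) (hI : AlgIdeal I) (hNI : N ⊆ I)
    {g : B} (hgI : g ∈ I) (hgN : g ∉ N) : (1 : B) ∈ I := by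
  obtain ⟨i0, iadd, ismul, imul⟩ := hI
  have hcl : IsClosedIdeal (closure I) := by
    refine ⟨isClosed_closure, subset_closure i0, ?_, ?_, ?_⟩
    · intro x hx y hy
      exact map_mem_closure₂ continuous_add hx hy iadd
    · intro c x hx
      exact map_mem_closure (continuous_const_smul c) hx (fun x hx => ismul c x hx)
    · intro a x hx
      exact ⟨map_mem_closure (continuous_const_mul a) hx (fun x hx => (imul a x hx).1),
        map_mem_closure (f := fun y => y * a) (continuous_mul_const a) hx (fun x hx => (imul a x hx).2)⟩
  have huniv : closure I = Set.univ := by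
    by_contra hne
    have := hN.2.2 _ hcl hne (hNI.trans subset_closure)
    exact hgN (this ▸ subset_closure hgI)
  have h1 : (1 : B) ∈ closure I := huniv ▸ Set.mem_univ _
  obtain ⟨y, hy, hd⟩ := Metric.mem_closure_iff.1 h1 1 one_pos
  rw [dist_eq_norm] at hd
  have hu : IsUnit y := by
    have := (Units.oneSub (1 - y) hd).isUnit
    simpa using this
  obtain ⟨u, rfl⟩ := hu
  have := (imul (↑u⁻¹ : B) _ hy).1
  simpa using this

lemma maximal_one_notMem {N : Set B} (hN : IsMaximalIdeal N) : (1 : B) ∉ N := by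
  intro h
  apply hN.2.1
  ext x
  simpa using ci_left hN.1 x h

lemma exists_split {N M : Set B} (hN : IsMaximalIdeal N) (hM : IsMaximalIdeal M) (hne : N ≠ M) :
    ∃ v ∈ M, 1 - v ∈ N := by
  have hns : ¬ M ⊆ N := fun hs => hne (hM.2.2 N hN.1 hN.2.1 hs)
  obtain ⟨g, hgM, hgN⟩ := Set.not_subset.1 hns
  have hI : AlgIdeal {z : B | ∃ v ∈ M, z - v ∈ N} := by
    refine ⟨⟨0, ci_zero hM.1, by simpa using ci_zero hN.1⟩, ?_, ?_, ?_⟩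
    · rintro x ⟨v, hv, hx⟩ y ⟨w, hw, hy⟩
      refine ⟨v + w, ci_add hM.1 hv hw, ?_⟩
      have : x + y - (v + w) = (x - v) + (y - w) := by abel
      rw [this]; exact ci_add hN.1 hx hy
    · rintro c x ⟨v, hv, hx⟩
      refine ⟨c • v, hM.1.2.2.2.1 c v hv, ?_⟩
      rw [← smul_sub]; exact hN.1.2.2.2.1 c _ hx
    · rintro a x ⟨v, hv, hx⟩
      refine ⟨⟨a * v, ci_left hM.1 a hv, ?_⟩, ⟨v * a, ci_right hM.1 a hv, ?_⟩⟩
      · rw [← mul_sub]; exact ci_left hN.1 a hx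
      · rw [← sub_mul]; exact ci_right hN.1 a hx
  exact one_mem_of_alg hN hI (fun x hx => ⟨0, ci_zero hM.1, by simpa using hx⟩)
    (g := g) ⟨g, hgM, by simpa using ci_zero hN.1⟩ hgN

lemma exists_d {ι : Type*} [Fintype ι] {N : ι → Set B} (hN : ∀ i, IsMaximalIdeal (N i))
    (hinj : Function.Injective N) (i : ι) :
    ∃ d : B, (∀ j, j ≠ i → d ∈ N j) ∧ 1 - d ∈ N i := by
  classical
  have key : ∀ s : Finset ι, i ∉ s → ∃ d : B, (∀ j ∈ s, d ∈ N j) ∧ 1 - d ∈ N i := by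
    intro s
    induction s using Finset.induction_on with
    | empty => intro _; exact ⟨1, by simp, by simpa using ci_zero (hN i).1⟩
    | insert a s ha ih =>
      intro his
      rw [Finset.mem_insert, not_or] at his
      obtain ⟨d, hd, hd1⟩ := ih his.2
      obtain ⟨v, hv, hv1⟩ := exists_split (hN i) (hN a) (fun h => his.1 (hinj h))
      refine ⟨d * v, ?_, ?_⟩
      · intro j hj
        rcases Finset.mem_insert.1 hj with rfl | hj
        · exact ci_left (hN _).1 _ hv
        · exact ci_right (hN _).1 _ (hd j hj)
      · have : 1 - d * v = (1 - d) * v + (1 - v) := by noncomm_ring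
        rw [this]
        exact ci_add (hN i).1 (ci_right (hN i).1 _ hd1) hv1
  obtain ⟨d, hd, h1⟩ := key (Finset.univ.erase i) (by simp)
  exact ⟨d, fun j hj => hd j (by simp [hj]), h1⟩

end Ideals

section ECPs

variable {B : Type u} [CStarAlgebra B]

/-- Elementary completely positive maps. -/
def ECP (ψ : B → B) : Prop :=
  ∃ l : List B, ∀ x, ψ x = (l.map fun a => star a * x * a).sum

lemma ecp_zero : ECP (fun _ : B => (0 : B)) := ⟨[], by simp⟩

lemma ecp_id : ECP (fun x : B => x) := ⟨[1], by simp⟩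

lemma ecp_add {ψ χ : B → B} (h1 : ECP ψ) (h2 : ECP χ) : ECP (fun x => ψ x + χ x) := by
  obtain ⟨l, hl⟩ := h1
  obtain ⟨m, hm⟩ := h2
  exact ⟨l ++ m, fun x => by simp [hl, hm]⟩

lemma ecp_sum {ι : Type*} (s : Finset ι) {ψ : ι → B → B} (h : ∀ i, ECP (ψ i)) :
    ECP (fun x => ∑ i ∈ s, ψ i x) := by
  classical
  induction s using Finset.induction_on with
  | empty => simpa using ecp_zero
  | insert a s ha ih =>
    simp only [Finset.sum_insert ha]
    exact ecp_add (h a) ih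

lemma ecp_conj {ψ : B → B} (h : ECP ψ) (b : B) : ECP (fun x => star b * ψ x * b) := by
  obtain ⟨l, hl⟩ := h
  refine ⟨l.map (fun a => a * b), fun x => ?_⟩
  beta_reduce
  rw [hl, ← List.sum_map_mul_left, ← List.sum_map_mul_right]
  simp [Function.comp_def, mul_assoc]

lemma ecp_inner {ψ : B → B} (h : ECP ψ) (b : B) : ECP (fun x => ψ (star b * x * b)) := by
  obtain ⟨l, hl⟩ := h
  refine ⟨l.map (fun a => b * a), fun x => ?_⟩
  beta_reduce
  rw [hl]
  simp [Function.comp_def, mul_assoc]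

lemma ecp_map_sub {ψ : B → B} (h : ECP ψ) (x y : B) : ψ (x - y) = ψ x - ψ y := by
  obtain ⟨l, hl⟩ := h
  simp only [hl]
  clear hl
  induction l with
  | nil => simp
  | cons a l ih =>
    simp only [List.map_cons, List.sum_cons, mul_sub, sub_mul] at ih ⊢
    rw [ih]; abel

lemma ecp_map_smul {ψ : B → B} (h : ECP ψ) (t : ℝ) (x : B) : ψ (t • x) = t • ψ x := by
  obtain ⟨l, hl⟩ := h
  simp [hl, List.smul_sum, Function.comp_def]

lemma ecp_mem {ψ : B → B} (h : ECP ψ) {N : Set B} (hN : IsClosedIdeal N) {x : B} (hx : x ∈ N) :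
    ψ x ∈ N := by
  obtain ⟨l, hl⟩ := h
  rw [hl]
  clear hl
  induction l with
  | nil => simpa using ci_zero hN
  | cons a l ih =>
    rw [List.map_cons, List.sum_cons]
    exact ci_add hN (ci_right hN _ (ci_left hN _ hx)) ih

lemma ecp_nonneg [PartialOrder B] [StarOrderedRing B] {ψ : B → B} (h : ECP ψ) {x : B}
    (hx : 0 ≤ x) : 0 ≤ ψ x := by
  obtain ⟨l, hl⟩ := h
  rw [hl]
  apply List.sum_nonneg
  intro y hy
  obtain ⟨a, _, rfl⟩ := List.mem_map.1 hy
  exact star_left_conjugate_nonneg hx a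

/-- A unital elementary completely positive map gives an element of `E(B)`. -/
lemma ecp_to {ψ : B → B} (h : ECP ψ) (h1 : ψ 1 = 1) :
    ∃ φ : B →L[ℂ] B, IsElementaryUCP φ ∧ ∀ x, φ x = ψ x := by
  obtain ⟨l, hl⟩ := h
  have e : ∀ x, ψ x = ∑ i, star (l.get i) * x * l.get i := by
    intro x
    rw [hl, ← List.sum_ofFn]
    congr 1
    apply List.ext_get
    · simp
    · intros; simp
  refine ⟨∑ i, (ContinuousLinearMap.mul ℂ B (star (l.get i))).comp
    ((ContinuousLinearMap.mul ℂ B).flip (l.get i)), ⟨l.length, l.get, ?_, ?_⟩, ?_⟩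
  · rw [← h1, e]; simp only [mul_one]
  · intro x; simp [mul_assoc]
  · intro x; rw [e]; simp [mul_assoc]

lemma ecp_of {φ : B →L[ℂ] B} (h : IsElementaryUCP φ) : ECP φ ∧ φ 1 = 1 := by
  obtain ⟨n, a, h1, h2⟩ := h
  refine ⟨⟨List.ofFn a, fun x => ?_⟩, ?_⟩
  · rw [h2, List.map_ofFn, List.sum_ofFn]; rfl
  · rw [h2]; simpa only [mul_one] using h1

end ECPs

section States

variable {B : Type u} [CStarAlgebra B] [PartialOrder B] [StarOrderedRing B]

lemma st_nonneg {ω : B →L[ℂ] ℂ} (h : IsState ω) {x : B} (hx : 0 ≤ x) : 0 ≤ ω x := by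
  obtain ⟨b, rfl⟩ := CStarAlgebra.nonneg_iff_eq_star_mul_self.1 hx
  exact h.1 b

lemma st_re_nonneg {ω : B →L[ℂ] ℂ} (h : IsState ω) {x : B} (hx : 0 ≤ x) : 0 ≤ (ω x).re :=
  (Complex.le_def.1 (st_nonneg h hx)).1

lemma st_re_mono {ω : B →L[ℂ] ℂ} (h : IsState ω) {x y : B} (hx : x ≤ y) :
    (ω x).re ≤ (ω y).re := by
  have := st_re_nonneg h (sub_nonneg.2 hx)
  rw [map_sub, Complex.sub_re] at this
  linarith

lemma st_re_smul (ω : B →L[ℂ] ℂ) (t : ℝ) (x : B) : (ω (t • x)).re = t * (ω x).re := by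
  have : t • x = (t : ℂ) • x := by simp
  rw [this, map_smul]; simp

lemma st_im {ω : B →L[ℂ] ℂ} (h : IsState ω) {x : B} (hx : IsSelfAdjoint x) : (ω x).im = 0 := by
  rw [← CFC.posPart_sub_negPart x, map_sub, Complex.sub_im]
  have h1 := (Complex.le_def.1 (st_nonneg h (CFC.posPart_nonneg x))).2
  have h2 := (Complex.le_def.1 (st_nonneg h (CFC.negPart_nonneg x))).2
  simp only [Complex.zero_im] at h1 h2
  rw [← h1, ← h2]; simp

/-- the real part of a state at `y` is its value at the real part of `y`. -/
lemma st_re_realPart {ω : B →L[ℂ] ℂ} (h : IsState ω) (y : B) :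
    (ω y).re = (ω (realPart y : B)).re := by
  conv_lhs => rw [← realPart_add_I_smul_imaginaryPart y]
  rw [map_add, map_smul, Complex.add_re]
  have := st_im h (imaginaryPart y).2
  simp [this]

lemma st_comp {ω : B →L[ℂ] ℂ} (h : IsState ω) {φ : B →L[ℂ] B} (hφ : IsElementaryUCP φ) :
    IsState (ω.comp φ) := by
  obtain ⟨h1, h2⟩ := ecp_of hφ
  refine ⟨fun a => st_nonneg h (ecp_nonneg h1 (star_mul_self_nonneg a)), ?_⟩
  simp [h2, h.2]

end States

section Key

variable {B : Type u} [CStarAlgebra B] [PartialOrder B] [StarOrderedRing B]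

lemma exists_dom {N : Set B} (hN : IsMaximalIdeal N) {g : B} (hg : g ∉ N) :
    ∃ n ∈ N, ∃ ψ : B → B, ECP ψ ∧ 1 ≤ ψ (star g * g) + n := by
  have hI : AlgIdeal {z : B | ∃ n ∈ N, ∃ ψ : B → B, ECP ψ ∧
      star z * z ≤ ψ (star g * g) + n} := by
    have hleft : ∀ (a x : B), (∃ n ∈ N, ∃ ψ : B → B, ECP ψ ∧
        star x * x ≤ ψ (star g * g) + n) → (∃ n ∈ N, ∃ ψ : B → B, ECP ψ ∧
        star (a * x) * (a * x) ≤ ψ (star g * g) + n) := by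
      rintro a x ⟨n, hn, ψ, hψ, hx⟩
      set b : B := algebraMap ℝ B ‖a‖ with hb
      have hbs : star b = b := by
        rw [hb]; exact (IsSelfAdjoint.algebraMap B (IsSelfAdjoint.all ‖a‖)).star_eq
      refine ⟨star b * n * b, ci_right hN.1 _ (ci_left hN.1 _ hn), _, ecp_conj hψ b, ?_⟩
      have h1 : star (a * x) * (a * x) ≤ star b * (star x * x) * b := by
        have h2 := star_left_conjugate_le_conjugate
          (CStarAlgebra.star_mul_le_algebraMap_norm_sq (a := a)) x
        have e1 : star (a * x) * (a * x) = star x * (star a * a) * x := by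
          simp [mul_assoc]
        have e2 : star b * (star x * x) * b = star x * algebraMap ℝ B (‖a‖ ^ 2) * x := by
          rw [hbs, hb]
          simp only [Algebra.algebraMap_eq_smul_one, smul_mul_assoc, one_mul, mul_smul_comm,
            mul_one, smul_smul, pow_two]
        rw [e1, e2]; exact h2
      refine h1.trans ?_
      have h3 := star_left_conjugate_le_conjugate hx b
      rwa [mul_add, add_mul] at h3
    refine ⟨⟨0, ci_zero hN.1, _, ecp_zero, by simp⟩, ?_, ?_, ?_⟩
    · rintro x ⟨n, hn, ψ, hψ, hx⟩ y ⟨m, hm, χ, hχ, hy⟩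
      refine ⟨(n + m) + (n + m), ci_add hN.1 (ci_add hN.1 hn hm) (ci_add hN.1 hn hm), _,
        ecp_add (ecp_add hψ hχ) (ecp_add hψ hχ), ?_⟩
      have h1 : 0 ≤ star (x - y) * (x - y) := star_mul_self_nonneg _
      have h2 : star (x + y) * (x + y) + star (x - y) * (x - y) =
          (star x * x + star y * y) + (star x * x + star y * y) := by
        simp only [star_add, star_sub]; noncomm_ring
      calc star (x + y) * (x + y) ≤ star (x + y) * (x + y) + star (x - y) * (x - y) :=
            le_add_of_nonneg_right h1
        _ = (star x * x + star y * y) + (star x * x + star y * y) := h2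
        _ ≤ ((ψ (star g * g) + n) + (χ (star g * g) + m)) +
            ((ψ (star g * g) + n) + (χ (star g * g) + m)) :=
            add_le_add (add_le_add hx hy) (add_le_add hx hy)
        _ = _ := by abel
    · intro c x hx
      have := hleft (c • 1) x hx
      simpa using this
    · intro a x hx
      refine ⟨hleft a x hx, ?_⟩
      obtain ⟨n, hn, ψ, hψ, hx⟩ := hx
      refine ⟨star a * n * a, ci_right hN.1 _ (ci_left hN.1 _ hn), _, ecp_conj hψ a, ?_⟩
      have h3 := star_left_conjugate_le_conjugate hx a
      rw [mul_add, add_mul] at h3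
      simpa [mul_assoc] using h3
  have h1 := one_mem_of_alg hN hI
    (fun x hx => ⟨star x * x, ci_left hN.1 _ hx, _, ecp_zero, by simp⟩)
    (g := g) ⟨0, ci_zero hN.1, _, ecp_id, by simp⟩ hg
  simpa using h1

lemma key {ι : Type*} [Fintype ι] {N : ι → Set B} (hN : ∀ i, IsMaximalIdeal (N i))
    (d : ι → B) (hd : ∀ i j, j ≠ i → d i ∈ N j) (hd1 : ∀ i, 1 - d i ∈ N i)
    (h : B) (g : ι → B) (hg : ∀ i, g i ∉ N i) (t : ι → ℝ)
    (hp : ∀ i, 0 ≤ star (g i) * (h - t i • 1) * g i) :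
    ∃ φ : B →L[ℂ] B, IsElementaryUCP φ ∧ ∀ τ : B →L[ℂ] ℂ, IsState τ →
      (∀ x, (∀ i, x ∈ N i) → τ x = 0) →
      ∑ i, t i * (τ (star (d i) * d i)).re ≤ (τ (φ h)).re := by
  classical
  choose n hn ψ hψ hdom using fun i => exists_dom (hN i) (hg i)
  set S : ι → B := fun i => ψ i (star (g i) * g i) with hS
  have hS0 : ∀ i, 0 ≤ S i := fun i => ecp_nonneg (hψ i) (star_mul_self_nonneg _)
  have hnsa : ∀ i, IsSelfAdjoint (n i) := by
    intro i
    have h1 : IsSelfAdjoint (S i + n i - 1) := (sub_nonneg.2 (hdom i)).isSelfAdjoint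
    have h2 : n i = (S i + n i - 1) - S i + 1 := by abel
    rw [h2]
    exact (h1.sub (hS0 i).isSelfAdjoint).add (IsSelfAdjoint.one B)
  have hdd : ∀ i, 1 - star (d i) * d i ∈ N i := by
    intro i
    have e : 1 - star (d i) * d i = star (1 - d i) * d i + (1 - d i) := by
      simp only [star_sub, star_one]; noncomm_ring
    rw [e]
    exact ci_add (hN i).1 (ci_right (hN i).1 _ (ci_star (hN i).1 (hd1 i))) (hd1 i)
  have hdxd : ∀ (i k : ι) (x : B), k ≠ i → star (d i) * x * d i ∈ N k := fun i k x hk =>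
    ci_left (hN k).1 _ (hd i k hk)
  set j : B := (1 - ∑ i, star (d i) * d i) + ∑ i, star (d i) * n i * d i with hj
  have hsumdd : ∀ k, 1 - ∑ i, star (d i) * d i ∈ N k := by
    intro k
    rw [← Finset.add_sum_erase _ _ (Finset.mem_univ k), ← sub_sub]
    refine ci_sub (hN k).1 (hdd k) (ci_sum (hN k).1 _ fun i hi => ?_)
    exact ci_left (hN k).1 _ (hd i k (Finset.ne_of_mem_erase hi).symm)
  have hjN : ∀ k, j ∈ N k := by
    intro k
    refine ci_add (hN k).1 (hsumdd k) (ci_sum (hN k).1 _ fun i _ => ?_)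
    by_cases hik : k = i
    · subst hik
      exact ci_right (hN k).1 _ (ci_left (hN k).1 _ (hn k))
    · exact hdxd i k _ hik
  have hjsa : IsSelfAdjoint j := by
    refine IsSelfAdjoint.add ((IsSelfAdjoint.one B).sub ?_) ?_
    · exact isSelfAdjoint_sum _ fun i _ => IsSelfAdjoint.star_mul_self _
    · exact isSelfAdjoint_sum _ fun i _ => (hnsa i).conjugate' _
  set T : B := ∑ i, star (d i) * S i * d i + star j * j with hT
  have hT1 : (1 / 2 : ℝ) • (1 : B) ≤ T := by
    have h1 : 1 - j ≤ ∑ i, star (d i) * S i * d i := by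
      have h2 : ∑ i, star (d i) * 1 * d i ≤ ∑ i, star (d i) * (S i + n i) * d i :=
        Finset.sum_le_sum fun i _ => star_left_conjugate_le_conjugate (hdom i) (d i)
      simp only [mul_one, mul_add, add_mul, Finset.sum_add_distrib] at h2
      have e : 1 - j = ∑ i, star (d i) * d i - ∑ i, star (d i) * n i * d i := by
        rw [hj]; abel
      rw [e]
      exact sub_le_iff_le_add.2 h2
    have h3 : (0 : B) ≤ star (j - (1 / 2 : ℝ) • 1) * (j - (1 / 2 : ℝ) • 1) :=
      star_mul_self_nonneg _
    have e : star (j - (1 / 2 : ℝ) • (1 : B)) * (j - (1 / 2 : ℝ) • 1) =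
        star j * j - j + (1 / 4 : ℝ) • 1 := by
      simp only [star_sub, hjsa.star_eq, star_smul, star_one, sub_mul, mul_sub, smul_mul_assoc,
        mul_smul_comm, one_mul, mul_one, star_trivial]
      module
    have h4 : (0 : B) ≤ (1 / 4 : ℝ) • (1 : B) := smul_nonneg (by norm_num) zero_le_one
    rw [e] at h3
    have h5 := add_nonneg (add_nonneg (sub_nonneg.2 h1) h3) h4
    rw [← sub_nonneg]
    refine h5.trans_eq ?_
    rw [hT]
    module
  have hTpos : IsStrictlyPositive T := by
    refine IsStrictlyPositive.of_le ?_ hT1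
    exact IsStrictlyPositive.smul (by norm_num) isStrictlyPositive_one
  set c : B := T ^ (-(1 / 2 : ℝ)) with hc
  have hcT : c * T * c = 1 := CFC.conjugate_rpow_neg_one_half T hTpos
  have hcsa : star c = c := (CFC.rpow_nonneg (a := T)).isSelfAdjoint.star_eq
  set Φ : B → B := fun x =>
    star c * (∑ i, star (d i) * ψ i (star (g i) * x * g i) * d i + star j * x * j) * c with hΦ
  have hΦe : ECP Φ :=
    ecp_conj (ecp_add (ecp_sum _ fun i => ecp_conj (ecp_inner (hψ i) (g i)) (d i))
      (ecp_conj ecp_id j)) c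
  have hΦ1 : Φ 1 = 1 := by
    simp only [hΦ, mul_one, hcsa]
    exact hcT
  obtain ⟨φ, hφ, hφΦ⟩ := ecp_to hΦe hΦ1
  refine ⟨φ, hφ, fun τ hτ hτN => ?_⟩
  have hle : star c * (∑ i, t i • (star (d i) * S i * d i) + star j * h * j) * c ≤ φ h := by
    rw [hφΦ]
    refine star_left_conjugate_le_conjugate (add_le_add_left
      (Finset.sum_le_sum fun i _ => ?_) _) c
    have h1 := star_left_conjugate_nonneg (ecp_nonneg (hψ i) (hp i)) (d i)
    have e : star (g i) * (h - t i • 1) * g i =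
        star (g i) * h * g i - t i • (star (g i) * g i) := by
      simp [mul_sub, sub_mul]
    rw [e, ecp_map_sub (hψ i), ecp_map_smul (hψ i), mul_sub, sub_mul, sub_nonneg] at h1
    simpa using h1
  refine le_trans (le_of_eq ?_) (st_re_mono hτ hle)
  have hji : τ (star c * (star j * h * j) * c) = 0 :=
    hτN _ fun i => ci_right (hN i).1 _ (ci_left (hN i).1 _ (ci_left (hN i).1 _ (hjN i)))
  have hei : ∀ i, τ (star c * (star (d i) * S i * d i) * c) = τ (star (d i) * d i) := by
    intro i
    rw [← sub_eq_zero, ← map_sub]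
    apply hτN
    intro k
    by_cases hik : k = i
    · subst hik
      have e : star c * (star (d k) * S k * d k) * c - star (d k) * d k =
          (1 - star (d k) * d k) -
          star c * (∑ i ∈ Finset.univ.erase k, star (d i) * S i * d i + star j * j) * c := by
        have : T = star (d k) * S k * d k +
            (∑ i ∈ Finset.univ.erase k, star (d i) * S i * d i + star j * j) := by
          rw [hT, ← Finset.add_sum_erase _ _ (Finset.mem_univ k)]; abel
        rw [← hcT, this, hcsa]; noncomm_ring
      rw [e]
      refine ci_sub (hN k).1 (hdd k) (ci_right (hN k).1 _ (ci_left (hN k).1 _ 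
        (ci_add (hN k).1 (ci_sum (hN k).1 _ fun i hi => ?_) (ci_left (hN k).1 _ (hjN k)))))
      exact hdxd i k _ (Finset.ne_of_mem_erase hi).symm
    · exact ci_sub (hN k).1 (ci_right (hN k).1 _ (ci_left (hN k).1 _ (hdxd i k _ hik)))
        (ci_left (hN k).1 _ (hd i k hik))
  rw [mul_add, add_mul, map_add, hji, add_zero, Finset.mul_sum, Finset.sum_mul, map_sum,
    Complex.re_sum]
  refine Finset.sum_congr rfl fun i _ => ?_
  rw [mul_smul_comm, smul_mul_assoc, st_re_smul, hei]

end Key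

section Separation

variable {B : Type u} [CStarAlgebra B] [PartialOrder B] [StarOrderedRing B]

lemma in_closure_of_sep {S : Set (B →L[ℂ] ℂ)} (hS : Convex ℝ S) (hSst : ∀ τ ∈ S, IsState τ)
    {σ : B →L[ℂ] ℂ} (hσ : IsState σ)
    (H : ∀ h : B, IsSelfAdjoint h → ∀ ε : ℝ, 0 < ε → ∃ τ ∈ S, (σ h).re - ε ≤ (τ h).re) :
    InWeakStarClosure S σ := by
  intro ε hε n x
  let Φ : (B →L[ℂ] ℂ) →ₗ[ℝ] (Fin n → ℂ) :=
    { toFun := fun τ i => τ (x i)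
      map_add' := fun a b => by ext i; simp
      map_smul' := fun c a => by ext i; simp }
  by_contra hcon
  push Not at hcon
  have hconv : Convex ℝ (closure (Φ '' S)) := (hS.linear_image Φ).closure
  have hnot : Φ σ ∉ closure (Φ '' S) := by
    intro hmem
    obtain ⟨_, ⟨τ, hτ, rfl⟩, hd⟩ := Metric.mem_closure_iff.1 hmem ε hε
    obtain ⟨i, hi⟩ := hcon τ hτ
    have h1 := dist_le_pi_dist (Φ σ) (Φ τ) i
    rw [dist_eq_norm (Φ σ i)] at h1
    exact absurd (hi.trans h1) (not_le.2 hd)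
  obtain ⟨f, u, hf1, hf2⟩ := RCLike.geometric_hahn_banach_closed_point (𝕜 := ℂ) hconv
    isClosed_closure hnot
  set y : B := ∑ i, f (Pi.single i 1) • x i with hy
  have hfy : ∀ τ : B →L[ℂ] ℂ, f (Φ τ) = τ y := by
    intro τ
    have e : Φ τ = ∑ i, τ (x i) • (Pi.single i (1 : ℂ) : Fin n → ℂ) := by
      ext k
      simp [Φ, Finset.sum_apply, Pi.single_apply]
    rw [e, hy, map_sum, map_sum]
    refine Finset.sum_congr rfl fun i _ => ?_
    rw [map_smul, map_smul, smul_eq_mul, smul_eq_mul, mul_comm]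
  have hu : u < (σ y).re := by rw [← hfy]; exact hf2
  obtain ⟨τ, hτ, hle⟩ := H (realPart y : B) (realPart y).2 ((σ y).re - u) (by linarith)
  rw [← st_re_realPart hσ, ← st_re_realPart (hSst τ hτ)] at hle
  have h3 := hf1 (Φ τ) (subset_closure ⟨τ, hτ, rfl⟩)
  rw [hfy] at h3
  have h4 : (τ y).re < u := h3
  linarith

lemma mixSet_convex (ρ : B →L[ℂ] ℂ) : Convex ℝ (mixSet ρ) := by
  rintro _ ⟨φ, hφ, rfl⟩ _ ⟨χ, hχ, rfl⟩ s t hs ht hst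
  obtain ⟨h1, h1u⟩ := ecp_of hφ
  obtain ⟨h2, h2u⟩ := ecp_of hχ
  have hsc : ∀ (r : ℝ), 0 ≤ r → ∀ x : B,
      star (Real.sqrt r • (1 : B)) * x * (Real.sqrt r • (1 : B)) = r • x := by
    intro r hr x
    simp only [star_smul, star_one, star_trivial, smul_mul_assoc, mul_smul_comm, one_mul, mul_one,
      smul_smul, Real.mul_self_sqrt hr]
  have h3 := ecp_add (ecp_conj h1 (Real.sqrt s • (1 : B))) (ecp_conj h2 (Real.sqrt t • (1 : B)))
  simp only [hsc s hs, hsc t ht] at h3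
  obtain ⟨θ, hθ, hθe⟩ := ecp_to h3 (by rw [h1u, h2u, ← add_smul, hst, one_smul])
  refine ⟨θ, hθ, ?_⟩
  ext x
  have r1 : ∀ (r : ℝ) (z : B), ρ (r • z) = r • ρ z := fun r z => by
    have : r • z = (r : ℂ) • z := by simp
    rw [this, map_smul]; simp
  simp only [_root_.add_apply, _root_.smul_apply,
    ContinuousLinearMap.comp_apply, hθe, map_add, r1]

/-- There is a state killing any given maximal ideal. -/
lemma exists_state {N : Set B} (hN : IsMaximalIdeal N) :
    ∃ τ : B →L[ℂ] ℂ, IsState τ ∧ ∀ x ∈ N, τ x = 0 := by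
  let p : Submodule ℂ B :=
    { carrier := N
      add_mem' := fun hx hy => ci_add hN.1 hx hy
      zero_mem' := ci_zero hN.1
      smul_mem' := fun c x hx => hN.1.2.2.2.1 c x hx }
  have hdist : ∀ x ∈ p, 1 ≤ ‖(1 : B) - x‖ := by
    intro x hx
    by_contra hlt
    have hu : IsUnit x := by
      have := (Units.oneSub (1 - x) (not_le.1 hlt)).isUnit
      simpa using this
    obtain ⟨v, rfl⟩ := hu
    refine maximal_one_notMem hN ?_
    have := ci_left hN.1 (↑v⁻¹ : B) hx
    simpa using this
  have : IsClosed (p : Set B) := hN.1.1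
  obtain ⟨f, hf1, hf2⟩ := exists_dual_vector'' ℂ (p.mkQ (1 : B))
  have hqle : ∀ x, ‖p.mkQ x‖ ≤ ‖x‖ := fun x => Submodule.Quotient.norm_mk_le p x
  have hone : ‖(1 : B)‖ = 1 := by
    have : Nontrivial B := nontrivial_of_ne 1 0 fun h0 =>
      maximal_one_notMem hN (h0 ▸ ci_zero hN.1)
    exact CStarRing.norm_one
  have hq1 : ‖p.mkQ (1 : B)‖ = 1 := by
    refine le_antisymm ((hqle 1).trans hone.le) ?_
    by_contra hlt
    obtain ⟨m, hm, hml⟩ := Submodule.Quotient.norm_mk_lt (p.mkQ (1 : B))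
      (sub_pos.2 (not_le.1 hlt))
    have hmem : 1 - m ∈ p := (Submodule.Quotient.eq p).1 hm.symm
    have := hdist _ hmem
    rw [sub_sub_cancel] at this
    linarith
  let τ : B →L[ℂ] ℂ := LinearMap.mkContinuous (f.toLinearMap.comp p.mkQ) 1 (by
    intro x
    simp only [LinearMap.comp_apply]
    refine (f.le_opNorm _).trans ?_
    gcongr
    exact hqle x)
  have hτ1 : τ 1 = 1 := by
    change f (p.mkQ 1) = 1
    rw [hf2, hq1]; simp
  have hτn : ∀ x, ‖τ x‖ ≤ ‖x‖ := by
    intro x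
    have := (LinearMap.mkContinuous_norm_le (f.toLinearMap.comp p.mkQ) zero_le_one _ : ‖τ‖ ≤ 1)
    refine (τ.le_opNorm x).trans ?_
    nlinarith [norm_nonneg x]
  have hτsa : ∀ a : B, IsSelfAdjoint a → (τ a).im = 0 := by
    intro a ha
    have hb : ∀ t : ℝ, ((τ a).im + t) ^ 2 ≤ ‖a‖ ^ 2 + t ^ 2 := by
      intro t
      set b : B := a + (t * Complex.I) • (1 : B) with hb
      have h1 : τ b = τ a + t * Complex.I := by
        rw [hb, map_add, map_smul, hτ1]; simp
      have h2 : ‖τ b‖ ^ 2 ≤ ‖b‖ ^ 2 := by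
        have := hτn b
        gcongr
      have h3 : ‖b‖ ^ 2 ≤ ‖a‖ ^ 2 + t ^ 2 := by
        rw [pow_two, ← CStarRing.norm_star_mul_self]
        have e : star b * b = a * a + (t ^ 2 : ℝ) • (1 : B) := by
          have : ((t ^ 2 : ℝ) • (1 : B)) = ((t ^ 2 : ℝ) : ℂ) • (1 : B) := (Complex.coe_smul _ _).symm
          rw [this, hb]
          simp only [star_add, ha.star_eq, star_smul, star_one, add_mul, mul_add, smul_mul_assoc,
            mul_smul_comm, one_mul, mul_one]
          have e1 : star ((t : ℂ) * Complex.I) = -(t * Complex.I) := by simp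
          have e2 : -(t * Complex.I) * (t * Complex.I) = ((t ^ 2 : ℝ) : ℂ) := by
            push_cast
            linear_combination (-(t : ℂ) ^ 2) * Complex.I_mul_I
          rw [e1, ← e2]
          module
        rw [e]
        refine (norm_add_le _ _).trans ?_
        have n1 : ‖a * a‖ ≤ ‖a‖ ^ 2 := by rw [pow_two]; exact norm_mul_le _ _
        have n2 : ‖(t ^ 2 : ℝ) • (1 : B)‖ ≤ t ^ 2 := by
          rw [norm_smul, Real.norm_of_nonneg (by positivity)]
          have : ‖(1 : B)‖ ≤ 1 := hone.le
          nlinarith [sq_nonneg t]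
        linarith
      have h4 : ((τ b).im) ^ 2 ≤ ‖τ b‖ ^ 2 := by
        rw [← sq_abs]
        have := Complex.abs_im_le_norm (τ b)
        gcongr
      have h5 : (τ b).im = (τ a).im + t := by rw [h1]; simp
      rw [← h5]; linarith
    by_contra hne
    have h1 := hb ((‖a‖ ^ 2) / (τ a).im)
    have h2 : (τ a).im * ((‖a‖ ^ 2) / (τ a).im) = ‖a‖ ^ 2 := by field_simp
    have h3 : 0 < (τ a).im ^ 2 := by positivity
    nlinarith [sq_nonneg ‖a‖]
  refine ⟨τ, ⟨?_, hτ1⟩, ?_⟩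
  · intro a
    set b := star a * a with hb
    have hb0 : 0 ≤ b := star_mul_self_nonneg a
    rw [Complex.le_def]
    refine ⟨?_, (hτsa b hb0.isSelfAdjoint).symm⟩
    have h1 : ‖algebraMap ℝ B ‖b‖ - b‖ ≤ ‖b‖ := by
      have hs : 0 ≤ algebraMap ℝ B ‖b‖ - b :=
        sub_nonneg.2 hb0.isSelfAdjoint.le_algebraMap_norm_self
      rw [CStarAlgebra.norm_le_iff_le_algebraMap _ (norm_nonneg b) hs]
      exact sub_le_self _ hb0
    have h2 := (hτn _).trans h1
    have h3 : τ (algebraMap ℝ B ‖b‖ - b) = ‖b‖ - τ b := by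
      rw [map_sub]
      have : algebraMap ℝ B ‖b‖ = (‖b‖ : ℂ) • (1 : B) := by
        rw [Algebra.algebraMap_eq_smul_one]; simp
      rw [this, map_smul, hτ1]; simp
    rw [h3] at h2
    have h4 := (Complex.re_le_norm _).trans h2
    simp only [Complex.sub_re, Complex.ofReal_re] at h4
    simp only [Complex.zero_re]
    linarith
  · intro x hx
    change f (p.mkQ x) = 0
    have : p.mkQ x = 0 := (Submodule.Quotient.mk_eq_zero p).2 hx
    rw [this, map_zero]

end Separation

section Final

variable {B : Type u} [CStarAlgebra B] [PartialOrder B] [StarOrderedRing B]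

lemma posPart_conj {a : B} (ha : IsSelfAdjoint a) : 0 ≤ star a⁺ * a * a⁺ := by
  have h0 : 0 ≤ a⁺ := CFC.posPart_nonneg a
  have e : star a⁺ * a * a⁺ = star a⁺ * a⁺ * a⁺ := by
    conv_lhs => enter [1, 2]; rw [← CFC.posPart_sub_negPart a]
    rw [mul_sub, sub_mul, mul_assoc (star a⁺) a⁻, CFC.negPart_mul_posPart]
    simp
  rw [e]
  exact star_left_conjugate_nonneg h0 _

lemma le_posPart_sa {a : B} (ha : IsSelfAdjoint a) : a ≤ a⁺ := by
  conv_lhs => rw [← CFC.posPart_sub_negPart a]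
  exact sub_le_self _ (CFC.negPart_nonneg a)

lemma sa_sub_smul {h : B} (hh : IsSelfAdjoint h) (t : ℝ) : IsSelfAdjoint (h - t • (1 : B)) :=
  hh.sub ((IsSelfAdjoint.all t).smul (IsSelfAdjoint.one B))

lemma mixed_inj {ι : Type*} [Fintype ι] {N : ι → Set B} (hN : ∀ i, IsMaximalIdeal (N i))
    (hinj : Function.Injective N) {ω : B →L[ℂ] ℂ} (hω : IsState ω)
    (hωN : ∀ x : B, (∀ i, x ∈ N i) → ω x = 0) : IsMaximallyMixed ω := by
  classical
  refine ⟨hω, fun ρ hρ hcl => ?_⟩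
  choose d hd hd1 using exists_d hN hinj
  have hdd : ∀ i, 1 - star (d i) * d i ∈ N i := by
    intro i
    have e : 1 - star (d i) * d i = star (1 - d i) * d i + (1 - d i) := by
      simp only [star_sub, star_one]; noncomm_ring
    rw [e]
    exact ci_add (hN i).1 (ci_right (hN i).1 _ (ci_star (hN i).1 (hd1 i))) (hd1 i)
  have happ : ∀ x : B, (∀ φ : B →L[ℂ] B, IsElementaryUCP φ → ω (φ x) = ω x) → ρ x = ω x := by
    intro x hx
    by_contra hne
    have hpos : 0 < ‖ρ x - ω x‖ := norm_pos_iff.2 (sub_ne_zero.2 hne)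
    obtain ⟨_, ⟨φ, hφ, rfl⟩, h2⟩ := hcl _ hpos 1 (fun _ => x)
    have := h2 0
    rw [ContinuousLinearMap.comp_apply, hx φ hφ] at this
    exact lt_irrefl _ this
  have hρN : ∀ x : B, (∀ i, x ∈ N i) → ρ x = 0 := by
    intro x hx
    rw [happ x, hωN x hx]
    intro φ hφ
    rw [hωN x hx, hωN]
    exact fun i => ecp_mem (ecp_of hφ).1 (hN i).1 (hx i)
  have hρd : ∀ i, ρ (star (d i) * d i) = ω (star (d i) * d i) := by
    intro i
    apply happ
    intro φ hφ
    obtain ⟨h1, h2⟩ := ecp_of hφ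
    rw [← sub_eq_zero, ← map_sub]
    apply hωN
    intro k
    by_cases hik : k = i
    · subst hik
      have e : φ (star (d k) * d k) - star (d k) * d k =
          (1 - star (d k) * d k) - φ (1 - star (d k) * d k) := by
        rw [map_sub, h2]; abel
      rw [e]
      exact ci_sub (hN k).1 (hdd k) (ecp_mem h1 (hN k).1 (hdd k))
    · have := ci_left (hN k).1 (star (d i)) (hd i k hik)
      exact ci_sub (hN k).1 (ecp_mem h1 (hN k).1 this) this
  refine in_closure_of_sep (mixSet_convex ρ) ?_ hω ?_
  · rintro _ ⟨φ, hφ, rfl⟩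
    exact st_comp hρ hφ
  intro h hh ε hε
  set lam : ι → ℝ := fun i => (ω (star (d i) * d i)).re with hlam
  set r : ι → ℝ := fun i => (ω (star (d i) * h * d i)).re with hr
  have hlam0 : ∀ i, 0 ≤ lam i := fun i => st_re_nonneg hω (star_mul_self_nonneg _)
  have hsum : ∀ x : B, ω x = ∑ i, ω (star (d i) * x * d i) := by
    intro x
    rw [← map_sum, ← sub_eq_zero, ← map_sub]
    apply hωN
    intro k
    rw [← Finset.add_sum_erase _ _ (Finset.mem_univ k), ← sub_sub]
    refine ci_sub (hN k).1 ?_ (ci_sum (hN k).1 _ fun i hi => ?_)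
    · have e : x - star (d k) * x * d k = star (1 - d k) * (x * d k) + x * (1 - d k) := by
        simp only [star_sub, star_one]; noncomm_ring
      rw [e]
      exact ci_add (hN k).1 (ci_right (hN k).1 _ (ci_star (hN k).1 (hd1 k)))
        (ci_left (hN k).1 _ (hd1 k))
    · exact ci_left (hN k).1 _ (hd i k (Finset.ne_of_mem_erase hi).symm)
  have hlam1 : ∑ i, lam i = 1 := by
    have := congrArg Complex.re (hsum 1)
    rw [hω.2, Complex.re_sum] at this
    simpa [hlam] using this.symm
  have hr1 : (ω h).re = ∑ i, r i := by
    rw [hsum h, Complex.re_sum]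
  have hch : ∀ i, ∃ (t : ℝ) (g : B), g ∉ N i ∧ 0 ≤ star g * (h - t • 1) * g ∧
      r i - ε * lam i ≤ t * lam i := by
    intro i
    rcases (hlam0 i).eq_or_lt with h0 | hpos
    · refine ⟨-‖h‖, 1, maximal_one_notMem (hN i), ?_, ?_⟩
      · have := hh.neg_algebraMap_norm_le_self
        rw [Algebra.algebraMap_eq_smul_one, neg_le_iff_add_nonneg] at this
        simpa using this
      · rw [← h0]
        have h1 := st_re_mono hω (star_left_conjugate_le_conjugate
          hh.le_algebraMap_norm_self (d i))
        rw [Algebra.algebraMap_eq_smul_one, mul_smul_comm, smul_mul_assoc, mul_one,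
          st_re_smul] at h1
        change r i ≤ ‖h‖ * lam i at h1
        rw [← h0] at h1
        simpa using h1
    · set t : ℝ := r i / lam i - ε with ht
      have htl : t * lam i = r i - ε * lam i := by rw [ht]; field_simp
      have hsa := sa_sub_smul hh t
      refine ⟨t, (h - t • (1 : B))⁺, ?_, posPart_conj hsa, htl.ge⟩
      intro hmem
      have h1 := st_re_mono hω (star_left_conjugate_le_conjugate (le_posPart_sa hsa) (d i))
      have h2 : ω (star (d i) * (h - t • (1 : B))⁺ * d i) = 0 := by
        apply hωN
        intro k
        by_cases hik : k = i
        · subst hik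
          exact ci_right (hN k).1 _ (ci_left (hN k).1 _ hmem)
        · exact ci_left (hN k).1 _ (hd i k hik)
      rw [h2, mul_sub, sub_mul, map_sub, Complex.sub_re, mul_smul_comm, smul_mul_assoc, mul_one,
        st_re_smul] at h1
      change r i - t * lam i ≤ 0 at h1
      rw [htl] at h1
      have : 0 < ε * lam i := by positivity
      linarith
  choose t g hg hp ht using hch
  obtain ⟨φ, hφ, hφle⟩ := key hN d (fun i j hj => hd i j hj) hd1 h g hg t hp
  refine ⟨ρ.comp φ, ⟨φ, hφ, rfl⟩, ?_⟩
  have h1 := hφle ρ hρ hρN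
  simp only [hρd] at h1
  refine le_trans ?_ h1
  calc (ω h).re - ε = ∑ i, (r i - ε * lam i) := by
        rw [Finset.sum_sub_distrib, ← hr1, ← Finset.mul_sum, hlam1, mul_one]
    _ ≤ ∑ i, t i * lam i := Finset.sum_le_sum fun i _ => ht i

lemma mixed_finite {n : ℕ} {N : Fin n → Set B} (hN : ∀ i, IsMaximalIdeal (N i))
    {ω : B →L[ℂ] ℂ} (hω : IsState ω)
    (hωN : ∀ x : B, (∀ i, x ∈ N i) → ω x = 0) : IsMaximallyMixed ω := by
  classical
  have : Fintype (Set.range N) := Fintype.ofFinite _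
  refine mixed_inj (ι := Set.range N) (N := Subtype.val) ?_ Subtype.val_injective hω ?_
  · rintro ⟨_, i, rfl⟩; exact hN i
  · intro x hx
    exact hωN x fun i => hx ⟨N i, i, rfl⟩

lemma dense {σ : B →L[ℂ] ℂ} (hσ : IsState σ) (hσJ : ∀ x ∈ strongRadical B, σ x = 0) :
    InWeakStarClosure {ω : B →L[ℂ] ℂ | IsMaximallyMixed ω} σ := by
  set S : Set (B →L[ℂ] ℂ) := {ω | IsState ω ∧ ∃ (n : ℕ) (N : Fin n → Set B),
    (∀ i, IsMaximalIdeal (N i)) ∧ ∀ x : B, (∀ i, x ∈ N i) → ω x = 0} with hS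
  have hmain : InWeakStarClosure S σ := by
    refine in_closure_of_sep ?_ (fun τ hτ => hτ.1) hσ ?_
    · rintro ω ⟨hω, n, N, hN, hωN⟩ ρ ⟨hρ, m, M, hM, hρM⟩ s t hs ht hst
      refine ⟨⟨?_, ?_⟩, n + m, Fin.append N M, ?_, ?_⟩
      · intro a
        have h1 := hω.1 a
        have h2 := hρ.1 a
        have hsc : (0 : ℂ) ≤ s := by exact_mod_cast hs
        have htc : (0 : ℂ) ≤ t := by exact_mod_cast ht
        have := add_nonneg (mul_nonneg hsc h1) (mul_nonneg htc h2)
        simpa using this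
      · simp only [_root_.add_apply, _root_.smul_apply, hω.2, hρ.2]
        rw [← add_smul, hst, one_smul]
      · intro i
        refine Fin.addCases (fun i => ?_) (fun i => ?_) i
        · rw [Fin.append_left]; exact hN i
        · rw [Fin.append_right]; exact hM i
      · intro x hx
        rw [_root_.add_apply, _root_.smul_apply,
          _root_.smul_apply, hωN x, hρM x]
        · simp
        · intro i; simpa using hx (Fin.natAdd n i)
        · intro i; simpa using hx (Fin.castAdd m i)
    · intro h hh ε hε
      set t : ℝ := (σ h).re - ε with ht
      have hsa := sa_sub_smul hh t
      have hex : ∃ M : Set B, IsMaximalIdeal M ∧ (h - t • (1 : B))⁺ ∉ M := by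
        by_contra hcon
        push Not at hcon
        have h1 := st_re_mono hσ (le_posPart_sa hsa)
        rw [hσJ _ (Set.mem_sInter.2 fun M hM => hcon M hM), map_sub, Complex.sub_re, st_re_smul,
          hσ.2] at h1
        simp only [Complex.one_re, Complex.zero_re, mul_one] at h1
        linarith
      obtain ⟨M, hM, hgM⟩ := hex
      obtain ⟨τ, hτ, hτM⟩ := exists_state hM
      obtain ⟨φ, hφ, hle⟩ := key (ι := Unit) (N := fun _ => M) (fun _ => hM) (fun _ => 1)
        (fun i j hij => absurd (Subsingleton.elim j i) hij)
        (fun _ => by simpa using ci_zero hM.1) h (fun _ => (h - t • (1 : B))⁺) (fun _ => hgM)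
        (fun _ => t) (fun _ => posPart_conj hsa)
      refine ⟨τ.comp φ, ⟨st_comp hτ hφ, 1, fun _ => M, fun _ => hM, fun x hx => ?_⟩, ?_⟩
      · exact hτM _ (ecp_mem (ecp_of hφ).1 hM.1 (hx 0))
      · have := hle τ hτ (fun x hx => hτM x (hx ()))
        simpa [hτ.2] using this
  intro ε hε n x
  obtain ⟨τ, ⟨hτ, m, N, hN, hτN⟩, hx⟩ := hmain ε hε n x
  exact ⟨τ, mixed_finite hN hτ hτN, hx⟩

end Final

end MMAux

/-- **Theorem.** If a state `ω` annihilates an intersection of finitely many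
maximal closed two-sided ideals of `A`, then `ω` is maximally mixed.
Consequently the set of maximally mixed states is weak*-dense in the set of
states annihilating the strong radical. -/
theorem maximallyMixed_of_annihilates_finite_inter_and_dense :
    (∀ (n : ℕ) (N : Fin n → Set A), (∀ i, IsMaximalIdeal (N i)) →
      ∀ ω : A →L[ℂ] ℂ, IsState ω → (∀ x : A, (∀ i, x ∈ N i) → ω x = 0) →
        IsMaximallyMixed ω) ∧
    (∀ σ : A →L[ℂ] ℂ, IsState σ → (∀ x ∈ strongRadical A, σ x = 0) →
      InWeakStarClosure {ω : A →L[ℂ] ℂ | IsMaximallyMixed ω} σ) := by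
  let _ : CStarAlgebra A := {}
  let _ := CStarAlgebra.spectralOrder A
  have := CStarAlgebra.spectralOrderedRing A
  exact ⟨fun n N hN ω hω hωN => MMAux.mixed_finite hN hω hωN,
    fun σ hσ hσJ => MMAux.dense hσ hσJ⟩

end
end

section
/- Let A be a unital C*-algebra. If the set S_m(A) of all maximally mixed states on A is weak* closed (equivalently, S_m(A) equals the set of all states annihilating the strong radical J_A), then every primitive ideal of A containing J_A is a maximal ideal. Conversely, if A is weakly central and every primitive ideal of A containing J_A is maximal, then S_m(A) equals the set of all states annihilating J_A. -/
universe u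

open scoped ComplexConjugate ComplexOrder

noncomputable section

variable {A : Type u} [NormedRing A] [StarRing A] [CStarRing A]
  [NormedAlgebra ℂ A] [StarModule ℂ A] [CompleteSpace A]

/-- A witness that `P` is the kernel of an irreducible representation of `A`
on some Hilbert space. -/
structure IrreducibleRepWitness (A : Type u) [NormedRing A] [StarRing A] [CStarRing A]
    [NormedAlgebra ℂ A] [StarModule ℂ A] [CompleteSpace A] (P : Set A) :
    Type (u + 1) where
  /-- the Hilbert space of the representation -/
  space : Type u
  [nacg : NormedAddCommGroup space]
  [ips : InnerProductSpace ℂ space]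
  [cplt : CompleteSpace space]
  [nontriv : Nontrivial space]
  /-- the representation -/
  π : A →L[ℂ] (space →L[ℂ] space)
  map_mul' : ∀ x y : A, π (x * y) = π x * π y
  map_star' : ∀ x : A, π (star x) = star (π x)
  map_one' : π 1 = 1
  /-- topological irreducibility: every nonzero vector is cyclic -/
  irreducible' : ∀ ξ : space, ξ ≠ 0 → Dense {η : space | ∃ a : A, η = π a ξ}
  ker_eq' : P = {a : A | π a = 0}

/-- `P` is a primitive ideal: the kernel of some irreducible representation. -/
def IsPrimitiveIdeal (P : Set A) : Prop :=
  Nonempty (IrreducibleRepWitness A P)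

/-- The primitive spectrum of `A` is Hausdorff: any two distinct points of the
primitive spectrum can be separated by disjoint basic open sets of the
hull-kernel topology. -/
def HasHausdorffPrimitiveSpectrum
    (A : Type u) [NormedRing A] [StarRing A] [CStarRing A]
    [NormedAlgebra ℂ A] [StarModule ℂ A] [CompleteSpace A] : Prop :=
  ∀ P Q : Set A, IsPrimitiveIdeal P → IsPrimitiveIdeal Q → P ≠ Q →
    ∃ I J : Set A, IsClosedIdeal I ∧ IsClosedIdeal J ∧ ¬I ⊆ P ∧ ¬J ⊆ Q ∧
      ∀ S : Set A, IsPrimitiveIdeal S → I ⊆ S ∨ J ⊆ S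

namespace MM
variable {B : Type u} [CStarAlgebra B] [PartialOrder B] [StarOrderedRing B]

/-! ### Basic facts on positive functionals -/

theorem exists_sq {a : B} (ha : 0 ≤ a) : ∃ b : B, a = star b * b := by
  refine ⟨CFC.sqrt a, ?_⟩
  rw [(CFC.sqrt_nonneg a).isSelfAdjoint.star_eq, CFC.sqrt_mul_sqrt_self a ha]

theorem pf_nonneg {f : B →L[ℂ] ℂ} (hf : IsPositiveFunctional f) {a : B} (ha : 0 ≤ a) :
    0 ≤ f a := by
  obtain ⟨b, rfl⟩ := exists_sq ha
  exact hf b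

/-- bundled positive linear map -/
def plm (f : B →L[ℂ] ℂ) (hf : IsPositiveFunctional f) : B →ₚ[ℂ] ℂ :=
  PositiveLinearMap.mk₀ f.toLinearMap (fun _ hx => pf_nonneg hf hx)

theorem plm_apply (f : B →L[ℂ] ℂ) (hf : IsPositiveFunctional f) (a : B) : plm f hf a = f a := rfl

theorem pf_re_nonneg {f : B →L[ℂ] ℂ} (hf : IsPositiveFunctional f) {a : B} (ha : 0 ≤ a) :
    0 ≤ (f a).re := (Complex.le_def.1 (pf_nonneg hf ha)).1

theorem pf_re_mono {f : B →L[ℂ] ℂ} (hf : IsPositiveFunctional f) {a b : B} (h : a ≤ b) :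
    (f a).re ≤ (f b).re := by
  have := pf_re_nonneg hf (sub_nonneg.2 h)
  simp at this; linarith

theorem pf_herm {f : B →L[ℂ] ℂ} (hf : IsPositiveFunctional f) (a : B) :
    f (star a) = conj (f a) := by
  have := map_star (plm f hf) a
  simpa [plm_apply] using this

theorem pf_im {f : B →L[ℂ] ℂ} (hf : IsPositiveFunctional f) {a : B} (ha : IsSelfAdjoint a) :
    (f a).im = 0 := by
  have := pf_herm hf a
  rw [ha.star_eq] at this
  exact Complex.conj_eq_iff_im.1 this.symm

theorem pf_eq_re {f : B →L[ℂ] ℂ} (hf : IsPositiveFunctional f) {a : B} (ha : IsSelfAdjoint a) :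
    f a = ((f a).re : ℂ) := by
  apply Complex.ext <;> simp [pf_im hf ha]

theorem pf_cs {f : B →L[ℂ] ℂ} (hf : IsPositiveFunctional f) (a b : B) :
    ‖f (star a * b)‖ ^ 2 ≤ (f (star a * a)).re * (f (star b * b)).re := by
  have h := norm_inner_le_norm (𝕜 := ℂ) ((plm f hf).toPreGNS a) ((plm f hf).toPreGNS b)
  rw [PositiveLinearMap.preGNS_inner_def, PositiveLinearMap.preGNS_norm_def,
    PositiveLinearMap.preGNS_norm_def] at h
  simp only [PositiveLinearMap.ofPreGNS_toPreGNS, plm_apply] at h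
  have h1 := pf_re_nonneg hf (star_mul_self_nonneg a)
  have h2 := pf_re_nonneg hf (star_mul_self_nonneg b)
  calc _ ≤ (√(f (star a * a)).re * √(f (star b * b)).re) ^ 2 :=
        pow_le_pow_left₀ (norm_nonneg _) h 2
    _ = _ := by rw [mul_pow, Real.sq_sqrt h1, Real.sq_sqrt h2]

theorem pf_cs1 {f : B →L[ℂ] ℂ} (hf : IsPositiveFunctional f) (b : B) :
    ‖f b‖ ^ 2 ≤ (f 1).re * (f (star b * b)).re := by
  simpa using pf_cs hf 1 b

theorem pf_zero_of_sq {f : B →L[ℂ] ℂ} (hf : IsPositiveFunctional f) {b : B}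
    (h : f (star b * b) = 0) : f b = 0 := by
  have := pf_cs1 hf b
  rw [h] at this
  simp at this
  simpa using this

theorem pf_zero_of_one {f : B →L[ℂ] ℂ} (hf : IsPositiveFunctional f)
    (h : f 1 = 0) : f = 0 := by
  ext b
  have := pf_cs1 hf b
  rw [h] at this
  simp at this
  simpa using this

theorem algMap_eq (r : ℝ) : algebraMap ℝ B r = (r : ℂ) • (1 : B) := by
  rw [Algebra.algebraMap_eq_smul_one]; simp

theorem sa_le_norm {a : B} (ha : IsSelfAdjoint a) : a ≤ ((‖a‖ : ℝ) : ℂ) • (1 : B) := by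
  rw [← algMap_eq]; exact ha.le_algebraMap_norm_self

theorem sa_ge_norm {a : B} (ha : IsSelfAdjoint a) : -(((‖a‖ : ℝ) : ℂ) • (1 : B)) ≤ a := by
  rw [← algMap_eq]; exact ha.neg_algebraMap_norm_le_self

theorem st_re_le {f : B →L[ℂ] ℂ} (hf : IsState f) {a : B} (ha : IsSelfAdjoint a) :
    (f a).re ≤ ‖a‖ := by
  have := pf_re_mono hf.1 (sa_le_norm ha)
  simpa [hf.2] using this

theorem st_cs {f : B →L[ℂ] ℂ} (hf : IsState f) (b : B) :
    ‖f b‖ ^ 2 ≤ (f (star b * b)).re := by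
  simpa [hf.2] using pf_cs1 hf.1 b

theorem st_norm_le {f : B →L[ℂ] ℂ} (hf : IsState f) (b : B) : ‖f b‖ ≤ ‖b‖ := by
  have h1 := st_cs hf b
  have h2 := st_re_le hf (IsSelfAdjoint.star_mul_self b)
  rw [CStarRing.norm_star_mul_self] at h2
  have : ‖f b‖ ^ 2 ≤ ‖b‖ ^ 2 := by nlinarith
  exact (sq_le_sq₀ (norm_nonneg _) (norm_nonneg _)).1 this

/-- conjugated functional -/
def conjF (f : B →L[ℂ] ℂ) (y : B) : B →L[ℂ] ℂ :=
  f.comp (ContinuousLinearMap.mulLeftRight ℂ B (star y) y)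

theorem conjF_apply (f : B →L[ℂ] ℂ) (y x : B) : conjF f y x = f (star y * x * y) := rfl

theorem conjF_pos {f : B →L[ℂ] ℂ} (hf : IsPositiveFunctional f) (y : B) :
    IsPositiveFunctional (conjF f y) := by
  intro a
  rw [conjF_apply]
  have := hf (a * y)
  rwa [star_mul, ← mul_assoc, mul_assoc (star y)] at this

/-- normalisation of a positive functional -/
theorem normalize {f : B →L[ℂ] ℂ} (hf : IsPositiveFunctional f) (h : f 1 ≠ 0) :
    ∃ c : ℝ, 0 < c ∧ f 1 = (c : ℂ) ∧ IsState (((c⁻¹ : ℝ) : ℂ) • f) := by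
  have h1 := pf_eq_re hf (IsSelfAdjoint.one B)
  have h0 := pf_re_nonneg hf (zero_le_one (α := B))
  have hc : 0 < (f 1).re := by
    rcases h0.lt_or_eq with h2 | h2
    · exact h2
    · rw [← h2] at h1; exact absurd (by simpa using h1) h
  refine ⟨(f 1).re, hc, h1, ?_, ?_⟩
  · intro a
    have h2 := hf a
    have h3 : (0 : ℂ) ≤ (((f 1).re⁻¹ : ℝ) : ℂ) := by
      rw [Complex.zero_le_real]; positivity
    simpa using mul_nonneg h3 h2
  · rw [ContinuousLinearMap.smul_apply, h1, smul_eq_mul, ← Complex.ofReal_mul]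
    simp [hc.ne']

/-! ### Ideals -/

section ideals
variable {I : Set B}

theorem ci_mul_left (hI : IsClosedIdeal I) (a : B) {x : B} (hx : x ∈ I) : a * x ∈ I :=
  (hI.2.2.2.2 a x hx).1
theorem ci_mul_right (hI : IsClosedIdeal I) (a : B) {x : B} (hx : x ∈ I) : x * a ∈ I :=
  (hI.2.2.2.2 a x hx).2
theorem ci_add (hI : IsClosedIdeal I) {x y : B} (hx : x ∈ I) (hy : y ∈ I) : x + y ∈ I :=
  hI.2.2.1 x hx y hy
theorem ci_smul (hI : IsClosedIdeal I) (c : ℂ) {x : B} (hx : x ∈ I) : c • x ∈ I :=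
  hI.2.2.2.1 c x hx
theorem ci_zero (hI : IsClosedIdeal I) : (0 : B) ∈ I := hI.2.1
theorem ci_neg (hI : IsClosedIdeal I) {x : B} (hx : x ∈ I) : -x ∈ I := by
  simpa using ci_smul hI (-1) hx
theorem ci_sub (hI : IsClosedIdeal I) {x y : B} (hx : x ∈ I) (hy : y ∈ I) : x - y ∈ I := by
  rw [sub_eq_add_neg]; exact ci_add hI hx (ci_neg hI hy)
theorem ci_sum (hI : IsClosedIdeal I) {ι : Type*} (s : Finset ι) {x : ι → B}
    (hx : ∀ i ∈ s, x i ∈ I) : ∑ i ∈ s, x i ∈ I := by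
  classical
  induction s using Finset.induction_on with
  | empty => simpa using ci_zero hI
  | insert a s ha ih =>
    rw [Finset.sum_insert ha]
    exact ci_add hI (hx _ (by simp)) (ih (fun i hi => hx i (by simp [hi])))
theorem ci_univ_of_one (hI : IsClosedIdeal I) (h : (1 : B) ∈ I) : I = Set.univ :=
  Set.eq_univ_of_forall (fun a => by simpa using ci_mul_left hI a h)
theorem ci_one_of_near (hI : IsClosedIdeal I) {x : B} (hx : x ∈ I) (h : ‖1 - x‖ < 1) :
    (1 : B) ∈ I := by
  have : IsUnit x := by
    have := (Units.oneSub (1 - x) h).isUnit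
    simpa using this
  obtain ⟨u, rfl⟩ := this
  simpa using ci_mul_left hI (↑u⁻¹ : B) hx

/-- A functional kills a set. -/
def Kills (f : B →L[ℂ] ℂ) (I : Set B) : Prop := ∀ x ∈ I, f x = 0

theorem kills_conjF (hI : IsClosedIdeal I) {f : B →L[ℂ] ℂ} (hf : Kills f I) (y : B) :
    Kills (conjF f y) I := fun x hx =>
  hf _ (ci_mul_right hI _ (ci_mul_left hI _ hx))

/-- The closure of the set of sums `i + t`, `i ∈ I`, `t ∈ span {a s b}`. -/
def genSpan (S : Set B) : Submodule ℂ B := Submodule.span ℂ {x | ∃ a b, ∃ s ∈ S, x = a * s * b}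

theorem genSpan_mul (S : Set B) (c : B) {x : B} (hx : x ∈ genSpan S) :
    c * x ∈ genSpan S ∧ x * c ∈ genSpan S := by
  induction hx using Submodule.span_induction with
  | mem x hx =>
    obtain ⟨a, b, s, hs, rfl⟩ := hx
    exact ⟨Submodule.subset_span ⟨c * a, b, s, hs, by simp [mul_assoc]⟩,
      Submodule.subset_span ⟨a, b * c, s, hs, by simp [mul_assoc]⟩⟩
  | zero => simp
  | add x y _ _ hx hy =>
    rw [mul_add, add_mul]; exact ⟨add_mem hx.1 hy.1, add_mem hx.2 hy.2⟩
  | smul r x _ hx =>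
    rw [mul_smul_comm, smul_mul_assoc]
    exact ⟨Submodule.smul_mem _ _ hx.1, Submodule.smul_mem _ _ hx.2⟩

theorem subset_genSpan (S : Set B) : S ⊆ genSpan S := fun s hs =>
  Submodule.subset_span ⟨1, 1, s, hs, by simp⟩

/-- the closed ideal generated by a set -/
def genIdeal (S : Set B) : Set B := closure (genSpan S : Set B)

theorem genIdeal_closed (S : Set B) : IsClosedIdeal (genIdeal S) := by
  have e : genIdeal S = ((genSpan S).topologicalClosure : Set B) := rfl
  refine ⟨isClosed_closure, ?_, ?_, ?_, ?_⟩
  · rw [e]; exact zero_mem _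
  · rw [e]; intro x hx y hy; exact add_mem hx hy
  · rw [e]; intro c x hx; exact Submodule.smul_mem _ _ hx
  · intro a x hx
    refine ⟨?_, ?_⟩
    · exact map_mem_closure (f := fun x => a * x) (by fun_prop) hx
        (fun y hy => (genSpan_mul S a hy).1)
    · exact map_mem_closure (f := fun x => x * a) (by fun_prop) hx
        (fun y hy => (genSpan_mul S a hy).2)

theorem subset_genIdeal (S : Set B) : S ⊆ genIdeal S :=
  (subset_genSpan S).trans subset_closure

theorem genSpan_le (hI : IsClosedIdeal I) {S : Set B} (h : S ⊆ I) {x : B} (hx : x ∈ genSpan S) :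
    x ∈ I := by
  induction hx using Submodule.span_induction with
  | mem x hx =>
    obtain ⟨a, b, s, hs, rfl⟩ := hx
    exact ci_mul_right hI _ (ci_mul_left hI _ (h hs))
  | zero => exact ci_zero hI
  | add x y _ _ hx hy => exact ci_add hI hx hy
  | smul r x _ hx => exact ci_smul hI r hx

theorem genIdeal_le (hI : IsClosedIdeal I) {S : Set B} (h : S ⊆ I) : genIdeal S ⊆ I :=
  closure_minimal (fun _ hx => genSpan_le hI h hx) hI.1

theorem ne_univ_iff (hI : IsClosedIdeal I) : I ≠ Set.univ ↔ (1 : B) ∉ I :=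
  ⟨fun h h1 => h (ci_univ_of_one hI h1), fun h h1 => h (h1 ▸ Set.mem_univ _)⟩

theorem exists_maximal (hI : IsClosedIdeal I) (h : (1 : B) ∉ I) :
    ∃ M, IsMaximalIdeal M ∧ I ⊆ M := by
  obtain ⟨M, hIM, hM⟩ := zorn_subset_nonempty {J : Set B | IsClosedIdeal J ∧ (1 : B) ∉ J} (by
    intro c hc hchain hne
    refine ⟨genIdeal (⋃₀ c), ⟨genIdeal_closed _, ?_⟩,
      fun s hs => (Set.subset_sUnion_of_mem hs).trans (subset_genIdeal _)⟩
    intro h1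
    obtain ⟨x, hx, hx1⟩ := Metric.mem_closure_iff.1 h1 1 one_pos
    have : ∃ s ∈ c, x ∈ s := by
      have hx' : x ∈ genSpan (⋃₀ c) := hx
      clear hx hx1
      induction hx' using Submodule.span_induction with
      | mem x hx =>
        obtain ⟨a, b, s, ⟨t, ht, hs⟩, rfl⟩ := hx
        exact ⟨t, ht, ci_mul_right (hc ht).1 _ (ci_mul_left (hc ht).1 _ hs)⟩
      | zero => obtain ⟨s, hs⟩ := hne; exact ⟨s, hs, ci_zero (hc hs).1⟩
      | add x y _ _ hx hy =>
        obtain ⟨s, hs, hxs⟩ := hx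
        obtain ⟨t, ht, hyt⟩ := hy
        rcases hchain.total hs ht with hst | hst
        · exact ⟨t, ht, ci_add (hc ht).1 (hst hxs) hyt⟩
        · exact ⟨s, hs, ci_add (hc hs).1 hxs (hst hyt)⟩
      | smul r x _ hx =>
        obtain ⟨s, hs, hxs⟩ := hx
        exact ⟨s, hs, ci_smul (hc hs).1 r hxs⟩
    obtain ⟨s, hs, hxs⟩ := this
    exact (hc hs).2 (ci_one_of_near (hc hs).1 hxs (by rwa [dist_eq_norm] at hx1))) I ⟨hI, h⟩
  refine ⟨M, ⟨hM.1.1, (ne_univ_iff hM.1.1).2 hM.1.2, fun N hN hN1 hMN => ?_⟩, hIM⟩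
  exact (hM.2 ⟨hN, (ne_univ_iff hN).1 hN1⟩ hMN).antisymm hMN

theorem sInter_closed (F : Set (Set B)) (hF : ∀ N ∈ F, IsClosedIdeal N) : IsClosedIdeal (⋂₀ F) := by
  refine ⟨isClosed_sInter (fun N hN => (hF N hN).1), fun N hN => ci_zero (hF N hN),
    fun x hx y hy N hN => ci_add (hF N hN) (hx N hN) (hy N hN),
    fun c x hx N hN => ci_smul (hF N hN) c (hx N hN),
    fun a x hx => ⟨fun N hN => ci_mul_left (hF N hN) a (hx N hN),
      fun N hN => ci_mul_right (hF N hN) a (hx N hN)⟩⟩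

end ideals
end MM

namespace MM
variable {B : Type u} [CStarAlgebra B] [PartialOrder B] [StarOrderedRing B]

/-! ### Elementary maps -/

/-- The elementary map with given coefficients. -/
def elemMap {n : ℕ} (a : Fin n → B) : B →L[ℂ] B :=
  ∑ i, ContinuousLinearMap.mulLeftRight ℂ B (star (a i)) (a i)

theorem elemMap_apply {n : ℕ} (a : Fin n → B) (x : B) :
    elemMap a x = ∑ i, star (a i) * x * a i := by
  simp [elemMap]

theorem elemMap_ucp {n : ℕ} (a : Fin n → B) (h : ∑ i, star (a i) * a i = 1) :
    IsElementaryUCP (elemMap a) := ⟨n, a, h, elemMap_apply a⟩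

theorem state_comp {σ : B →L[ℂ] ℂ} (hσ : IsState σ) {φ : B →L[ℂ] B} (hφ : IsElementaryUCP φ) :
    IsState (σ.comp φ) := by
  obtain ⟨n, a, h1, h⟩ := hφ
  refine ⟨fun x => ?_, ?_⟩
  · rw [ContinuousLinearMap.comp_apply, h, map_sum]
    exact Finset.sum_nonneg (fun i _ => conjF_pos hσ.1 (a i) x)
  · rw [ContinuousLinearMap.comp_apply, h]
    simp [h1, hσ.2]

theorem kills_comp {I : Set B} (hI : IsClosedIdeal I) {σ : B →L[ℂ] ℂ} (hσ : Kills σ I)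
    {φ : B →L[ℂ] B} (hφ : IsElementaryUCP φ) : Kills (σ.comp φ) I := by
  obtain ⟨n, a, h1, h⟩ := hφ
  intro x hx
  rw [ContinuousLinearMap.comp_apply, h]
  exact hσ _ (ci_sum hI _ (fun i _ => ci_mul_right hI _ (ci_mul_left hI _ hx)))

/-- elementary maps fix elements which are central modulo `I`, modulo `I` -/
theorem comp_central {I : Set B} (hI : IsClosedIdeal I) {σ : B →L[ℂ] ℂ} (hσ : Kills σ I)
    {φ : B →L[ℂ] B} (hφ : IsElementaryUCP φ) {f : B} (hf : ∀ a : B, f * a - a * f ∈ I) :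
    σ (φ f) = σ f := by
  obtain ⟨n, a, h1, h⟩ := hφ
  have : φ f - f ∈ I := by
    have e : φ f - f = ∑ i, star (a i) * (f * a i - a i * f) := by
      rw [h]
      simp only [mul_sub, Finset.sum_sub_distrib, ← mul_assoc]
      rw [← Finset.sum_mul, h1, one_mul]
    rw [e]
    exact ci_sum hI _ (fun i _ => ci_mul_left hI _ (hf _))
  have := hσ _ this
  rwa [map_sub, sub_eq_zero] at this

theorem mixSet_convex (ω : B →L[ℂ] ℂ) : Convex ℝ (mixSet ω) := by
  rintro _ ⟨φ, ⟨n, a, ha, hφ⟩, rfl⟩ _ ⟨ψ, ⟨m, b, hb, hψ⟩, rfl⟩ s t hs ht hst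
  have key : ∀ x : B, elemMap (Fin.append (fun i => ((√s : ℝ) : ℂ) • a i)
      (fun i => ((√t : ℝ) : ℂ) • b i)) x = (s : ℂ) • φ x + (t : ℂ) • ψ x := by
    intro x
    rw [elemMap_apply, Fin.sum_univ_add, hφ, hψ, Finset.smul_sum, Finset.smul_sum]
    congr 1
    · refine Finset.sum_congr rfl (fun i _ => ?_)
      rw [Fin.append_left]
      simp only [star_smul, smul_mul_assoc, mul_smul_comm, smul_smul]
      congr 1
      simp [← Complex.ofReal_mul, Real.mul_self_sqrt hs]
    · refine Finset.sum_congr rfl (fun i _ => ?_)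
      rw [Fin.append_right]
      simp only [star_smul, smul_mul_assoc, mul_smul_comm, smul_smul]
      congr 1
      simp [← Complex.ofReal_mul, Real.mul_self_sqrt ht]
  refine ⟨_, elemMap_ucp (Fin.append (fun i => ((√s : ℝ) : ℂ) • a i)
      (fun i => ((√t : ℝ) : ℂ) • b i)) ?_, ?_⟩
  · have := key 1
    rw [elemMap_apply, hφ, hψ] at this
    simp only [mul_one] at this
    rw [this, ha, hb, ← add_smul, ← Complex.ofReal_add, hst]
    simp
  · ext x
    rw [ContinuousLinearMap.comp_apply, key]
    simp

/-! ### Hahn-Banach for the weak* closure -/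

theorem inClosure_of_sa {S : Set (B →L[ℂ] ℂ)} (hS : Convex ℝ S) (hSne : S.Nonempty)
    (hSs : ∀ σ ∈ S, IsState σ) {ω : B →L[ℂ] ℂ} (hω : IsState ω)
    (h : ∀ x : B, IsSelfAdjoint x → ∀ ε : ℝ, 0 < ε → ∃ σ ∈ S, (ω x).re ≤ (σ x).re + ε) :
    InWeakStarClosure S ω := by
  intro ε hε n x
  by_contra hcon
  push Not at hcon
  -- evaluation map
  let ev : (B →L[ℂ] ℂ) →ₗ[ℝ] (Fin n → ℂ) :=
    { toFun := fun σ i => σ (x i)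
      map_add' := fun _ _ => rfl
      map_smul' := fun _ _ => rfl }
  have hconv : Convex ℝ (closure (ev '' S)) := (hS.linear_image ev).closure
  have hnot : ev ω ∉ closure (ev '' S) := by
    intro hmem
    obtain ⟨_, ⟨σ, hσ, rfl⟩, hd⟩ := Metric.mem_closure_iff.1 hmem ε hε
    obtain ⟨i, hi⟩ := hcon σ hσ
    have : dist (ev ω i) (ev σ i) < ε := (dist_le_pi_dist _ _ i).trans_lt hd
    rw [dist_eq_norm] at this
    exact absurd this (not_lt.2 hi)
  obtain ⟨f, u, hf1, hf2⟩ := RCLike.geometric_hahn_banach_point_closed (𝕜 := ℂ)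
    hconv isClosed_closure hnot
  -- the element
  let y : B := ∑ i, f (Pi.single i 1) • x i
  have hy : ∀ σ : B →L[ℂ] ℂ, σ y = f (ev σ) := by
    intro σ
    have : ev σ = ∑ i, (σ (x i)) • (Pi.single i (1 : ℂ) : Fin n → ℂ) := by
      ext j
      simp [ev, Finset.sum_apply, Pi.single_apply]
    rw [this, map_sum, map_sum]
    refine Finset.sum_congr rfl (fun i _ => ?_)
    simp [mul_comm]
  let z : B := -(y + star y)
  have hz : IsSelfAdjoint z := (IsSelfAdjoint.add_star_self y).neg
  have hre : ∀ σ : B →L[ℂ] ℂ, IsState σ → (σ z).re = - (2 * (f (ev σ)).re) := by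
    intro σ hσ
    simp only [z, map_neg, map_add, pf_herm hσ.1, hy]
    simp; ring
  have hlt : (f (ev ω)).re < u := hf1
  obtain ⟨σ, hσ, hle⟩ := h z hz (u - (f (ev ω)).re) (by linarith)
  rw [hre ω hω, hre σ (hSs σ hσ)] at hle
  have : u < (f (ev σ)).re := hf2 _ (subset_closure ⟨σ, hσ, rfl⟩)
  linarith

/-- limits of states are states -/
theorem state_of_closure {S : Set (B →L[ℂ] ℂ)} (hS : ∀ σ ∈ S, IsState σ) {ρ : B →L[ℂ] ℂ}
    (h : InWeakStarClosure S ρ) : IsState ρ := by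
  have key : ∀ (a : B) (C : Set ℂ), IsClosed C → (∀ σ ∈ S, σ a ∈ C) → ρ a ∈ C := by
    intro a C hC hSC
    rw [← hC.closure_eq, Metric.mem_closure_iff]
    intro ε hε
    obtain ⟨σ, hσ, hi⟩ := h ε hε 1 (fun _ => a)
    exact ⟨σ a, hSC σ hσ, by rw [dist_eq_norm]; exact hi 0⟩
  refine ⟨fun a => ?_, ?_⟩
  · exact key _ {z : ℂ | 0 ≤ z} (by exact isClosed_Ici) (fun σ hσ => (hS σ hσ).1 a)
  · exact key 1 {1} isClosed_singleton (fun σ hσ => (hS σ hσ).2)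

theorem kills_of_closure {S : Set (B →L[ℂ] ℂ)} {I : Set B} (hS : ∀ σ ∈ S, Kills σ I)
    {ρ : B →L[ℂ] ℂ} (h : InWeakStarClosure S ρ) : Kills ρ I := by
  intro a ha
  have : ρ a ∈ closure ({0} : Set ℂ) := by
    rw [Metric.mem_closure_iff]
    intro ε hε
    obtain ⟨σ, hσ, hi⟩ := h ε hε 1 (fun _ => a)
    exact ⟨σ a, hS σ hσ a ha, by rw [dist_eq_norm]; exact hi 0⟩
  simpa using this

theorem mixSet_state {ω : B →L[ℂ] ℂ} (hω : IsState ω) : ∀ σ ∈ mixSet ω, IsState σ := by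
  rintro _ ⟨φ, hφ, rfl⟩; exact state_comp hω hφ

theorem mixSet_kills {I : Set B} (hI : IsClosedIdeal I) {ω : B →L[ℂ] ℂ} (hω : Kills ω I) :
    ∀ σ ∈ mixSet ω, Kills σ I := by
  rintro _ ⟨φ, hφ, rfl⟩; exact kills_comp hI hω hφ

theorem mixSet_nonempty (ω : B →L[ℂ] ℂ) : (mixSet ω).Nonempty :=
  ⟨_, _, elemMap_ucp (n := 1) (fun _ => (1 : B)) (by simp), rfl⟩

end MM

namespace MM
variable {B : Type u} [CStarAlgebra B] [PartialOrder B] [StarOrderedRing B]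

theorem re_smul (σ : B →L[ℂ] ℂ) (r : ℝ) (x : B) : (σ (r • x)).re = r * (σ x).re := by
  rw [ContinuousLinearMap.map_smul_of_tower]; simp

theorem span_bound {s : B} (hs : IsSelfAdjoint s) {t : B} (ht : t ∈ genSpan {s}) :
    ∃ (n : ℕ) (a : Fin n → B) (C : ℝ), 0 ≤ C ∧
      t * star t ≤ C • ∑ j, a j * (s * s) * star (a j) := by
  have vnn : ∀ (n : ℕ) (a : Fin n → B), 0 ≤ ∑ j, a j * (s * s) * star (a j) := by
    intro n a
    refine Finset.sum_nonneg (fun j _ => ?_)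
    have := mul_star_self_nonneg (a j * s)
    rwa [star_mul, hs.star_eq, ← mul_assoc, mul_assoc (a j)] at this
  induction ht using Submodule.span_induction with
  | mem x hx =>
    obtain ⟨a, b, s', hs', rfl⟩ := hx
    obtain rfl : s' = s := hs'
    refine ⟨1, fun _ => a, ‖b * star b‖, norm_nonneg _, ?_⟩
    have := CStarAlgebra.star_right_conjugate_le_norm_smul (a := a * s') (b := b * star b)
      (IsSelfAdjoint.mul_star_self b)
    simp only [star_mul, hs.star_eq] at this
    simpa [mul_assoc, hs.star_eq] using this
  | zero => exact ⟨0, Fin.elim0, 0, le_rfl, by simp⟩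
  | add x y _ _ hx hy =>
    obtain ⟨n, a, C, hC, h1⟩ := hx
    obtain ⟨m, b, D, hD, h2⟩ := hy
    refine ⟨n + m, Fin.append a b, 2 * (C + D), by positivity, ?_⟩
    rw [Fin.sum_univ_add]
    simp only [Fin.append_left, Fin.append_right]
    have h3 : (x + y) * star (x + y) ≤ (2 : ℝ) • (x * star x + y * star y) := by
      rw [← sub_nonneg]
      have := mul_star_self_nonneg (x - y)
      convert this using 1
      simp only [two_smul, star_add, star_sub]
      noncomm_ring
    refine h3.trans ?_
    rw [mul_smul]
    refine smul_le_smul_of_nonneg_left ?_ (by norm_num)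
    have v1 := vnn n a
    have v2 := vnn m b
    set V := ∑ j, a j * (s * s) * star (a j)
    set W := ∑ j, b j * (s * s) * star (b j)
    calc x * star x + y * star y ≤ C • V + D • W := add_le_add h1 h2
      _ ≤ C • V + D • W + (C • W + D • V) :=
        le_add_of_nonneg_right (add_nonneg (smul_nonneg hC v2) (smul_nonneg hD v1))
      _ = _ := by module
  | smul r x _ hx =>
    obtain ⟨n, a, C, hC, h1⟩ := hx
    refine ⟨n, a, ‖r‖ ^ 2 * C, by positivity, ?_⟩
    have : (r • x) * star (r • x) = (‖r‖ ^ 2 : ℝ) • (x * star x) := by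
      rw [star_smul, smul_mul_assoc, mul_smul_comm, smul_smul]
      have : r * star r = ((‖r‖ ^ 2 : ℝ) : ℂ) := by
        rw [Complex.star_def, Complex.mul_conj, Complex.normSq_eq_norm_sq]
      rw [this, Complex.coe_smul]
    rw [this, mul_smul]
    exact smul_le_smul_of_nonneg_left h1 (by positivity)

theorem posPart_conj_nonneg {g : B} (hg : IsSelfAdjoint g) : 0 ≤ g⁺ * g * g⁺ := by
  have h0 := CFC.posPart_nonneg g
  have e : g⁺ * g * g⁺ = star (g⁺) * g⁺ * g⁺ := by
    rw [h0.isSelfAdjoint.star_eq]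
    have : g⁺ * g = g⁺ * g⁺ := by
      conv_lhs => rw [← CFC.posPart_sub_negPart g hg, mul_sub]
      rw [CFC.posPart_sub_negPart g hg, CFC.posPart_mul_negPart, sub_zero]
    rw [this]
  rw [e]
  exact star_left_conjugate_nonneg h0 _

theorem strictPos_algMap {δ : ℝ} (hδ : 0 < δ) : IsStrictlyPositive (algebraMap ℝ B δ) :=
  IsStrictlyPositive.iff_of_unital.2 ⟨by
    rw [Algebra.algebraMap_eq_smul_one]; exact smul_nonneg hδ.le zero_le_one,
    (IsUnit.mk0 δ hδ.ne').map (algebraMap ℝ B)⟩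

theorem lemmaL {g : B} (hg : IsSelfAdjoint g) {t : B} (ht : t ∈ genSpan {g⁺}) {η : ℝ}
    (hη : 0 < η) : ∃ φ : B →L[ℂ] B, IsElementaryUCP φ ∧ ∀ σ : B →L[ℂ] ℂ, IsState σ →
      (σ (star (1 - t) * (1 - t))).re ≤ η → -(4 * η * ‖g‖) ≤ (σ (φ g)).re := by
  have hs0 := CFC.posPart_nonneg g
  have hsgs := posPart_conj_nonneg hg
  set s := g⁺ with hsdef
  have hs := hs0.isSelfAdjoint
  obtain ⟨n, a, C, hC, hle⟩ := span_bound hs ht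
  have hv : 0 ≤ ∑ j, a j * (s * s) * star (a j) := by
    refine Finset.sum_nonneg (fun j _ => ?_)
    have := mul_star_self_nonneg (a j * s)
    rwa [star_mul, hs.star_eq, ← mul_assoc, mul_assoc (a j)] at this
  set v := ∑ j, a j * (s * s) * star (a j) with hvdef
  set δ : ℝ := η / (C + 1) with hδ
  have hδ0 : 0 < δ := by positivity
  have hd : IsStrictlyPositive (v + algebraMap ℝ B δ) :=
    IsStrictlyPositive.nonneg_add hv (strictPos_algMap hδ0)
  have hk1 := CFC.conjugate_rpow_neg_one_half (v + algebraMap ℝ B δ) hd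
  have hk0 : 0 ≤ (v + algebraMap ℝ B δ) ^ (-(1 / 2) : ℝ) := CFC.rpow_nonneg
  set k := (v + algebraMap ℝ B δ) ^ (-(1 / 2) : ℝ) with hkdef
  have hk := hk0.isSelfAdjoint
  have hsum : k * v * k + δ • (k * k) = 1 := by
    rw [← hk1, Algebra.algebraMap_eq_smul_one]
    simp [mul_add, add_mul]
  let c : Fin (n + 1) → B := Fin.cons (√δ • k) (fun j => s * star (a j) * k)
  have hc : ∀ x : B, ∑ i, star (c i) * x * c i =
      δ • (k * x * k) + k * (∑ j, a j * (s * x * s) * star (a j)) * k := by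
    intro x
    rw [Fin.sum_univ_succ]
    congr 1
    · simp only [c, Fin.cons_zero, star_smul, hk.star_eq, smul_mul_assoc, mul_smul_comm, smul_smul]
      simp [Real.mul_self_sqrt hδ0.le]
    · simp only [c, Fin.cons_succ, star_mul, star_star, hk.star_eq, hs.star_eq]
      rw [Finset.mul_sum, Finset.sum_mul]
      exact Finset.sum_congr rfl (fun i _ => by simp only [mul_assoc])
  refine ⟨elemMap c, elemMap_ucp c ?_, ?_⟩
  · have := hc 1
    simp only [mul_one] at this
    rw [this, add_comm]
    exact hsum
  intro σ hσ hση
  have hkvk : 0 ≤ k * v * k := by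
    have := star_left_conjugate_nonneg hv k
    rwa [hk.star_eq] at this
  have hkk : 0 ≤ k * k := by
    have := star_mul_self_nonneg k
    rwa [hk.star_eq] at this
  -- lower bound of φ g
  have h1 : δ • (k * g * k) ≤ elemMap c g := by
    rw [elemMap_apply, hc g]
    refine le_add_of_nonneg_right ?_
    have : 0 ≤ ∑ j, a j * (s * g * s) * star (a j) :=
      Finset.sum_nonneg (fun j _ => star_right_conjugate_nonneg hsgs _)
    have := star_left_conjugate_nonneg this k
    rwa [hk.star_eq] at this
  have h2 : -(‖g‖ • (k * k)) ≤ k * g * k := by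
    have := CStarAlgebra.star_left_conjugate_le_norm_smul (a := k) (b := -g) hg.neg
    rw [hk.star_eq, norm_neg] at this
    rw [neg_le]
    simpa using this
  have h3 := pf_re_mono hσ.1 h1
  have h4 := pf_re_mono hσ.1 h2
  rw [re_smul] at h3
  rw [map_neg, Complex.neg_re, re_smul] at h4
  -- σ (δ k k) ≤ 4 η
  have h5 : δ • (k * k) ≤ (2 : ℝ) • (δ • (star (k * t) * (k * t)) +
      star (1 - t) * (δ • (k * k)) * (1 - t)) := by
    rw [← sub_nonneg]
    have := smul_nonneg hδ0.le (star_mul_self_nonneg (k * t - k * (1 - t)))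
    convert this using 1
    have e : k = k * t + k * (1 - t) := by noncomm_ring
    have e2 : k * k = star (k * t + k * (1 - t)) * (k * t + k * (1 - t)) := by
      rw [← e, hk.star_eq]
    have e3 : star (1 - t) * (δ • (k * k)) * (1 - t) =
        δ • (star (k * (1 - t)) * (k * (1 - t))) := by
      simp only [star_mul, hk.star_eq, mul_smul_comm, smul_mul_assoc, mul_assoc]
    rw [e3]
    rw [e2]
    generalize k * t = p
    generalize k * (1 - t) = q
    rw [two_smul, ← smul_add, ← smul_add, ← smul_sub]
    congr 1
    simp only [star_add, star_sub]
    noncomm_ring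
  have h6 : star (1 - t) * (δ • (k * k)) * (1 - t) ≤ star (1 - t) * (1 - t) := by
    have : δ • (k * k) ≤ 1 := by rw [← hsum]; exact le_add_of_nonneg_left hkvk
    simpa using star_left_conjugate_le_conjugate this (1 - t)
  have h7 : ‖k * t‖ ^ 2 ≤ C := by
    have e : ‖k * t‖ ^ 2 = ‖k * (t * star t) * k‖ := by
      rw [sq, ← CStarRing.norm_self_mul_star, star_mul, hk.star_eq]; simp only [mul_assoc]
    rw [e]
    have e2 : k * (t * star t) * k ≤ algebraMap ℝ B C := by
      calc k * (t * star t) * k ≤ k * (C • v) * k := by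
            have := star_left_conjugate_le_conjugate hle k
            rwa [hk.star_eq] at this
        _ = C • (k * v * k) := by simp
        _ ≤ C • 1 := smul_le_smul_of_nonneg_left
            (by rw [← hsum]; exact le_add_of_nonneg_right (smul_nonneg hδ0.le hkk)) hC
        _ = _ := by rw [Algebra.algebraMap_eq_smul_one]
    refine (CStarAlgebra.norm_le_iff_le_algebraMap _ hC ?_).2 e2
    have := star_left_conjugate_nonneg (mul_star_self_nonneg t) k
    rwa [hk.star_eq] at this
  have h8 := pf_re_mono hσ.1 h5
  rw [re_smul, re_smul, map_add, Complex.add_re, re_smul] at h8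
  have h9 := pf_re_mono hσ.1 h6
  have h10 := st_re_le hσ (IsSelfAdjoint.star_mul_self (k * t))
  rw [CStarRing.norm_star_mul_self] at h10
  have h11 : δ * C ≤ η := by
    rw [hδ, div_mul_eq_mul_div, div_le_iff₀ (by positivity)]; nlinarith
  have h12 : δ * (σ (star (k * t) * (k * t))).re ≤ η := by
    refine le_trans (mul_le_mul_of_nonneg_left (h10.trans ?_) hδ0.le) h11
    rw [← sq]; exact h7
  have h13 : δ * (σ (k * k)).re ≤ 4 * η := by linarith
  have h14 := mul_le_mul_of_nonneg_left h4 hδ0.le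
  have h15 := mul_le_mul_of_nonneg_left h13 (norm_nonneg g)
  nlinarith

/-- The ideal version of `lemmaL`. -/
theorem lemmaM {I : Set B} (hI : IsClosedIdeal I) {g : B} (hg : IsSelfAdjoint g)
    (hmax : ∀ M, IsMaximalIdeal M → I ⊆ M → g⁺ ∉ M) {ε : ℝ} (hε : 0 < ε) :
    ∃ φ : B →L[ℂ] B, IsElementaryUCP φ ∧ ∀ σ : B →L[ℂ] ℂ, IsState σ → Kills σ I →
      -ε ≤ (σ (φ g)).re := by
  set η : ℝ := ε / (4 * (‖g‖ + 1)) with hη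
  have hη0 : 0 < η := by positivity
  have h1 : (1 : B) ∈ genIdeal (I ∪ {g⁺}) := by
    by_contra h
    obtain ⟨M, hM, hle⟩ := exists_maximal (genIdeal_closed _) h
    have h2 := (subset_genIdeal _).trans hle
    exact hmax M hM (Set.subset_union_left.trans h2) (h2 (by simp))
  obtain ⟨x, hx, hd⟩ := Metric.mem_closure_iff.1 h1 (√η) (Real.sqrt_pos.2 hη0)
  have hx' : ∃ i ∈ I, ∃ t ∈ genSpan {g⁺}, x = i + t := by
    have hx2 : x ∈ genSpan (I ∪ {g⁺}) := hx
    clear hx hd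
    induction hx2 using Submodule.span_induction with
    | mem x hx =>
      obtain ⟨a, b, s, hs | hs, rfl⟩ := hx
      · exact ⟨_, ci_mul_right hI b (ci_mul_left hI a hs), 0, zero_mem _, by simp⟩
      · exact ⟨0, ci_zero hI, a * s * b, Submodule.subset_span ⟨a, b, s, hs, rfl⟩, by simp⟩
    | zero => exact ⟨0, ci_zero hI, 0, zero_mem _, by simp⟩
    | add x y _ _ hx hy =>
      obtain ⟨i, hi, t, ht, rfl⟩ := hx
      obtain ⟨j, hj, r, hr, rfl⟩ := hy
      exact ⟨i + j, ci_add hI hi hj, t + r, add_mem ht hr, by abel⟩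
    | smul r x _ hx =>
      obtain ⟨i, hi, t, ht, rfl⟩ := hx
      exact ⟨r • i, ci_smul hI r hi, r • t, Submodule.smul_mem _ _ ht, by simp⟩
  obtain ⟨i, hi, t, ht, rfl⟩ := hx'
  obtain ⟨φ, hφ, hall⟩ := lemmaL hg ht hη0
  refine ⟨φ, hφ, fun σ hσ hk => ?_⟩
  have h3 := hall σ hσ (by
    set e := 1 - (i + t) with he
    have e1 : 1 - t = i + e := by rw [he]; abel
    have e2 : star (1 - t) * (1 - t) = star (1 - t) * i + (star e * e + star i * e) := by
      have : star (1 - t) * (1 - t) = star (1 - t) * (i + e) := by rw [← e1]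
      rw [this, mul_add]
      congr 1
      rw [e1, star_add, add_mul, add_comm]
    have e3 : σ (star i * e) = 0 := by
      have : σ (star e * i) = 0 := hk _ (ci_mul_left hI _ hi)
      have h5 := pf_herm hσ.1 (star e * i)
      rw [this] at h5
      simpa using h5
    rw [e2, map_add, map_add, e3, hk _ (ci_mul_left hI _ hi)]
    simp only [zero_add, add_zero]
    have := st_re_le hσ (IsSelfAdjoint.star_mul_self e)
    rw [CStarRing.norm_star_mul_self] at this
    rw [dist_eq_norm] at hd
    have h6 : ‖e‖ * ‖e‖ ≤ √η * √η := mul_self_le_mul_self (norm_nonneg _) hd.le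
    rw [Real.mul_self_sqrt hη0.le] at h6
    linarith)
  have h4 : 4 * η * ‖g‖ ≤ ε := by
    have : 4 * η * (‖g‖ + 1) = ε := by rw [hη]; field_simp
    nlinarith
  linarith

end MM

namespace MM
variable {B : Type u} [CStarAlgebra B] [PartialOrder B] [StarOrderedRing B]

/-- symmetrization of a functional -/
def symF (f : B →L[ℂ] ℂ) : B →L[ℂ] ℂ where
  toFun a := (f a + conj (f (star a))) / 2
  map_add' a b := by simp only [star_add, map_add]; ring
  map_smul' c a := by simp only [star_smul, map_smul, smul_eq_mul, map_mul, RingHom.id_apply,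
    RCLike.star_def, Complex.conj_conj]; ring
  cont := by
    have : Continuous (fun a : B => star a) := continuous_star
    fun_prop

theorem symF_apply (f : B →L[ℂ] ℂ) (a : B) : symF f a = (f a + conj (f (star a))) / 2 := rfl

theorem symF_sa (f : B →L[ℂ] ℂ) {a : B} (ha : IsSelfAdjoint a) : symF f a = ((f a).re : ℂ) := by
  rw [symF_apply, ha.star_eq, Complex.add_conj]; push_cast; ring

theorem sep (V : Submodule ℝ B) (hV : ∀ v ∈ V, IsSelfAdjoint v) {x : B} (hx : IsSelfAdjoint x)
    (h : x ∉ closure {y : B | ∃ p v, 0 ≤ p ∧ v ∈ V ∧ y = p + v}) :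
    ∃ σ : B →L[ℂ] ℂ, IsState σ ∧ (∀ v ∈ V, σ v = 0) ∧ (σ x).re < 0 := by
  set T := {y : B | ∃ p v, 0 ≤ p ∧ v ∈ V ∧ y = p + v} with hT
  have hconv : Convex ℝ T := by
    rintro _ ⟨p, v, hp, hv, rfl⟩ _ ⟨q, w, hq, hw, rfl⟩ a b ha hb _
    refine ⟨a • p + b • q, a • v + b • w, add_nonneg (smul_nonneg ha hp) (smul_nonneg hb hq),
      add_mem (V.smul_mem _ hv) (V.smul_mem _ hw), ?_⟩
    simp only [smul_add]; abel
  obtain ⟨f, u, hfx, hfb⟩ := RCLike.geometric_hahn_banach_point_closed (𝕜 := ℂ) hconv.closure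
    isClosed_closure h
  have hu : u < 0 := by
    simpa using hfb 0 (subset_closure ⟨0, 0, le_rfl, zero_mem _, by simp⟩)
  have hcone : ∀ b ∈ T, 0 ≤ (f b).re := by
    rintro b ⟨p, v, hp, hv, rfl⟩
    by_contra hneg
    push Not at hneg
    have hr : 0 < u / (f (p + v)).re := div_pos_of_neg_of_neg hu hneg
    have := hfb ((u / (f (p + v)).re) • (p + v)) (subset_closure ⟨_, _, smul_nonneg hr.le hp,
      V.smul_mem _ hv, smul_add _ _ _⟩)
    rw [← Complex.coe_smul, map_smul, smul_eq_mul] at this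
    simp only [RCLike.re_eq_complex_re, Complex.re_ofReal_mul] at this
    rw [div_mul_cancel₀ _ hneg.ne] at this
    exact lt_irrefl _ this
  have hpos : IsPositiveFunctional (symF f) := by
    intro a
    rw [symF_sa f (IsSelfAdjoint.star_mul_self a)]
    exact_mod_cast hcone _ ⟨_, 0, star_mul_self_nonneg a, zero_mem _, by simp⟩
  have hkill : ∀ v ∈ V, symF f v = 0 := by
    intro v hv
    rw [symF_sa f (hV v hv)]
    have h1 := hcone v ⟨0, v, le_rfl, hv, by simp⟩
    have h2 := hcone (-v) ⟨0, -v, le_rfl, neg_mem hv, by simp⟩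
    simp at h2
    exact_mod_cast le_antisymm h2 h1
  have hneg : (symF f x).re < 0 := by
    rw [symF_sa f hx]
    exact lt_trans hfx hu
  obtain ⟨c, hc, -, hst⟩ := normalize hpos (fun h1 => by
    rw [pf_zero_of_one hpos h1] at hneg; simp at hneg)
  refine ⟨_, hst, fun v hv => by simp [hkill v hv], ?_⟩
  simp only [ContinuousLinearMap.smul_apply, smul_eq_mul, Complex.re_ofReal_mul]
  have := inv_pos.2 hc
  nlinarith

/-- the self-adjoint part of a closed ideal -/
def saPart {I : Set B} (hI : IsClosedIdeal I) : Submodule ℝ B where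
  carrier := {x | x ∈ I ∧ IsSelfAdjoint x}
  add_mem' := fun ⟨h1, h2⟩ ⟨h3, h4⟩ => ⟨ci_add hI h1 h3, h2.add h4⟩
  zero_mem' := ⟨ci_zero hI, IsSelfAdjoint.zero B⟩
  smul_mem' c x := fun ⟨h1, h2⟩ => ⟨by
    rw [← Complex.coe_smul]; exact ci_smul hI _ h1, (IsSelfAdjoint.all c).smul h2⟩

theorem mem_of_close {I : Set B} (hI : IsClosedIdeal I) {h : B}
    (hc : -(star h * h) ∈ closure {y : B | ∃ p v, 0 ≤ p ∧ v ∈ saPart hI ∧ y = p + v}) :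
    h ∈ I := by
  rw [← hI.1.closure_eq, Metric.mem_closure_iff]
  intro r hr
  set ε : ℝ := r ^ 2 / 8 with hε
  have hε0 : 0 < ε := by positivity
  obtain ⟨_, ⟨p, v, hp, hv, rfl⟩, hd⟩ := Metric.mem_closure_iff.1 hc ε hε0
  have hvs : IsSelfAdjoint v := hv.2
  have hps := hp.isSelfAdjoint
  set w := -(star h * h) - (p + v) with hw
  have hwsa : IsSelfAdjoint w := ((IsSelfAdjoint.star_mul_self h).neg).sub (hps.add hvs)
  have hwn : ‖w‖ ≤ ε := by rw [dist_eq_norm] at hd; exact hd.le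
  have h1 : star h * h ≤ -v + algebraMap ℝ B ε := by
    have e : star h * h = -v + -w - p := by rw [hw]; abel
    rw [e]
    calc -v + -w - p ≤ -v + -w := sub_le_self _ hp
      _ ≤ -v + algebraMap ℝ B ε := by
        gcongr
        have h2 : -w ≤ algebraMap ℝ B ‖w‖ := by
          simpa using hwsa.neg.le_algebraMap_norm_self
        refine h2.trans ?_
        rw [Algebra.algebraMap_eq_smul_one, Algebra.algebraMap_eq_smul_one]
        exact smul_le_smul_of_nonneg_right hwn zero_le_one
  set k : B := (1 / (4 * ε)) • (v * v) with hk
  have hk0 : 0 ≤ k := by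
    refine smul_nonneg (by positivity) ?_
    simpa [hvs.star_eq] using star_mul_self_nonneg v
  have hkI : k ∈ I := by
    rw [hk, ← Complex.coe_smul]; exact ci_smul hI _ (ci_mul_left hI _ hv.1)
  have h2 : -v ≤ k + algebraMap ℝ B ε := by
    have := smul_nonneg (show (0 : ℝ) ≤ 1 / (4 * ε) by positivity)
      (star_mul_self_nonneg (v + algebraMap ℝ B (2 * ε)))
    rw [← sub_nonneg]
    convert this using 1
    rw [star_add, hvs.star_eq, (IsSelfAdjoint.algebraMap B (IsSelfAdjoint.all (2 * ε))).star_eq, hk]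
    simp only [Algebra.algebraMap_eq_smul_one, mul_add, add_mul, smul_mul_assoc, mul_smul_comm,
      one_mul, mul_one, smul_add, smul_smul]
    have e1 : 1 / (4 * ε) * (2 * ε) = 1 / 2 := by field_simp; norm_num
    have e2 : 1 / (4 * ε) * (2 * ε * (2 * ε)) = ε := by field_simp; norm_num
    rw [e1, e2]
    have e3 : v = (1 / 2 : ℝ) • v + (1 / 2 : ℝ) • v := by rw [← add_smul]; norm_num
    rw [sub_neg_eq_add]
    calc _ = (1 / (4 * ε)) • (v * v) + ε • (1 : B) + ((1 / 2 : ℝ) • v + (1 / 2 : ℝ) • v) := by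
          rw [← e3]
      _ = _ := by abel
  set δ : ℝ := 2 * ε with hδ
  have hδ0 : 0 < δ := by positivity
  have h3 : star h * h ≤ k + algebraMap ℝ B δ := by
    have : algebraMap ℝ B δ = algebraMap ℝ B ε + algebraMap ℝ B ε := by
      rw [← map_add]; congr 1; rw [hδ]; ring
    rw [this]
    calc _ ≤ _ := h1
      _ ≤ k + algebraMap ℝ B ε + algebraMap ℝ B ε := by gcongr
      _ = _ := by abel
  have hs : IsStrictlyPositive (k + algebraMap ℝ B δ) :=
    IsStrictlyPositive.nonneg_add hk0 (strictPos_algMap hδ0)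
  set d := k + algebraMap ℝ B δ with hdd
  have hinv0 : 0 ≤ Ring.inverse d := hs.ringInverse.nonneg
  have hinvsa := hinv0.isSelfAdjoint
  set q := Ring.inverse d with hq
  have hdq : d * q = 1 := Ring.mul_inverse_cancel _ hs.isUnit
  have hqd : q * d = 1 := Ring.inverse_mul_cancel _ hs.isUnit
  refine ⟨h * (k * q), ci_mul_left hI _ (ci_mul_right hI _ hkI), ?_⟩
  have e : h - h * (k * q) = δ • (h * q) := by
    have : k = d - algebraMap ℝ B δ := by rw [hdd]; abel
    rw [this, sub_mul, hdq, Algebra.algebraMap_eq_smul_one]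
    simp [mul_sub]
  rw [dist_eq_norm, e]
  have h4 : δ • q ≤ 1 := by
    have h5 : q * (δ • (1 : B)) * q ≤ q * d * q := by
      have := star_left_conjugate_le_conjugate (show δ • (1 : B) ≤ d by
        rw [hdd, Algebra.algebraMap_eq_smul_one]; exact le_add_of_nonneg_left hk0) q
      rwa [hinvsa.star_eq] at this
    have h6 : d * q ≤ d * q := le_rfl
    -- conjugate by sqrt
    have h7 : algebraMap ℝ B δ ≤ d := le_add_of_nonneg_left hk0
    have h8 := CStarAlgebra.ringInverse_le_ringInverse h7 (strictPos_algMap hδ0)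
    have h9 : Ring.inverse (algebraMap ℝ B δ) = δ⁻¹ • (1 : B) := by
      have h10 := Ring.mul_inverse_cancel _ (strictPos_algMap (B := B) hδ0).isUnit
      have h11 : δ⁻¹ • algebraMap ℝ B δ = 1 := by
        rw [Algebra.algebraMap_eq_smul_one, smul_smul, inv_mul_cancel₀ hδ0.ne', one_smul]
      rw [← h10, ← smul_mul_assoc, h11, one_mul]
    rw [h9] at h8
    have := smul_le_smul_of_nonneg_left h8 hδ0.le
    rwa [smul_smul, mul_inv_cancel₀ hδ0.ne', one_smul] at this
  have h5 : ‖δ • (h * q)‖ ^ 2 ≤ δ := by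
    rw [sq, ← CStarRing.norm_star_mul_self]
    have e2 : star (δ • (h * q)) * (δ • (h * q)) = (δ * δ) • (q * (star h * h) * q) := by
      simp [hinvsa.star_eq, smul_smul, mul_assoc]
    rw [CStarAlgebra.norm_le_iff_le_algebraMap _ hδ0.le (star_mul_self_nonneg _), e2]
    have h10 : q * (star h * h) * q ≤ q := by
      have := star_left_conjugate_le_conjugate h3 q
      rwa [hinvsa.star_eq, hqd, one_mul] at this
    calc (δ * δ) • (q * (star h * h) * q) ≤ (δ * δ) • q :=
          smul_le_smul_of_nonneg_left h10 (by positivity)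
      _ = δ • (δ • q) := by rw [smul_smul]
      _ ≤ δ • 1 := smul_le_smul_of_nonneg_left h4 hδ0.le
      _ = _ := by rw [Algebra.algebraMap_eq_smul_one]
  have h6 : ‖δ • (h * q)‖ ^ 2 < r ^ 2 := by
    refine lt_of_le_of_lt h5 ?_
    rw [hδ, hε]; nlinarith [pow_pos hr 2]
  exact lt_of_pow_lt_pow_left₀ 2 hr.le h6

/-- (S1) -/
theorem exists_state {I : Set B} (hI : IsClosedIdeal I) {h : B} (hh : h ∉ I) :
    ∃ σ : B →L[ℂ] ℂ, IsState σ ∧ Kills σ I ∧ 0 < (σ (star h * h)).re := by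
  obtain ⟨σ, hσ, hk, hn⟩ := sep (saPart hI) (fun v hv => hv.2)
    (IsSelfAdjoint.star_mul_self h).neg (fun hc => hh (mem_of_close hI hc))
  refine ⟨σ, hσ, fun x hx => pf_zero_of_sq hσ.1 (hk _ ⟨ci_mul_left hI _ hx,
    IsSelfAdjoint.star_mul_self x⟩), ?_⟩
  simpa using hn

theorem exists_state_kills {I : Set B} (hI : IsClosedIdeal I) (h1 : (1 : B) ∉ I) :
    ∃ σ : B →L[ℂ] ℂ, IsState σ ∧ Kills σ I := by
  obtain ⟨σ, h, h', -⟩ := exists_state hI h1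
  exact ⟨σ, h, h'⟩

theorem ci_star {I : Set B} (hI : IsClosedIdeal I) {x : B} (hx : x ∈ I) : star x ∈ I := by
  by_contra h
  obtain ⟨σ, hσ, hk, hp⟩ := exists_state hI h
  rw [star_star, hk _ (ci_mul_right hI _ hx)] at hp
  simp at hp

theorem y_lemma {I : Set B} (hI : IsClosedIdeal I) {x : B} (hx : IsSelfAdjoint x) (α : ℝ)
    (hy : (x - (α : ℂ) • (1 : B))⁺ ∉ I) :
    ∃ σ : B →L[ℂ] ℂ, IsState σ ∧ Kills σ I ∧ α ≤ (σ x).re := by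
  have hsa : IsSelfAdjoint (x - (α : ℂ) • (1 : B)) := by
    rw [← algMap_eq]; exact hx.sub (IsSelfAdjoint.algebraMap B (IsSelfAdjoint.all _))
  have hp := posPart_conj_nonneg hsa
  have hys := (CFC.posPart_nonneg (x - (α : ℂ) • (1 : B))).isSelfAdjoint
  set y := (x - (α : ℂ) • (1 : B))⁺ with hydef
  obtain ⟨σ, hσ, hk, hpos⟩ := exists_state hI hy
  have hF := conjF_pos hσ.1 y
  have h1 : conjF σ y 1 = σ (star y * y) := by rw [conjF_apply, mul_one]
  obtain ⟨c, hc, hc1, hst⟩ := normalize hF (fun h0 => by rw [← h1, h0] at hpos; simp at hpos)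
  refine ⟨_, hst, fun z hz => by simp [kills_conjF hI hk y z hz], ?_⟩
  have h2 := pf_re_nonneg hσ.1 hp
  have h3 : σ (y * (x - (α : ℂ) • (1 : B)) * y) = conjF σ y x - α * c := by
    rw [← hc1, conjF_apply, conjF_apply, hys.star_eq]
    simp [mul_sub, sub_mul]
  rw [h3] at h2
  simp only [ContinuousLinearMap.smul_apply, smul_eq_mul, Complex.re_ofReal_mul]
  simp at h2
  rw [inv_mul_eq_div, le_div_iff₀ hc]; exact h2

theorem le_posPart' {g : B} (hg : IsSelfAdjoint g) : g ≤ g⁺ := by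
  nth_rewrite 1 [← CFC.posPart_sub_negPart g hg]
  exact sub_le_self _ (CFC.negPart_nonneg g)

theorem state_nonpos {I : Set B} {g : B} (hg : IsSelfAdjoint g) (h : g⁺ ∈ I) {σ : B →L[ℂ] ℂ}
    (hσ : IsState σ) (hk : Kills σ I) : (σ g).re ≤ 0 := by
  have := pf_re_mono hσ.1 (le_posPart' hg)
  rwa [hk _ h] at this

end MM

namespace MM
variable {B : Type u} [CStarAlgebra B] [PartialOrder B] [StarOrderedRing B]

theorem eq_of_closure {S : Set (B →L[ℂ] ℂ)} {a : B} {c : ℂ} (hS : ∀ σ ∈ S, σ a = c)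
    {ρ : B →L[ℂ] ℂ} (h : InWeakStarClosure S ρ) : ρ a = c := by
  have : ρ a ∈ closure ({c} : Set ℂ) := by
    rw [Metric.mem_closure_iff]
    intro ε hε
    obtain ⟨σ, hσ, hi⟩ := h ε hε 1 (fun _ => a)
    exact ⟨σ a, hS σ hσ, by rw [dist_eq_norm]; exact hi 0⟩
  simpa using this

theorem sa_smul_one (r : ℝ) : IsSelfAdjoint ((r : ℂ) • (1 : B)) := by
  rw [← algMap_eq]; exact IsSelfAdjoint.algebraMap B (IsSelfAdjoint.all _)

theorem key {I : Set B} (hI : IsClosedIdeal I) {ω : B →L[ℂ] ℂ} (hω : IsState ω) (hk : Kills ω I)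
    (h : ∀ x : B, IsSelfAdjoint x → ∀ ε : ℝ, 0 < ε → ∃ f : B, IsSelfAdjoint f ∧
      (∀ a, f * a - a * f ∈ I) ∧ (ω x).re ≤ (ω f).re + ε ∧
      ∀ M, IsMaximalIdeal M → I ⊆ M → (x - f + (ε : ℂ) • (1 : B))⁺ ∉ M) :
    IsMaximallyMixed ω := by
  refine ⟨hω, fun ρ hρ hc => ?_⟩
  have hρk : Kills ρ I := kills_of_closure (mixSet_kills hI hk) hc
  refine inClosure_of_sa (mixSet_convex ρ) (mixSet_nonempty ρ) (mixSet_state hρ) hω ?_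
  intro x hx ε hε
  obtain ⟨f, hf, hfc, hle, hM⟩ := h x hx (ε / 3) (by positivity)
  have hρf : ρ f = ω f := by
    refine eq_of_closure ?_ hc
    rintro _ ⟨φ, hφ, rfl⟩
    exact comp_central hI hk hφ hfc
  obtain ⟨φ, hφ, hall⟩ := lemmaM hI ((hx.sub hf).add (sa_smul_one _)) hM
    (show 0 < ε / 3 by positivity)
  refine ⟨_, ⟨φ, hφ, rfl⟩, ?_⟩
  have h1 := hall ρ hρ hρk
  have h2 : ρ (φ (1 : B)) = 1 := by
    rw [comp_central hI hρk hφ (fun a => by simpa using ci_zero hI), hρ.2]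
  simp only [map_add, map_sub, map_smul, h2, comp_central hI hρk hφ hfc, hρf] at h1
  simp at h1
  simp only [ContinuousLinearMap.comp_apply]
  linarith

theorem kills_sInter {F : Set (Set B)} {N : Set B} (hN : N ∈ F) {σ : B →L[ℂ] ℂ}
    (hk : Kills σ N) : Kills σ (⋂₀ F) := fun x hx => hk x (hx N hN)

theorem key2 {F : Set (Set B)} (hF : ∀ N ∈ F, IsMaximalIdeal N)
    (hFm : ∀ M, IsMaximalIdeal M → ⋂₀ F ⊆ M → M ∈ F)
    (h : ∀ x : B, IsSelfAdjoint x → ∀ ε : ℝ, 0 < ε → ∃ f : B, IsSelfAdjoint f ∧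
      (∀ a, f * a - a * f ∈ ⋂₀ F) ∧ (∀ N ∈ F, ∀ σ : B →L[ℂ] ℂ, IsState σ → Kills σ N →
        (σ x).re ≤ (σ f).re) ∧ (∀ N ∈ F, ∃ σ : B →L[ℂ] ℂ, IsState σ ∧ Kills σ N ∧
        (σ f).re < (σ x).re + ε))
    {ω : B →L[ℂ] ℂ} (hω : IsState ω) (hk : Kills ω (⋂₀ F)) : IsMaximallyMixed ω := by
  refine key (sInter_closed F (fun N hN => (hF N hN).1)) hω hk (fun x hx ε hε => ?_)
  obtain ⟨f, hf, hfc, ha, hb⟩ := h x hx ε hε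
  refine ⟨f, hf, hfc, ?_, ?_⟩
  · have hmem : ((x - f) - (ε : ℂ) • (1 : B))⁺ ∈ ⋂₀ F := by
      intro N hN
      by_contra hc
      obtain ⟨σ, hσ, hσk, hge⟩ := y_lemma (hF N hN).1 (hx.sub hf) ε hc
      have := ha N hN σ hσ hσk
      simp at hge
      linarith
    have := state_nonpos ((hx.sub hf).sub (sa_smul_one _)) hmem hω hk
    simp [hω.2] at this
    linarith
  · intro M hM hle hc
    obtain ⟨σ, hσ, hσk, hlt⟩ := hb M (hFm M hM hle)
    have := state_nonpos ((hx.sub hf).add (sa_smul_one _)) hc hσ hσk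
    simp [hσ.2] at this
    linarith

theorem max_one {M : Set B} (hM : IsMaximalIdeal M) : (1 : B) ∉ M := (ne_univ_iff hM.1).1 hM.2.1

theorem mem_genSpan_union {I K : Set B} (hI : IsClosedIdeal I) (hK : IsClosedIdeal K) {x : B}
    (hx : x ∈ genSpan (I ∪ K)) : ∃ i ∈ I, ∃ k ∈ K, x = i + k := by
  induction hx using Submodule.span_induction with
  | mem x hx =>
    obtain ⟨a, b, s, hs | hs, rfl⟩ := hx
    · exact ⟨_, ci_mul_right hI b (ci_mul_left hI a hs), 0, ci_zero hK, by simp⟩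
    · exact ⟨0, ci_zero hI, _, ci_mul_right hK b (ci_mul_left hK a hs), by simp⟩
  | zero => exact ⟨0, ci_zero hI, 0, ci_zero hK, by simp⟩
  | add x y _ _ hx hy =>
    obtain ⟨i, hi, t, ht, rfl⟩ := hx
    obtain ⟨j, hj, r, hr, rfl⟩ := hy
    exact ⟨i + j, ci_add hI hi hj, t + r, ci_add hK ht hr, by abel⟩
  | smul r x _ hx =>
    obtain ⟨i, hi, t, ht, rfl⟩ := hx
    exact ⟨r • i, ci_smul hI r hi, r • t, ci_smul hK r ht, by simp⟩

theorem coprime {M K : Set B} (hM : IsMaximalIdeal M) (hK : IsClosedIdeal K) (h : ¬ K ⊆ M) :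
    ∃ e ∈ K, 1 - e ∈ M := by
  have h1 : (1 : B) ∈ genIdeal (K ∪ M) := by
    by_contra hc
    have hs := subset_genIdeal (K ∪ M)
    have := hM.2.2 _ (genIdeal_closed _) ((ne_univ_iff (genIdeal_closed _)).2 hc)
      (Set.subset_union_right.trans hs)
    rw [this] at hs
    exact h (Set.subset_union_left.trans hs)
  obtain ⟨x, hx, hd⟩ := Metric.mem_closure_iff.1 h1 1 one_pos
  obtain ⟨i, hi, k, hk, rfl⟩ := mem_genSpan_union hK hM.1 hx
  have : IsUnit (i + k) := by
    rw [dist_eq_norm] at hd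
    simpa using (Units.oneSub (1 - (i + k)) hd).isUnit
  obtain ⟨u, hu⟩ := this
  refine ⟨(↑u⁻¹ : B) * i, ci_mul_left hK _ hi, ?_⟩
  have e : 1 - (↑u⁻¹ : B) * i = (↑u⁻¹ : B) * k := by
    rw [sub_eq_iff_eq_add, ← mul_add, add_comm k, ← hu]; simp
  rw [e]; exact ci_mul_left hM.1 _ hk

theorem mem_of_sInter_le (F : Finset (Set B)) (hF : ∀ N ∈ F, IsMaximalIdeal N) {M : Set B}
    (hM : IsMaximalIdeal M) (h : ⋂₀ (F : Set (Set B)) ⊆ M) : M ∈ F := by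
  classical
  induction F using Finset.induction_on with
  | empty => exact absurd (h (by simp)) (max_one hM)
  | insert N F hN ih =>
    by_cases hMN : M = N
    · simp [hMN]
    refine Finset.mem_insert_of_mem (ih (fun N hN => hF N (Finset.mem_insert_of_mem hN)) ?_)
    have hNm := hF N (Finset.mem_insert_self _ _)
    obtain ⟨e, he, he1⟩ := coprime hM hNm.1 (fun hle => hMN (hNm.2.2 M hM.1 hM.2.1 hle))
    intro a ha
    have h1 : e * a ∈ M := by
      apply h
      intro K hK
      rcases Finset.mem_insert.1 (Finset.mem_coe.1 hK) with rfl | hK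
      · exact ci_mul_right hNm.1 _ he
      · exact ci_mul_left (hF K (Finset.mem_insert_of_mem hK)).1 _ (ha K hK)
    have h2 := ci_add hM.1 h1 (ci_mul_right hM.1 a he1)
    rwa [sub_mul, one_mul, add_sub_cancel] at h2

theorem chinese (F : Finset (Set B)) (hF : ∀ N ∈ F, IsMaximalIdeal N) (m : Set B → ℂ) :
    ∃ f : B, ∀ N ∈ F, f - m N • (1 : B) ∈ N := by
  classical
  induction F using Finset.induction_on with
  | empty => exact ⟨0, by simp⟩
  | insert N F hN ih =>
    have hF' : ∀ N ∈ F, IsMaximalIdeal N := fun N hN => hF N (Finset.mem_insert_of_mem hN)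
    obtain ⟨f, hf⟩ := ih hF'
    have hNm := hF N (Finset.mem_insert_self _ _)
    obtain ⟨e, he, he1⟩ := coprime hNm (sInter_closed (F : Set (Set B)) (fun N hN => (hF' N hN).1))
      (fun hle => hN (mem_of_sInter_le F hF' hNm hle))
    refine ⟨f + e * (m N • (1 : B) - f), fun K hK => ?_⟩
    rcases Finset.mem_insert.1 hK with rfl | hK
    · have : f + e * (m K • (1 : B) - f) - m K • (1 : B) = (1 - e) * (f - m K • (1 : B)) := by
        simp only [sub_mul, mul_sub, smul_mul_assoc, mul_smul_comm, one_mul, mul_one, smul_sub]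
        abel
      rw [this]; exact ci_mul_right hNm.1 _ he1
    · rw [add_sub_right_comm]
      exact ci_add (hF' K hK).1 (hf K hK) (ci_mul_right (hF' K hK).1 _ (he K hK))

/-- the supremum of `σ x` over states killing `N` -/
def msup (N : Set B) (x : B) : ℝ := sSup {r | ∃ σ : B →L[ℂ] ℂ, IsState σ ∧ Kills σ N ∧ r = (σ x).re}

theorem le_msup {N : Set B} {x : B} (hx : IsSelfAdjoint x) {σ : B →L[ℂ] ℂ} (hσ : IsState σ)
    (hk : Kills σ N) : (σ x).re ≤ msup N x :=
  le_csSup ⟨‖x‖, by rintro _ ⟨τ, hτ, -, rfl⟩; exact st_re_le hτ hx⟩ ⟨σ, hσ, hk, rfl⟩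

theorem lt_msup {N : Set B} (hN : IsMaximalIdeal N) (x : B) {ε : ℝ} (hε : 0 < ε) :
    ∃ σ : B →L[ℂ] ℂ, IsState σ ∧ Kills σ N ∧ msup N x < (σ x).re + ε := by
  obtain ⟨σ, hσ, hk⟩ := exists_state_kills hN.1 (max_one hN)
  obtain ⟨_, ⟨τ, hτ, hτk, rfl⟩, h⟩ := exists_lt_of_lt_csSup
    (s := {r | ∃ σ : B →L[ℂ] ℂ, IsState σ ∧ Kills σ N ∧ r = (σ x).re}) ⟨_, σ, hσ, hk, rfl⟩
    (show msup N x - ε < sSup _ from sub_lt_self _ hε)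
  exact ⟨τ, hτ, hτk, by linarith⟩

theorem mm_of_finite (F : Finset (Set B)) (hF : ∀ N ∈ F, IsMaximalIdeal N)
    {ω : B →L[ℂ] ℂ} (hω : IsState ω) (hk : Kills ω (⋂₀ (F : Set (Set B)))) :
    IsMaximallyMixed ω := by
  refine key2 (F := (F : Set (Set B))) hF (fun M hM hle => mem_of_sInter_le F hF hM hle) ?_ hω hk
  intro x hx ε hε
  obtain ⟨f, hf⟩ := chinese F hF (fun N => ((msup N x : ℝ) : ℂ))
  set f' := (1 / 2 : ℂ) • (f + star f) with hf'
  have hsa : IsSelfAdjoint f' := by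
    rw [isSelfAdjoint_iff, hf', star_smul, star_add, star_star, add_comm]
    congr 1; simp
  have h1 : ∀ N ∈ F, f' - ((msup N x : ℝ) : ℂ) • (1 : B) ∈ N := by
    intro N hN
    have h2 := ci_star (hF N hN).1 (hf N hN)
    have h3 := ci_smul (hF N hN).1 (1 / 2) (ci_add (hF N hN).1 (hf N hN) h2)
    convert h3 using 1
    rw [star_sub, (sa_smul_one (msup N x)).star_eq, hf']
    module
  have h4 : ∀ N ∈ F, ∀ σ : B →L[ℂ] ℂ, IsState σ → Kills σ N → (σ f').re = msup N x := by
    intro N hN σ hσ hσk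
    have := hσk _ (h1 N hN)
    clear_value f'
    rw [map_sub, map_smul, hσ.2, sub_eq_zero] at this
    rw [this]; simp
  refine ⟨f', hsa, fun a N hN => ?_, fun N hN σ hσ hσk => ?_, fun N hN => ?_⟩
  · have h5 := ci_sub (hF N hN).1 (ci_mul_right (hF N hN).1 a (h1 N hN))
      (ci_mul_left (hF N hN).1 a (h1 N hN))
    convert h5 using 1
    simp only [sub_mul, mul_sub, smul_mul_assoc, mul_smul_comm, one_mul, mul_one]
    abel
  · rw [h4 N hN σ hσ hσk]; exact le_msup hx hσ hσk
  · obtain ⟨σ, hσ, hσk, hlt⟩ := lt_msup (hF N hN) x hε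
    exact ⟨σ, hσ, hσk, by rw [h4 N hN σ hσ hσk]; exact hlt⟩

/-- the states factoring through finitely many simple quotients -/
def finC (B : Type u) [CStarAlgebra B] : Set (B →L[ℂ] ℂ) :=
  {ω | IsState ω ∧ ∃ F : Finset (Set B), (∀ N ∈ F, IsMaximalIdeal N) ∧
    Kills ω (⋂₀ (F : Set (Set B)))}

theorem finC_convex : Convex ℝ (finC B) := by
  classical
  rintro ω ⟨hω, F, hF, hk⟩ τ ⟨hτ, G, hG, hl⟩ a b ha hb hab
  refine ⟨⟨fun x => ?_, ?_⟩, F ∪ G, ?_, ?_⟩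
  · simp only [ContinuousLinearMap.add_apply, ContinuousLinearMap.smul_apply]
    exact add_nonneg (smul_nonneg ha (hω.1 x)) (smul_nonneg hb (hτ.1 x))
  · simp only [ContinuousLinearMap.add_apply, ContinuousLinearMap.smul_apply, hω.2, hτ.2]
    rw [← add_smul, hab, one_smul]
  · intro N hN
    rcases Finset.mem_union.1 hN with h | h
    exacts [hF N h, hG N h]
  · intro x hx
    simp only [ContinuousLinearMap.add_apply, ContinuousLinearMap.smul_apply]
    rw [hk x (fun N hN => hx N (by simp [Finset.mem_coe.1 hN])),
      hl x (fun N hN => hx N (by simp [Finset.mem_coe.1 hN]))]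
    simp

theorem dense_finC {ω : B →L[ℂ] ℂ} (hω : IsState ω) (hk : Kills ω (strongRadical B)) :
    InWeakStarClosure (finC B) ω := by
  have hmem : ∀ M, IsMaximalIdeal M → ∀ σ : B →L[ℂ] ℂ, IsState σ → Kills σ M → σ ∈ finC B :=
    fun M hM σ hσ hσk => ⟨hσ, {M}, by simpa using hM, by simpa using hσk⟩
  have hex : ∀ x : B, IsSelfAdjoint x → ∀ ε : ℝ, 0 < ε →
      ∃ σ ∈ finC B, (ω x).re ≤ (σ x).re + ε := by
    intro x hx ε hε
    have h1 : (x - (((ω x).re - ε : ℝ) : ℂ) • (1 : B))⁺ ∉ strongRadical B := by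
      intro hc
      have := state_nonpos (hx.sub (sa_smul_one _)) hc hω hk
      simp [hω.2] at this
      linarith
    simp only [strongRadical, Set.mem_sInter, not_forall] at h1
    obtain ⟨M, hM, hy⟩ := h1
    obtain ⟨σ, hσ, hσk, hge⟩ := y_lemma hM.1 hx _ hy
    exact ⟨σ, hmem M hM σ hσ hσk, by linarith⟩
  refine inClosure_of_sa finC_convex ?_ (fun σ hσ => hσ.1) hω hex
  obtain ⟨σ, hσ, -⟩ := hex 0 (IsSelfAdjoint.zero B) 1 one_pos
  exact ⟨σ, hσ⟩

theorem finC_mm {ω : B →L[ℂ] ℂ} (h : ω ∈ finC B) : IsMaximallyMixed ω := by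
  obtain ⟨hω, F, hF, hk⟩ := h
  exact mm_of_finite F hF hω hk

theorem strongRadical_closed : IsClosedIdeal (strongRadical B) :=
  sInter_closed _ (fun _ hN => hN.1)

end MM

namespace MM
variable {B : Type u} [CStarAlgebra B] [PartialOrder B] [StarOrderedRing B]

/-- the states killing `I`, as functions -/
def SF (I : Set B) : Set (B → ℂ) := {g | ∃ σ : B →L[ℂ] ℂ, IsState σ ∧ Kills σ I ∧ g = σ}

theorem SF_eq (I : Set B) : SF I = {g : B → ℂ | (∀ a b, g (a + b) = g a + g b) ∧
    (∀ (c : ℂ) a, g (c • a) = c * g a) ∧ (∀ a, ‖g a‖ ≤ ‖a‖) ∧ (∀ a, 0 ≤ g (star a * a)) ∧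
    g 1 = 1 ∧ ∀ x ∈ I, g x = 0} := by
  ext g
  constructor
  · rintro ⟨σ, hσ, hk, rfl⟩
    exact ⟨fun a b => map_add _ _ _, fun c a => by simp, fun a => st_norm_le hσ a,
      fun a => hσ.1 a, hσ.2, hk⟩
  · rintro ⟨h1, h2, h3, h4, h5, h6⟩
    let l : B →ₗ[ℂ] ℂ := ⟨⟨g, h1⟩, fun c a => h2 c a⟩
    exact ⟨l.mkContinuous 1 (fun a => by simpa [l] using h3 a), ⟨h4, h5⟩, h6, rfl⟩

theorem SF_compact (I : Set B) : IsCompact (SF I) := by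
  have hc : IsCompact (Set.pi Set.univ (fun b : B => Metric.closedBall (0 : ℂ) ‖b‖)) :=
    isCompact_univ_pi (fun b => isCompact_closedBall _ _)
  refine hc.of_isClosed_subset ?_ ?_
  · rw [SF_eq]
    simp only [Set.setOf_and, Set.setOf_forall]
    refine IsClosed.inter ?_ (IsClosed.inter ?_ (IsClosed.inter ?_ (IsClosed.inter ?_
      (IsClosed.inter ?_ ?_))))
    · exact isClosed_iInter fun a => isClosed_iInter fun b =>
        isClosed_eq (by fun_prop) (by fun_prop)
    · exact isClosed_iInter fun a => isClosed_iInter fun b =>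
        isClosed_eq (by fun_prop) (by fun_prop)
    · exact isClosed_iInter fun a => isClosed_le (by fun_prop) (by fun_prop)
    · exact isClosed_iInter fun a => isClosed_le (by fun_prop) (by fun_prop)
    · exact isClosed_eq (by fun_prop) (by fun_prop)
    · exact isClosed_iInter fun a => isClosed_iInter fun _ =>
        isClosed_eq (by fun_prop) (by fun_prop)
  · rw [SF_eq]
    rintro g ⟨_, _, h, _⟩ b -
    simpa using h b

theorem exists_kill {ω : B →L[ℂ] ℂ} (hω : IsState ω) {N : Set B} (hN : IsClosedIdeal N)
    (h : ∀ x ∈ N, 0 ≤ x → ∀ ε : ℝ, 0 < ε → ∃ φ : B →L[ℂ] B, IsElementaryUCP φ ∧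
      (ω (φ x)).re ≤ ε) :
    ∃ ρ : B →L[ℂ] ℂ, IsState ρ ∧ Kills ρ N ∧ InWeakStarClosure (mixSet ω) ρ := by
  classical
  have h1 : ∀ p : Finset N × ℕ, ∃ σ ∈ mixSet ω, ∀ x ∈ p.1, ‖σ (x : B)‖ ^ 2 ≤ 1 / ((p.2 : ℝ) + 1) := by
    rintro ⟨s, n⟩
    obtain ⟨φ, hφ, hle⟩ := h (∑ x ∈ s, star (x : B) * (x : B))
      (ci_sum hN _ (fun x _ => ci_mul_left hN _ x.2))
      (Finset.sum_nonneg (fun x _ => star_mul_self_nonneg _)) (1 / ((n : ℝ) + 1)) (by positivity)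
    refine ⟨_, ⟨φ, hφ, rfl⟩, fun x hx => ?_⟩
    have hst := state_comp hω hφ
    refine (st_cs hst (x : B)).trans (le_trans ?_ hle)
    exact pf_re_mono hst.1 (Finset.single_le_sum (f := fun x : N => star (x : B) * (x : B))
      (fun x _ => star_mul_self_nonneg _) hx)
  choose σ hσ hle using h1
  let U : Ultrafilter (Finset N × ℕ) := Ultrafilter.of Filter.atTop
  have hU : (U : Filter (Finset N × ℕ)) ≤ Filter.atTop := Ultrafilter.of_le _
  obtain ⟨g, ⟨ρ, hρ, -, rfl⟩, hlim⟩ := isCompact_iff_ultrafilter_le_nhds'.1 (SF_compact (∅ : Set B))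
    (U.map (fun p => (σ p : B → ℂ))) (Filter.mem_map.2 (Filter.Eventually.of_forall
      (fun p => ⟨σ p, mixSet_state hω _ (hσ p), fun x hx => absurd hx (by simp), rfl⟩)))
  have hlim' : ∀ b : B, Filter.Tendsto (fun p => σ p b) U (nhds (ρ b)) := fun b =>
    (tendsto_pi_nhds.1 (show Filter.Tendsto (fun p => (σ p : B → ℂ)) U (nhds (ρ : B → ℂ)) from hlim)) b
  refine ⟨ρ, hρ, fun x hx => ?_, fun ε hε n xs => ?_⟩
  · have h2 : Filter.Tendsto (fun p => ‖σ p x‖ ^ 2) U (nhds (‖ρ x‖ ^ 2)) := ((hlim' x).norm).pow 2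
    have h3 : Filter.Tendsto (fun p : Finset N × ℕ => 1 / ((p.2 : ℝ) + 1)) U (nhds 0) := by
      have : Filter.Tendsto (fun p : Finset N × ℕ => p.2) Filter.atTop Filter.atTop := by
        rw [← Filter.prod_atTop_atTop_eq]; exact Filter.tendsto_snd
      exact (tendsto_one_div_add_atTop_nhds_zero_nat.comp this).mono_left hU
    have h4 : ‖ρ x‖ ^ 2 ≤ 0 := by
      refine le_of_tendsto_of_tendsto h2 h3 ?_
      have : ∀ᶠ p : Finset N × ℕ in Filter.atTop, ({⟨x, hx⟩}, 0) ≤ p := Filter.eventually_ge_atTop _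
      filter_upwards [hU this] with p hp
      exact hle p ⟨x, hx⟩ (hp.1 (by simp))
    have h5 : ‖ρ x‖ = 0 := by nlinarith [norm_nonneg (ρ x)]
    simpa using h5
  · have h2 : ∀ᶠ p in (U : Filter (Finset N × ℕ)), ∀ i, ‖ρ (xs i) - σ p (xs i)‖ < ε := by
      rw [Filter.eventually_all]
      intro i
      have := Metric.tendsto_nhds.1 (hlim' (xs i)) ε hε
      filter_upwards [this] with p hp
      rwa [dist_comm, dist_eq_norm] at hp
    obtain ⟨p, hp⟩ := h2.exists
    exact ⟨σ p, hσ p, hp⟩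

theorem kills_trans {ω ρ : B →L[ℂ] ℂ} {N : Set B} (hN : IsClosedIdeal N) (hk : Kills ρ N)
    (h : InWeakStarClosure (mixSet ρ) ω) : Kills ω N :=
  kills_of_closure (mixSet_kills hN hk) h

/-- `g = ε - h` has positive part outside a proper ideal containing `h`. -/
theorem posPart_notMem {N : Set B} (hN : IsClosedIdeal N) (h1 : (1 : B) ∉ N) {h : B} (hh : h ∈ N)
    (hs : IsSelfAdjoint h) {ε : ℝ} (hε : 0 < ε) : ((ε : ℂ) • (1 : B) - h)⁺ ∉ N := by
  intro hc
  obtain ⟨σ, hσ, hk⟩ := exists_state_kills hN h1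
  have := state_nonpos ((sa_smul_one ε).sub hs) hc hσ hk
  rw [map_sub, hk _ hh] at this
  simp [hσ.2] at this
  linarith

theorem ucp_one {φ : B →L[ℂ] B} (hφ : IsElementaryUCP φ) : φ 1 = 1 := by
  obtain ⟨n, a, h1, h⟩ := hφ
  rw [h]; simpa using h1

theorem zero_closedIdeal : IsClosedIdeal ({0} : Set B) :=
  ⟨isClosed_singleton, rfl, by simp, by simp, by simp⟩

theorem mm_kills_radical {ω : B →L[ℂ] ℂ} (h : IsMaximallyMixed ω) : Kills ω (strongRadical B) := by
  obtain ⟨ρ, hρ, hk, hc⟩ := exists_kill h.1 (strongRadical_closed (B := B)) (fun x hx hx0 ε hε => by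
    obtain ⟨φ, hφ, hall⟩ := lemmaM zero_closedIdeal
      ((sa_smul_one (ε / 2)).sub hx0.isSelfAdjoint)
      (fun M hM _ => posPart_notMem hM.1 (max_one hM) (hx M hM) hx0.isSelfAdjoint
        (show 0 < ε / 2 by positivity)) (show 0 < ε / 2 by positivity)
    refine ⟨φ, hφ, ?_⟩
    have := hall ω h.1 (by rintro x rfl; simp)
    rw [map_sub, map_sub, map_smul, ucp_one hφ, map_smul, h.1.2] at this
    simp at this
    linarith)
  exact kills_trans strongRadical_closed hk (h.2 ρ hρ hc)

end MM

namespace MM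
variable {B : Type u} [CStarAlgebra B] [PartialOrder B] [StarOrderedRing B]

theorem closure_mono' {S T : Set (B →L[ℂ] ℂ)} (hST : S ⊆ T) {ρ : B →L[ℂ] ℂ}
    (h : InWeakStarClosure S ρ) : InWeakStarClosure T ρ := fun ε hε n x => by
  obtain ⟨σ, hσ, hh⟩ := h ε hε n x
  exact ⟨σ, hST hσ, hh⟩

section rep
variable {P : Set B}

attribute [local instance] IrreducibleRepWitness.nacg IrreducibleRepWitness.ips
  IrreducibleRepWitness.cplt IrreducibleRepWitness.nontriv

theorem mem_prim (W : IrreducibleRepWitness B P) {x : B} : x ∈ P ↔ W.π x = 0 := by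
  have := W.ker_eq'
  constructor
  · intro h; rw [this] at h; exact h
  · intro h; rw [this]; exact h

theorem prim_closed (W : IrreducibleRepWitness B P) : IsClosedIdeal P := by
  have hm : ∀ x, x ∈ P ↔ W.π x = 0 := fun x => mem_prim W
  refine ⟨?_, by simp [hm], ?_, ?_, ?_⟩
  · have : P = {a | W.π a = 0} := Set.ext hm
    rw [this]
    exact isClosed_eq W.π.continuous continuous_const
  · intro x hx y hy
    simp only [hm] at *
    rw [map_add, hx, hy, add_zero]
  · intro c x hx
    simp only [hm] at *
    rw [map_smul, hx, smul_zero]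
  · intro a x hx
    simp only [hm] at *
    rw [W.map_mul', W.map_mul', hx, mul_zero, zero_mul]
    exact ⟨rfl, rfl⟩

theorem prim_one (W : IrreducibleRepWitness B P) : (1 : B) ∉ P := by
  rw [mem_prim W, W.map_one']
  exact one_ne_zero

/-- vector functional -/
def vecF (W : IrreducibleRepWitness B P) (ξ : W.space) : B →L[ℂ] ℂ :=
  (innerSL ℂ ξ).comp ((ContinuousLinearMap.apply ℂ W.space ξ).comp W.π)

theorem vecF_apply (W : IrreducibleRepWitness B P) (ξ : W.space) (a : B) : vecF W ξ a = inner ℂ ξ (W.π a ξ) := rfl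

theorem vecF_sq (W : IrreducibleRepWitness B P) (ξ : W.space) (a : B) : vecF W ξ (star a * a) = ((‖W.π a ξ‖ ^ 2 : ℝ) : ℂ) := by
  rw [vecF_apply, W.map_mul', W.map_star', ContinuousLinearMap.mul_apply,
    ContinuousLinearMap.star_eq_adjoint, ContinuousLinearMap.adjoint_inner_right,
    inner_self_eq_norm_sq_to_K]
  simp

theorem vecF_state (W : IrreducibleRepWitness B P) {ξ : W.space} (hξ : ‖ξ‖ = 1) : IsState (vecF W ξ) := by
  refine ⟨fun a => ?_, ?_⟩
  · rw [vecF_sq]; exact_mod_cast sq_nonneg ‖W.π a ξ‖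
  · have := vecF_sq W ξ 1
    rw [star_one, one_mul, W.map_one', ContinuousLinearMap.one_apply, hξ] at this
    simpa using this

theorem zero_of_dense (W : IrreducibleRepWitness B P) {ξ : W.space} (hξ : ξ ≠ 0) {T : W.space →L[ℂ] W.space}
    (h : ∀ b : B, T (W.π b ξ) = 0) : T = 0 := by
  have : (T : W.space → W.space) = (0 : W.space →L[ℂ] W.space) := by
    refine Continuous.ext_on (W.irreducible' ξ hξ) T.continuous (0 : W.space →L[ℂ] W.space).continuous ?_
    rintro _ ⟨b, rfl⟩
    simpa using h b
  exact DFunLike.coe_injective this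

theorem part1_aux (W : IrreducibleRepWitness B P) (hJ : strongRadical B ⊆ P)
    (hcl : ∀ ρ : B →L[ℂ] ℂ, InWeakStarClosure {ω : B →L[ℂ] ℂ | IsMaximallyMixed ω} ρ →
      IsMaximallyMixed ρ) : IsMaximalIdeal P := by
  have hPc := prim_closed W
  obtain ⟨ξ, hξ⟩ : ∃ ξ : W.space, ‖ξ‖ = 1 := exists_norm_eq W.space zero_le_one
  have hξ0 : ξ ≠ 0 := by rintro rfl; simp at hξ
  have hω := vecF_state W hξ
  have hωP : Kills (vecF W ξ) P := by
    intro x hx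
    rw [vecF_apply, (mem_prim W).1 hx]; simp
  have hmm : IsMaximallyMixed (vecF W ξ) :=
    hcl _ (closure_mono' (fun σ hσ => finC_mm hσ) (dense_finC hω (fun x hx => hωP x (hJ hx))))
  obtain ⟨N, hN, hPN⟩ := exists_maximal hPc (prim_one W)
  obtain ⟨ρ, hρ, hk, hc⟩ := exists_kill hω hN.1 (fun x hx hx0 ε hε => by
    have hs := posPart_notMem hN.1 (max_one hN) hx hx0.isSelfAdjoint (show 0 < ε / 2 by positivity)
    have hgsa := (sa_smul_one (B := B) (ε / 2)).sub hx0.isSelfAdjoint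
    set g := ((ε / 2 : ℝ) : ℂ) • (1 : B) - x with hg
    have hsP : W.π g⁺ ≠ 0 := fun h0 => hs (hPN ((mem_prim W).2 h0))
    obtain ⟨b, hb⟩ : ∃ b : B, W.π g⁺ (W.π b ξ) ≠ 0 := by
      by_contra hcon
      push Not at hcon
      exact hsP (zero_of_dense W hξ0 hcon)
    set η : ℝ := (ε / 2) / (4 * (‖g‖ + 1)) with hη
    have hη0 : 0 < η := by positivity
    obtain ⟨_, hd, ⟨a, rfl⟩⟩ := Metric.dense_iff.1 (W.irreducible' _ hb) ξ (√η)
      (Real.sqrt_pos.2 hη0)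
    obtain ⟨φ, hφ, hall⟩ := lemmaL hgsa (t := a * g⁺ * b)
      (Submodule.subset_span ⟨a, b, g⁺, rfl, rfl⟩) hη0
    refine ⟨φ, hφ, ?_⟩
    have h1 := hall _ hω (by
      rw [vecF_sq, Complex.ofReal_re, map_sub, W.map_one', W.map_mul', W.map_mul']
      rw [mem_ball_iff_norm'] at hd
      have h6 := pow_le_pow_left₀ (norm_nonneg _) hd.le 2
      rw [Real.sq_sqrt hη0.le] at h6
      simpa using h6)
    have h4 : 4 * η * ‖g‖ ≤ ε / 2 := by
      have : 4 * η * (‖g‖ + 1) = ε / 2 := by rw [hη]; field_simp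
      nlinarith
    rw [hg, map_sub, map_sub, map_smul, ucp_one hφ, map_smul, hω.2, ← hg] at h1
    simp at h1
    linarith)
  have hkN : Kills (vecF W ξ) N := kills_trans hN.1 hk (hmm.2 ρ hρ hc)
  have hNP : N ⊆ P := by
    intro x hx
    rw [mem_prim W]
    refine zero_of_dense W hξ0 (fun b => ?_)
    have h1 := hkN _ (ci_mul_left hN.1 (star (x * b)) (ci_mul_right hN.1 b hx))
    rw [vecF_sq, W.map_mul'] at h1
    simpa using h1
  rw [hPN.antisymm hNP]
  exact hN

end rep

theorem part1 (hcl : ∀ ρ : B →L[ℂ] ℂ, InWeakStarClosure {ω : B →L[ℂ] ℂ | IsMaximallyMixed ω} ρ →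
      IsMaximallyMixed ρ) (P : Set B) (hP : IsPrimitiveIdeal P) (hJ : strongRadical B ⊆ P) :
    IsMaximalIdeal P := by
  obtain ⟨W⟩ := hP
  exact part1_aux W hJ hcl

end MM

namespace MM
variable {B : Type u} [CStarAlgebra B] [PartialOrder B] [StarOrderedRing B]

theorem SF_convex (I : Set B) : Convex ℝ (SF I) := by
  rintro _ ⟨σ, hσ, hk, rfl⟩ _ ⟨τ, hτ, hl, rfl⟩ a b ha hb hab
  refine ⟨(a : ℂ) • σ + (b : ℂ) • τ, ⟨fun x => ?_, ?_⟩, fun x hx => ?_, ?_⟩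
  · simp only [ContinuousLinearMap.add_apply, ContinuousLinearMap.smul_apply, smul_eq_mul]
    exact add_nonneg (mul_nonneg (by exact_mod_cast ha) (hσ.1 x))
      (mul_nonneg (by exact_mod_cast hb) (hτ.1 x))
  · simp only [ContinuousLinearMap.add_apply, ContinuousLinearMap.smul_apply, smul_eq_mul, hσ.2,
      hτ.2, mul_one]
    exact_mod_cast hab
  · simp [hk x hx, hl x hx]
  · ext x; simp

theorem exists_extreme {I : Set B} (hI : IsClosedIdeal I) {a : B} (ha : a ∉ I) :
    ∃ σ : B →L[ℂ] ℂ, IsState σ ∧ Kills σ I ∧ (σ : B → ℂ) ∈ (SF I).extremePoints ℝ ∧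
      σ (star a * a) ≠ 0 := by
  by_contra hcon
  push Not at hcon
  have h1 := closure_convexHull_extremePoints (SF_compact I) (SF_convex I)
  have h2 : closure (convexHull ℝ ((SF I).extremePoints ℝ)) ⊆ {g : B → ℂ | g (star a * a) = 0} := by
    refine closure_minimal (convexHull_min ?_ ?_) (isClosed_eq (by fun_prop) (by fun_prop))
    · intro g hg
      obtain ⟨σ, hσ, hk, rfl⟩ := extremePoints_subset hg
      exact hcon σ hσ hk hg
    · intro x hx y hy s t _ _ _
      simp only [Set.mem_setOf_eq] at *
      simp [hx, hy]
  rw [h1] at h2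
  obtain ⟨σ, hσ, hk, hp⟩ := exists_state hI ha
  have h3 : σ (star a * a) = 0 := h2 ⟨σ, hσ, hk, rfl⟩
  rw [h3] at hp
  simp at hp

theorem extreme_prop {I : Set B} (hI : IsClosedIdeal I) {σ : B →L[ℂ] ℂ} (hσ : IsState σ)
    (hk : Kills σ I) (he : (σ : B → ℂ) ∈ (SF I).extremePoints ℝ) {τ : B →L[ℂ] ℂ}
    (hτ : IsPositiveFunctional τ) (hd : IsPositiveFunctional (σ - τ)) : τ = τ 1 • σ := by
  have hτk : Kills τ I := by
    intro x hx
    refine pf_zero_of_sq hτ (le_antisymm ?_ (hτ x))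
    have := hd x
    rw [ContinuousLinearMap.sub_apply, hk _ (ci_mul_left hI _ hx), zero_sub] at this
    exact neg_nonneg.1 this
  by_cases h0 : τ 1 = 0
  · have h2 := pf_zero_of_one hτ h0
    refine ContinuousLinearMap.ext fun x => ?_
    rw [ContinuousLinearMap.smul_apply, h0, h2]
    simp
  by_cases h1 : (σ - τ) 1 = 0
  · have h2 := pf_zero_of_one hd h1
    rw [sub_eq_zero] at h2
    rw [← h2, hσ.2, one_smul]
  obtain ⟨c, hc, hc1, hcs⟩ := normalize hτ h0
  obtain ⟨d, hdp, hd1, hds⟩ := normalize hd h1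
  have hcd : c + d = 1 := by
    rw [ContinuousLinearMap.sub_apply, hc1, hσ.2] at hd1
    have : (1 : ℂ) = (d + c : ℝ) := by push_cast; rw [← hd1]; ring
    rw [add_comm]; exact_mod_cast this.symm
  have hext := (mem_extremePoints.1 he).2 _ ⟨_, hcs, fun x hx => by simp [hτk x hx], rfl⟩ _
    ⟨_, hds, fun x hx => by simp [hτk x hx, hk x hx], rfl⟩ ⟨c, d, hc, hdp, hcd, by
      ext x
      simp [hc.ne', hdp.ne']⟩
  have h3 := hext.1
  ext x
  have h4 := congrFun h3 x
  rw [ContinuousLinearMap.smul_apply, ← h4, hc1]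
  simp [hc.ne']

theorem gns_exists {σ : B →L[ℂ] ℂ} (hσ : IsState σ) :
    ∃ (H : Type u) (_ : NormedAddCommGroup H) (_ : InnerProductSpace ℂ H) (_ : CompleteSpace H)
      (π : B →L[ℂ] (H →L[ℂ] H)) (ξ : H), (∀ x y : B, π (x * y) = π x * π y) ∧
      (∀ x : B, π (star x) = star (π x)) ∧ π 1 = 1 ∧ (∀ a : B, inner ℂ ξ (π a ξ) = σ a) ∧
      DenseRange (fun a : B => π a ξ) := by
  let f := plm σ hσ.1
  let π0 := f.gnsStarAlgHom
  let π : B →L[ℂ] (f.GNS →L[ℂ] f.GNS) :=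
    LinearMap.mkContinuous (π0 : B →ₗ[ℂ] (f.GNS →L[ℂ] f.GNS)) 1 (fun x => by
      rw [one_mul]
      exact NonUnitalStarAlgHom.norm_apply_le (f.gnsNonUnitalStarAlgHom) x)
  have hπ : ∀ a, π a = f.gnsNonUnitalStarAlgHom a := fun a => rfl
  have hπ0 : ∀ a, π a = π0 a := fun a => rfl
  have hact : ∀ a b : B, π a ((f.toPreGNS b : f.PreGNS) : f.GNS) =
      ((f.toPreGNS (a * b) : f.PreGNS) : f.GNS) := by
    intro a b
    rw [hπ, PositiveLinearMap.gnsNonUnitalStarAlgHom_apply_coe]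
    rfl
  refine ⟨f.GNS, inferInstance, inferInstance, inferInstance, π,
    ((f.toPreGNS 1 : f.PreGNS) : f.GNS), ?_, ?_, ?_, ?_, ?_⟩
  · intro x y; rw [hπ, hπ, hπ, map_mul]
  · intro x; rw [hπ, hπ, map_star]
  · rw [hπ0]; exact map_one π0
  · intro a
    rw [hact, UniformSpace.Completion.inner_coe, PositiveLinearMap.preGNS_inner_def]
    simp [f, plm_apply]
  · have h1 := UniformSpace.Completion.denseRange_coe (α := f.PreGNS)
    have h2 : (fun a : B => π a ((f.toPreGNS 1 : f.PreGNS) : f.GNS)) =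
        fun a : B => ((f.toPreGNS a : f.PreGNS) : f.GNS) := by
      funext a
      rw [hact, mul_one]
    rw [h2]
    exact h1

theorem extreme_primitive {I : Set B} (hI : IsClosedIdeal I) {σ : B →L[ℂ] ℂ} (hσ : IsState σ)
    (hk : Kills σ I) (he : (σ : B → ℂ) ∈ (SF I).extremePoints ℝ) :
    ∃ P : Set B, IsPrimitiveIdeal P ∧ I ⊆ P ∧ ∀ x ∈ P, σ x = 0 := by
  obtain ⟨H, i1, i2, i3, π, ξ, hmul, hstar, hone, hσa, hdense⟩ := gns_exists hσ
  have hinner : ∀ (a : B) (v w : H), inner ℂ v (π a w) = inner ℂ (π (star a) v) w := by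
    intro a v w
    rw [hstar, ContinuousLinearMap.star_eq_adjoint, ContinuousLinearMap.adjoint_inner_left]
  have hξ : ξ ≠ 0 := by
    rintro rfl
    have := hσa 1
    rw [hσ.2] at this
    simp at this
  haveI hnt : Nontrivial H := ⟨ξ, 0, hξ⟩
  refine ⟨{a | π a = 0}, ⟨IrreducibleRepWitness.mk H π hmul hstar hone ?_ rfl⟩, ?_, ?_⟩
  · intro ζ hζ
    let K0 : Submodule ℂ H := LinearMap.range
      (((ContinuousLinearMap.apply ℂ H ζ).comp π : B →L[ℂ] H) : B →ₗ[ℂ] H)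
    let K := K0.topologicalClosure
    have hK0 : ∀ v, v ∈ K0 ↔ ∃ a, π a ζ = v := fun v => Iff.rfl
    have hKinv : ∀ a : B, ∀ v ∈ K, π a v ∈ K := by
      intro a v hv
      have hmaps : Set.MapsTo (π a) (K0 : Set H) (K0 : Set H) := by
        rintro _ ⟨b, rfl⟩
        exact ⟨a * b, by
          change π (a * b) ζ = π a (π b ζ)
          rw [hmul]; rfl⟩
      exact hmaps.closure (π a).continuous hv
    have hKo : ∀ a : B, ∀ v ∈ Kᗮ, π a v ∈ Kᗮ := by
      intro a v hv w hw
      rw [hinner]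
      exact hv _ (hKinv _ _ hw)
    haveI : CompleteSpace K := K0.isClosed_topologicalClosure.completeSpace_coe
    set p := K.starProjection with hp
    have hpK : ∀ v, p v ∈ K := fun v => K.starProjection_apply_mem v
    have hpo : ∀ v, v - p v ∈ Kᗮ := fun v => K.sub_starProjection_mem_orthogonal v
    have hcomm : ∀ (a : B) (v : H), p (π a v) = π a (p v) := by
      intro a v
      refine Submodule.eq_starProjection_of_mem_orthogonal' (hKinv a _ (hpK v)) (hKo a _ (hpo v)) ?_
      rw [← map_add]; congr 1; abel
    have hpp : ∀ v w : H, inner ℂ v (p w) = inner ℂ (p v) (p w) := by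
      intro v w
      have : inner ℂ (v - p v) (p w) = 0 := (Submodule.mem_orthogonal' _ _).1 (hpo v) _ (hpK w)
      rw [inner_sub_left, sub_eq_zero] at this
      exact this
    let τ : B →L[ℂ] ℂ := (innerSL ℂ ξ).comp ((ContinuousLinearMap.apply ℂ H (p ξ)).comp π)
    have hτa : ∀ a, τ a = inner ℂ ξ (π a (p ξ)) := fun a => rfl
    have hτ2 : ∀ a b, τ (star b * a) = inner ℂ (π b ξ) (p (π a ξ)) := by
      intro a b
      rw [hτa, hmul, ContinuousLinearMap.mul_apply, hinner, star_star, hcomm]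
    have hσ2 : ∀ a b, σ (star b * a) = inner ℂ (π b ξ) (π a ξ) := by
      intro a b
      rw [← hσa, hmul, ContinuousLinearMap.mul_apply, hinner, star_star]
    have hτpos : IsPositiveFunctional τ := by
      intro a
      rw [hτ2, hpp, inner_self_eq_norm_sq_to_K]
      rw [← RCLike.ofReal_pow]
      exact Complex.zero_le_real.2 (sq_nonneg _)
    have hdpos : IsPositiveFunctional (σ - τ) := by
      intro a
      rw [ContinuousLinearMap.sub_apply, hτ2, hσ2, ← inner_sub_right]
      have h1 : inner ℂ (π a ξ) (π a ξ - p (π a ξ)) =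
          inner ℂ (π a ξ - p (π a ξ)) (π a ξ - p (π a ξ)) := by
        have : inner ℂ (p (π a ξ)) (π a ξ - p (π a ξ)) = 0 := hpo (π a ξ) _ (hpK _)
        rw [inner_sub_left, this, sub_zero]
      rw [h1, inner_self_eq_norm_sq_to_K]
      rw [← RCLike.ofReal_pow]
      exact Complex.zero_le_real.2 (sq_nonneg _)
    have hτσ := extreme_prop hI hσ hk he hτpos hdpos
    set c := τ 1 with hc
    have hpc : ∀ v, p v = c • v := by
      have hfun : ∀ a, p (π a ξ) = c • π a ξ := by
        intro a
        rw [← sub_eq_zero]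
        refine hdense.eq_zero_of_inner_right (𝕜 := ℂ) ?_
        intro b
        rw [inner_sub_right, inner_smul_right, ← hτ2, ← hσ2, hτσ]
        simp
      have : (p : H → H) = (c • (1 : H →L[ℂ] H) : H →L[ℂ] H) := by
        refine Continuous.ext_on hdense p.continuous (c • (1 : H →L[ℂ] H)).continuous ?_
        rintro _ ⟨b, rfl⟩
        simpa using hfun b
      intro v
      rw [this]; simp
    have hζK : ζ ∈ K := K0.le_topologicalClosure ⟨1, by
      change π 1 ζ = ζ
      rw [hone]; rfl⟩
    have h1 : p ζ = ζ := Submodule.starProjection_eq_self_iff.2 hζK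
    have hc1 : c = 1 := by
      rw [hpc] at h1
      have : (c - 1) • ζ = 0 := by rw [sub_smul, h1, one_smul, sub_self]
      exact sub_eq_zero.1 ((smul_eq_zero.1 this).resolve_right hζ)
    intro v
    have h2 : v ∈ K := by
      have := hpK v
      rwa [hpc, hc1, one_smul] at this
    refine closure_mono ?_ h2
    rintro _ ⟨a, rfl⟩
    exact ⟨a, rfl⟩
  · intro x hx
    have h1 : (π x : H → H) = (0 : H →L[ℂ] H) := by
      refine Continuous.ext_on hdense (π x).continuous (0 : H →L[ℂ] H).continuous ?_
      rintro _ ⟨b, rfl⟩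
      have h2 : inner ℂ (π x (π b ξ)) (π x (π b ξ)) = (0 : ℂ) := by
        have h3 := hk _ (ci_mul_left hI (star (x * b)) (ci_mul_right hI b hx))
        rw [← hσa, hmul, ContinuousLinearMap.mul_apply, hinner, star_star, hmul] at h3
        exact h3
      simpa using h2
    exact DFunLike.coe_injective h1
  · intro x hx
    have : π x = 0 := hx
    rw [← hσa, this]; simp

/-- a closed ideal is the intersection of the primitive ideals above it -/
theorem exists_primitive {I : Set B} (hI : IsClosedIdeal I) {a : B} (ha : a ∉ I) :
    ∃ P : Set B, IsPrimitiveIdeal P ∧ I ⊆ P ∧ a ∉ P := by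
  obtain ⟨σ, hσ, hk, he, hne⟩ := exists_extreme hI ha
  obtain ⟨P, hP, hIP, hall⟩ := extreme_primitive hI hσ hk he
  refine ⟨P, hP, hIP, fun haP => hne (hall _ ?_)⟩
  obtain ⟨W⟩ := hP
  exact ci_mul_left (prim_closed W) _ haP

end MM

namespace MM
variable {B : Type u} [CStarAlgebra B] [PartialOrder B] [StarOrderedRing B]

/-- the largest closed ideal in the kernel of a functional -/
def kerI (σ : B →L[ℂ] ℂ) : Set B := {x | ∀ a b, σ (a * x * b) = 0}

theorem kerI_closed (σ : B →L[ℂ] ℂ) : IsClosedIdeal (kerI σ) := by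
  refine ⟨?_, ?_, ?_, ?_, ?_⟩
  · have : kerI σ = ⋂ a, ⋂ b, {x | σ (a * x * b) = 0} := by
      ext x; simp [kerI]
    rw [this]
    refine isClosed_iInter fun a => isClosed_iInter fun b => isClosed_eq ?_ continuous_const
    exact σ.continuous.comp (by fun_prop)
  · intro a b; simp
  · intro x hx y hy a b
    rw [mul_add, add_mul, map_add, hx, hy, add_zero]
  · intro c x hx a b
    rw [mul_smul_comm, smul_mul_assoc, map_smul, hx, smul_zero]
  · intro c x hx
    refine ⟨fun a b => ?_, fun a b => ?_⟩
    · have := hx (a * c) b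
      rwa [mul_assoc a c x] at this
    · have := hx a (c * b)
      rwa [← mul_assoc, mul_assoc a x c] at this

theorem kerI_one {σ : B →L[ℂ] ℂ} (hσ : IsState σ) : (1 : B) ∉ kerI σ := by
  intro h
  have := h 1 1
  simp [hσ.2] at this

theorem extreme_central {I : Set B} (hI : IsClosedIdeal I) {σ : B →L[ℂ] ℂ} (hσ : IsState σ)
    (hk : Kills σ I) (he : (σ : B → ℂ) ∈ (SF I).extremePoints ℝ) {z : B}
    (hz : ∀ a, z * a = a * z) (a : B) : σ (z * a) = σ z * σ a := by
  have step1 : ∀ w : B, (∀ a, w * a = a * w) → 0 ≤ w → w ≤ 1 → ∀ a, σ (w * a) = σ w * σ a := by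
    intro w hw h0 h1 a
    have hp : ∀ v : B, (∀ a, v * a = a * v) → 0 ≤ v →
        IsPositiveFunctional (σ.comp (ContinuousLinearMap.mul ℂ B v)) := by
      intro v hv hv0 b
      change 0 ≤ σ (v * (star b * b))
      rw [← mul_assoc, hv (star b)]
      exact pf_nonneg hσ.1 (star_left_conjugate_nonneg hv0 b)
    have h2 := extreme_prop hI hσ hk he (hp w hw h0) (by
      have h3 := hp (1 - w) (fun a => by rw [sub_mul, mul_sub, hw]; simp) (sub_nonneg.2 h1)
      have : σ - σ.comp (ContinuousLinearMap.mul ℂ B w) =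
          σ.comp (ContinuousLinearMap.mul ℂ B (1 - w)) := by
        ext x; simp [sub_mul]
      rw [this]; exact h3)
    have := congrArg (fun f : B →L[ℂ] ℂ => f a) h2
    simpa using this
  have step2 : ∀ w : B, IsSelfAdjoint w → (∀ a, w * a = a * w) → ∀ a, σ (w * a) = σ w * σ a := by
    intro w hs hw a
    set r : ℝ := ‖w‖ + 1 with hr
    have hr0 : 0 < r := by positivity
    have hle : w ≤ ((r : ℝ) : ℂ) • (1 : B) := by
      refine (sa_le_norm hs).trans ?_
      rw [← algMap_eq, ← algMap_eq]
      exact algebraMap_mono B (by linarith)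
    have hge : -(((r : ℝ) : ℂ) • (1 : B)) ≤ w := by
      refine le_trans ?_ (sa_ge_norm hs)
      rw [← algMap_eq, ← algMap_eq]
      exact neg_le_neg (algebraMap_mono B (by linarith))
    set u : B := w + ((r : ℝ) : ℂ) • (1 : B) with hu
    have hu0 : 0 ≤ u := by rw [hu]; exact neg_le_iff_add_nonneg.1 hge
    have hu1 : u ≤ ((2 * r : ℝ) : ℂ) • (1 : B) := by
      rw [hu]
      have : ((2 * r : ℝ) : ℂ) • (1 : B) = ((r : ℝ) : ℂ) • (1 : B) + ((r : ℝ) : ℂ) • (1 : B) := by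
        rw [← add_smul]; push_cast; ring_nf
      rw [this]
      exact add_le_add_left hle _
    have hinv : (((2 * r)⁻¹ : ℝ) • u) ≤ 1 := by
      have h1 := smul_le_smul_of_nonneg_left hu1 (inv_nonneg.2 (by positivity : 0 ≤ 2 * r))
      refine h1.trans_eq ?_
      rw [← algMap_eq, Algebra.algebraMap_eq_smul_one, smul_smul, inv_mul_cancel₀ (by positivity),
        one_smul]
    have huc : ∀ a, u * a = a * u := by
      intro a
      rw [hu, add_mul, mul_add, hw, smul_mul_assoc, mul_smul_comm, one_mul, mul_one]
    have h := step1 ((2 * r)⁻¹ • u) (fun a => by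
      rw [smul_mul_assoc, mul_smul_comm, huc])
      (smul_nonneg (by positivity) hu0) hinv a
    have e : ((2 * r)⁻¹ : ℝ) • u = (((2 * r)⁻¹ : ℝ) : ℂ) • u := (Complex.coe_smul _ _).symm
    rw [e, smul_mul_assoc, map_smul, map_smul, smul_eq_mul, smul_eq_mul, mul_assoc] at h
    have h' := mul_left_cancel₀ (by
      rw [Complex.ofReal_ne_zero]; positivity) h
    rw [hu, add_mul, map_add, map_add, add_mul] at h'
    simp only [smul_mul_assoc, one_mul, map_smul, hσ.2, smul_eq_mul, mul_one] at h'
    exact add_right_cancel h'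
  have hzs : ∀ a, star z * a = a * star z := by
    intro a
    have := congrArg star (hz (star a))
    simpa using this.symm
  have e := realPart_add_I_smul_imaginaryPart z
  have hre : ∀ a, (realPart z : B) * a = a * (realPart z : B) := by
    intro a
    rw [realPart_apply_coe]
    simp [add_mul, mul_add, hz, hzs]
  have him : ∀ a, (imaginaryPart z : B) * a = a * (imaginaryPart z : B) := by
    intro a
    rw [imaginaryPart_apply_coe]
    simp [sub_mul, mul_sub, hz, hzs]
  rw [← e, add_mul, map_add, map_add, smul_mul_assoc, map_smul, map_smul,
    step2 _ (realPart z).2 hre, step2 _ (imaginaryPart z).2 him]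
  simp only [smul_eq_mul]; ring

end MM

namespace MM
variable {B : Type u} [CStarAlgebra B] [PartialOrder B] [StarOrderedRing B]

section central
open WeakDual
variable {C : Type u} [CommCStarAlgebra C]

/-- image of the kernel of a character of the center -/
def cker (ι : C →⋆ₐ[ℂ] B) (χ : characterSpace ℂ C) : Set B := {b | ∃ z, χ z = 0 ∧ b = ι z}

theorem cker_sub_mem (ι : C →⋆ₐ[ℂ] B) (χ : characterSpace ℂ C) (z : C) :
    ι z - χ z • (1 : B) ∈ cker ι χ := by
  refine ⟨z - χ z • 1, ?_, ?_⟩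
  · simp
  · simp

theorem kills_central {ι : C →⋆ₐ[ℂ] B} {χ : characterSpace ℂ C} {N : Set B}
    (hN : IsClosedIdeal N) (h : cker ι χ ⊆ N) {σ : B →L[ℂ] ℂ} (hk : Kills σ N) (z : C) (a : B) :
    σ (ι z * a) = χ z * σ a := by
  have := hk _ (ci_mul_right hN a (h (cker_sub_mem ι χ z)))
  rw [sub_mul, map_sub, smul_mul_assoc, one_mul, map_smul, sub_eq_zero] at this
  exact this

theorem exists_char (ι : C →⋆ₐ[ℂ] B) (hc : ∀ z a, ι z * a = a * ι z) {M : Set B}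
    (hM : IsMaximalIdeal M) : ∃ χ : characterSpace ℂ C, cker ι χ ⊆ M := by
  obtain ⟨σ, hσ, hk, he, -⟩ := exists_extreme hM.1 (max_one hM)
  have hmul := fun z a => extreme_central hM.1 hσ hk he (hc z) a
  have hK : kerI σ = M := by
    refine hM.2.2 _ (kerI_closed σ) ((ne_univ_iff (kerI_closed σ)).2 (kerI_one hσ)) ?_
    intro x hx a b
    exact hk _ (ci_mul_right hM.1 _ (ci_mul_left hM.1 _ hx))
  let φ : C →ₐ[ℂ] ℂ := AlgHom.ofLinearMap ((σ : B →ₗ[ℂ] ℂ) ∘ₗ (ι : C →ₗ[ℂ] B))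
    (by simp [hσ.2]) (by intro x y; simp [hmul])
  refine ⟨CharacterSpace.equivAlgHom.symm φ, ?_⟩
  rintro _ ⟨z, hz, rfl⟩
  have hz' : σ (ι z) = 0 := hz
  rw [← hK]
  intro a b
  rw [← hc, mul_assoc, hmul, hz', zero_mul]

theorem isUnit_of_central {ι : C →⋆ₐ[ℂ] B} (hι : Function.Injective ι)
    (hc : ∀ z a, ι z * a = a * ι z) (hs : ∀ b ∈ Set.center B, ∃ z, ι z = b) {z : C}
    (h : IsUnit (ι z)) : IsUnit z := by
  obtain ⟨u, hu⟩ := h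
  obtain ⟨w, hw⟩ := hs (↑u⁻¹ : B) (by
    rw [Semigroup.mem_center_iff]
    intro g
    have h1 := hc z g
    rw [← hu] at h1
    have h2 := congrArg (fun y => (↑u⁻¹ : B) * y * (↑u⁻¹ : B)) h1
    simpa [mul_assoc] using h2)
  refine IsUnit.of_mul_eq_one w (hι ?_)
  rw [map_mul, hw, ← hu, map_one, Units.mul_inv]

theorem exists_max_of_char (ι : C →⋆ₐ[ℂ] B) (hι : Function.Injective ι)
    (hc : ∀ z a, ι z * a = a * ι z) (hs : ∀ b ∈ Set.center B, ∃ z, ι z = b)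
    (χ : characterSpace ℂ C) : ∃ M, IsMaximalIdeal M ∧ cker ι χ ⊆ M := by
  let V : Submodule ℝ B :=
    { carrier := {v | IsSelfAdjoint v ∧ v ∈ cker ι χ}
      zero_mem' := ⟨IsSelfAdjoint.zero B, 0, by simp, by simp⟩
      add_mem' := by
        rintro _ _ ⟨ha, z, hz, rfl⟩ ⟨hb, w, hw, rfl⟩
        exact ⟨ha.add hb, z + w, by simp [hz, hw], by simp⟩
      smul_mem' := by
        rintro c _ ⟨ha, z, hz, rfl⟩
        refine ⟨(IsSelfAdjoint.all c).smul ha, (c : ℂ) • z, by rw [map_smul, hz, smul_zero], ?_⟩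
        rw [map_smul, Complex.coe_smul] }
  have hV : ∀ v ∈ V, IsSelfAdjoint v := fun v hv => hv.1
  obtain ⟨σ, hσ, hσV, -⟩ := sep V hV (x := -1) (IsSelfAdjoint.one B).neg (by
    intro hcl
    obtain ⟨_, ⟨p, v, hp, ⟨hvs, z, hz, rfl⟩, rfl⟩, hd⟩ :=
      Metric.mem_closure_iff.1 hcl (1 / 2) (by norm_num)
    rw [dist_eq_norm] at hd
    have hsa : IsSelfAdjoint (-(-1 - (p + ι z))) :=
      (((IsSelfAdjoint.one B).neg).sub (hp.isSelfAdjoint.add hvs)).neg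
    have h1 := sa_le_norm hsa
    rw [norm_neg, ← algMap_eq] at h1
    have h2 : algebraMap ℝ B ‖-1 - (p + ι z)‖ ≤ algebraMap ℝ B (1 / 2) :=
      algebraMap_mono B hd.le
    have h3 : algebraMap ℝ B (1 / 2) ≤ -ι z := by
      have h4 := h1.trans h2
      have h5 : (1 : B) = algebraMap ℝ B (1 / 2) + algebraMap ℝ B (1 / 2) := by
        rw [← map_add]; norm_num
      have h6 : -(-1 - (p + ι z)) = p + (algebraMap ℝ B (1 / 2) + (algebraMap ℝ B (1 / 2)) + ι z) := by
        rw [← h5]; abel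
      rw [h6] at h4
      have h7 := (le_add_of_nonneg_left hp).trans h4
      rw [add_assoc] at h7
      have h8 : algebraMap ℝ B (1 / 2) + ι z ≤ 0 := by simpa using h7
      rw [← sub_nonpos, sub_neg_eq_add]; exact h8
    have h9 : IsUnit (ι (-z)) := by
      rw [map_neg]
      exact CStarAlgebra.isUnit_of_le _ h3 (strictPos_algMap (by norm_num))
    have h10 := (isUnit_of_central hι hc hs h9).map χ
    rw [map_neg, hz, neg_zero] at h10
    exact not_isUnit_zero h10)
  have hker : ∀ z, χ z = 0 → σ (star (ι z) * ι z) = 0 := by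
    intro z hz
    refine hσV _ ⟨IsSelfAdjoint.star_mul_self _, star z * z, by simp [hz], by simp [map_star]⟩
  obtain ⟨M, hM, hle⟩ := exists_maximal (kerI_closed σ) (kerI_one hσ)
  refine ⟨M, hM, Set.Subset.trans ?_ hle⟩
  rintro _ ⟨z, hz, rfl⟩ a b
  rw [mul_assoc, hc, ← mul_assoc]
  have h := pf_cs hσ.1 (star (a * b)) (ι z)
  rw [hker z hz, star_star] at h
  have h0 : ‖σ (a * b * ι z)‖ ^ 2 ≤ 0 := by simpa using h
  have h1 : ‖σ (a * b * ι z)‖ = 0 := by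
    have := le_antisymm h0 (sq_nonneg _)
    exact pow_eq_zero_iff (two_ne_zero) |>.1 this
  exact norm_eq_zero.1 h1

theorem max_unique {ι : C →⋆ₐ[ℂ] B}
    (hs : ∀ b ∈ Set.center B, ∃ z, ι z = b) (hc : ∀ z a, ι z * a = a * ι z)
    (hwc : ∀ N N' : Set B, IsMaximalIdeal N → IsMaximalIdeal N' →
        N ∩ Set.center B = N' ∩ Set.center B → N = N')
    {χ : characterSpace ℂ C} {M N : Set B} (hM : IsMaximalIdeal M) (hN : IsMaximalIdeal N)
    (h1 : cker ι χ ⊆ M) (h2 : cker ι χ ⊆ N) : M = N := by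
  have key : ∀ K, IsMaximalIdeal K → cker ι χ ⊆ K → K ∩ Set.center B = cker ι χ := by
    intro K hK hle
    ext b
    constructor
    · rintro ⟨hb, hbc⟩
      obtain ⟨z, rfl⟩ := hs b hbc
      refine ⟨z, ?_, rfl⟩
      by_contra hne
      have h3 := ci_sub hK.1 hb (hle (cker_sub_mem ι χ z))
      rw [sub_sub_cancel] at h3
      have h4 := ci_smul hK.1 (χ z)⁻¹ h3
      rw [smul_smul, inv_mul_cancel₀ hne, one_smul] at h4
      exact max_one hK h4
    · intro hb
      refine ⟨hle hb, ?_⟩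
      obtain ⟨z, -, rfl⟩ := hb
      rw [Semigroup.mem_center_iff]
      intro g; exact (hc z g).symm
  exact hwc M N hM hN ((key M hM h1).trans (key N hN h2).symm)

end central
end MM

namespace MM
variable {B : Type u} [CStarAlgebra B] [PartialOrder B] [StarOrderedRing B]

section central2
open WeakDual Filter Topology
variable {C : Type u} [CommCStarAlgebra C]

theorem ev_small (ι : C →⋆ₐ[ℂ] B) (hc : ∀ z a, ι z * a = a * ι z)
    (m : characterSpace ℂ C → Set B) (hm : ∀ χ, IsMaximalIdeal (m χ))
    (hle : ∀ χ, cker ι χ ⊆ m χ) (χ₀ : characterSpace ℂ C) (T : Set B) {k : B}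
    (hk : k ∈ genIdeal (T ∪ cker ι χ₀)) {ε : ℝ} (hε : 0 < ε) :
    ∀ᶠ χ in 𝓝 χ₀, ∀ σ : B →L[ℂ] ℂ, IsState σ → Kills σ (m χ) → T ⊆ m χ → ‖σ k‖ < ε := by
  have main : ∀ k ∈ genSpan (T ∪ cker ι χ₀), ∀ ε : ℝ, 0 < ε → ∀ᶠ χ in 𝓝 χ₀,
      ∀ σ : B →L[ℂ] ℂ, IsState σ → Kills σ (m χ) → T ⊆ m χ → ‖σ k‖ < ε := by
    intro k hk
    induction hk using Submodule.span_induction with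
    | mem x hx =>
      intro ε hε
      obtain ⟨a, b, s, hs, rfl⟩ := hx
      rcases hs with hs | ⟨z, hz, rfl⟩
      · refine Eventually.of_forall fun χ σ hσ hkl hT => ?_
        rw [hkl _ (ci_mul_right (hm χ).1 _ (ci_mul_left (hm χ).1 _ (hT hs)))]
        simpa using hε
      · have hcont : Continuous fun χ : characterSpace ℂ C => ‖χ z‖ * ‖a * b‖ := by
          have : Continuous fun χ : characterSpace ℂ C => χ z := (gelfandTransform ℂ C z).continuous
          exact this.norm.mul continuous_const
        have hlt : (fun χ : characterSpace ℂ C => ‖χ z‖ * ‖a * b‖) χ₀ < ε := by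
          simpa [hz] using hε
        filter_upwards [hcont.continuousAt.eventually_lt_const hlt] with χ hχ σ hσ hkl hT
        rw [← hc, mul_assoc, kills_central (hm χ).1 (hle χ) hkl, norm_mul]
        exact (mul_le_mul_of_nonneg_left (st_norm_le hσ _) (norm_nonneg _)).trans_lt hχ
    | zero =>
      intro ε hε
      exact Eventually.of_forall fun χ σ hσ hkl hT => by simpa using hε
    | add x y _ _ hx hy =>
      intro ε hε
      filter_upwards [hx _ (half_pos hε), hy _ (half_pos hε)] with χ h1 h2 σ hσ hkl hT
      rw [map_add]
      refine (norm_add_le _ _).trans_lt ?_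
      linarith [h1 σ hσ hkl hT, h2 σ hσ hkl hT]
    | smul c x _ hx =>
      intro ε hε
      have hp : 0 < ‖c‖ + 1 := by positivity
      filter_upwards [hx _ (div_pos hε hp)] with χ h1 σ hσ hkl hT
      have h2 := h1 σ hσ hkl hT
      rw [lt_div_iff₀ hp] at h2
      rw [map_smul, norm_smul]
      nlinarith [norm_nonneg (σ x), norm_nonneg c]
  obtain ⟨g, hg, hd⟩ := Metric.mem_closure_iff.1 hk (ε / 2) (half_pos hε)
  rw [dist_eq_norm] at hd
  filter_upwards [main g hg _ (half_pos hε)] with χ h1 σ hσ hkl hT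
  have h2 := h1 σ hσ hkl hT
  have h3 := (st_norm_le hσ (k - g)).trans_lt hd
  have h4 : σ k = σ (k - g) + σ g := by rw [map_sub]; ring
  rw [h4]
  refine (norm_add_le _ _).trans_lt ?_
  linarith

theorem msup_continuous (ι : C →⋆ₐ[ℂ] B) (hc : ∀ z a, ι z * a = a * ι z)
    (hs : ∀ b ∈ Set.center B, ∃ z, ι z = b)
    (hwc : ∀ N N' : Set B, IsMaximalIdeal N → IsMaximalIdeal N' →
        N ∩ Set.center B = N' ∩ Set.center B → N = N')
    (hprim : ∀ P : Set B, IsPrimitiveIdeal P → strongRadical B ⊆ P → IsMaximalIdeal P)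
    (m : characterSpace ℂ C → Set B) (hm : ∀ χ, IsMaximalIdeal (m χ))
    (hle : ∀ χ, cker ι χ ⊆ m χ) {x : B} (hx : IsSelfAdjoint x) :
    Continuous fun χ => msup (m χ) x := by
  have hsa : ∀ α : ℝ, IsSelfAdjoint (x - (α : ℂ) • (1 : B)) := fun α => by
    rw [← algMap_eq]; exact hx.sub (IsSelfAdjoint.algebraMap B (IsSelfAdjoint.all _))
  rw [continuous_iff_continuousAt]
  intro χ₀
  refine tendsto_order.2 ⟨fun α' hα' => ?_, fun β hβ => ?_⟩
  · obtain ⟨α, h1, h2⟩ := exists_between hα'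
    obtain ⟨σ₀, hσ₀, hk₀, hlt⟩ := lt_msup (hm χ₀) x (sub_pos.2 h2)
    have hy : (x - (α : ℂ) • (1 : B))⁺ ∉ m χ₀ := by
      intro hy
      have := state_nonpos (hsa α) hy hσ₀ hk₀
      rw [map_sub, map_smul, hσ₀.2] at this
      simp at this
      linarith
    have hone : (1 : B) ∈ genIdeal ({(x - (α : ℂ) • (1 : B))⁺} ∪ cker ι χ₀) := by
      by_contra hcon
      obtain ⟨M, hM, hMle⟩ := exists_maximal (genIdeal_closed _) hcon
      have hsub := (subset_genIdeal ({(x - (α : ℂ) • (1 : B))⁺} ∪ cker ι χ₀)).trans hMle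
      have : M = m χ₀ := max_unique hs hc hwc hM (hm χ₀)
        (fun b hb => hsub (Or.inr hb)) (hle χ₀)
      rw [← this] at hy
      exact hy (hsub (Or.inl rfl))
    filter_upwards [ev_small ι hc m hm hle χ₀ _ hone one_pos] with χ hχ
    have hyn : (x - (α : ℂ) • (1 : B))⁺ ∉ m χ := by
      intro hyn
      obtain ⟨σ, hσ, hk⟩ := exists_state_kills (hm χ).1 (max_one (hm χ))
      have := hχ σ hσ hk (Set.singleton_subset_iff.2 hyn)
      rw [hσ.2] at this
      simp at this
    obtain ⟨σ, hσ, hk, hα⟩ := y_lemma (hm χ).1 hx α hyn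
    exact h1.trans_le (hα.trans (le_msup hx hσ hk))
  · obtain ⟨α, h1, h2⟩ := exists_between hβ
    have hy : (x - (α : ℂ) • (1 : B))⁺ ∈ m χ₀ := by
      by_contra hy
      obtain ⟨σ, hσ, hk, hα⟩ := y_lemma (hm χ₀).1 hx α hy
      exact absurd (hα.trans (le_msup hx hσ hk)) (not_le.2 h1)
    have hyG : (x - (α : ℂ) • (1 : B))⁺ ∈ genIdeal (strongRadical B ∪ cker ι χ₀) := by
      by_contra hcon
      obtain ⟨P, hP, hPle, hyP⟩ := exists_primitive (genIdeal_closed _) hcon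
      have hsub := (subset_genIdeal (strongRadical B ∪ cker ι χ₀)).trans hPle
      have hPm := hprim P hP (fun b hb => hsub (Or.inl hb))
      have : P = m χ₀ := max_unique hs hc hwc hPm (hm χ₀)
        (fun b hb => hsub (Or.inr hb)) (hle χ₀)
      rw [this] at hyP
      exact hyP hy
    have hδ : 0 < (β - α) / 2 := by linarith
    filter_upwards [ev_small ι hc m hm hle χ₀ _ hyG hδ] with χ hχ
    obtain ⟨σ, hσ, hk, hlt⟩ := lt_msup (hm χ) x hδ
    have h3 := hχ σ hσ hk (Set.sInter_subset_of_mem (hm χ))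
    have h4 := pf_re_mono hσ.1 (le_posPart' (hsa α))
    rw [map_sub, map_smul, hσ.2, smul_eq_mul, mul_one, Complex.sub_re, Complex.ofReal_re] at h4
    have h5 := (le_abs_self _).trans (Complex.abs_re_le_norm (σ (x - (α : ℂ) • (1 : B))⁺))
    linarith

theorem part2_abs (ι : C →⋆ₐ[ℂ] B) (hι : Function.Injective ι) (hc : ∀ z a, ι z * a = a * ι z)
    (hs : ∀ b ∈ Set.center B, ∃ z, ι z = b)
    (hwc : ∀ N N' : Set B, IsMaximalIdeal N → IsMaximalIdeal N' →
        N ∩ Set.center B = N' ∩ Set.center B → N = N')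
    (hprim : ∀ P : Set B, IsPrimitiveIdeal P → strongRadical B ⊆ P → IsMaximalIdeal P)
    {ω : B →L[ℂ] ℂ} (hω : IsState ω) (hk : Kills ω (strongRadical B)) : IsMaximallyMixed ω := by
  choose m hm hle using exists_max_of_char ι hι hc hs
  refine key2 (F := {N : Set B | IsMaximalIdeal N}) (fun N hN => hN) (fun M hM _ => hM) ?_ hω hk
  intro x hx ε hε
  have hcont := msup_continuous ι hc hs hwc hprim m hm hle hx
  let g : C(characterSpace ℂ C, ℂ) := ⟨fun χ => (msup (m χ) x : ℂ), by fun_prop⟩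
  have hg : IsSelfAdjoint g := by
    ext χ
    simp [g]
  obtain ⟨z, hz⟩ := EquivLike.surjective (gelfandStarTransform C) g
  have hχ : ∀ χ : characterSpace ℂ C, χ z = (msup (m χ) x : ℂ) := fun χ =>
    congrArg (fun f : C(characterSpace ℂ C, ℂ) => f χ) hz
  have hzs : IsSelfAdjoint z := by
    apply EquivLike.injective (gelfandStarTransform C)
    rw [map_star, hz]
    exact hg
  have hval : ∀ N, IsMaximalIdeal N → ∀ σ : B →L[ℂ] ℂ, IsState σ → Kills σ N →
      (σ (ι z)).re = msup N x := by
    intro N hN σ hσ hkl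
    obtain ⟨χ, hχN⟩ := exists_char ι hc hN
    have hNm : N = m χ := max_unique hs hc hwc hN (hm χ) hχN (hle χ)
    have h1 := kills_central hN.1 hχN hkl z 1
    rw [mul_one, hσ.2, mul_one, hχ] at h1
    rw [h1, hNm]; simp
  refine ⟨ι z, hzs.map ι, fun a => ?_, ?_, ?_⟩
  · rw [hc, sub_self]
    exact ci_zero strongRadical_closed
  · intro N hN σ hσ hkl
    rw [hval N hN σ hσ hkl]
    exact le_msup hx hσ hkl
  · intro N hN
    obtain ⟨σ, hσ, hkl, hlt⟩ := lt_msup hN x hε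
    exact ⟨σ, hσ, hkl, by rw [hval N hN σ hσ hkl]; exact hlt⟩

end central2

theorem part2
    (hwc : ∀ N N' : Set B, IsMaximalIdeal N → IsMaximalIdeal N' →
        N ∩ Set.center B = N' ∩ Set.center B → N = N')
    (hprim : ∀ P : Set B, IsPrimitiveIdeal P → strongRadical B ⊆ P → IsMaximalIdeal P)
    {ω : B →L[ℂ] ℂ} (hω : IsState ω) (hk : Kills ω (strongRadical B)) : IsMaximallyMixed ω := by
  let S : StarSubalgebra ℂ B := StarSubalgebra.centralizer ℂ Set.univ
  have hS : ∀ b, b ∈ S ↔ ∀ a, a * b = b * a := by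
    intro b
    rw [← SetLike.mem_coe, StarSubalgebra.coe_centralizer, Set.univ_union, Set.mem_centralizer_iff]
    simp
  haveI hcl : IsClosed (S : Set B) := by
    have : (S : Set B) = ⋂ a : B, {b | a * b = b * a} := by
      ext b; simp [← hS]
    rw [this]
    exact isClosed_iInter fun a => isClosed_eq (by fun_prop) (by fun_prop)
  letI : CommCStarAlgebra S :=
    { StarSubalgebra.cstarAlgebra S with
      mul_comm := fun a b => Subtype.ext ((hS b).1 b.2 a) }
  refine part2_abs (C := S) S.subtype Subtype.val_injective (fun z a => ((hS z).1 z.2 a).symm)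
    ?_ hwc hprim hω hk
  intro b hb
  exact ⟨⟨b, (hS b).2 (Semigroup.mem_center_iff.1 hb)⟩, rfl⟩

theorem main' :
    ((∀ ρ : B →L[ℂ] ℂ, InWeakStarClosure {ω : B →L[ℂ] ℂ | IsMaximallyMixed ω} ρ →
        IsMaximallyMixed ρ) →
      ∀ P : Set B, IsPrimitiveIdeal P → strongRadical B ⊆ P → IsMaximalIdeal P) ∧
    ((∀ N N' : Set B, IsMaximalIdeal N → IsMaximalIdeal N' →
        N ∩ Set.center B = N' ∩ Set.center B → N = N') →
      (∀ P : Set B, IsPrimitiveIdeal P → strongRadical B ⊆ P → IsMaximalIdeal P) →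
      {ω : B →L[ℂ] ℂ | IsMaximallyMixed ω} =
        {ω : B →L[ℂ] ℂ | IsState ω ∧ ∀ x ∈ strongRadical B, ω x = 0}) := by
  refine ⟨fun h P hP hJ => part1 h P hP hJ, fun hwc hprim => Set.ext fun ω => ⟨fun h => ?_, ?_⟩⟩
  · exact ⟨h.1, mm_kills_radical h⟩
  · rintro ⟨hω, hk⟩
    exact part2 hwc hprim hω hk

end MM

/-- **Theorem.** If the set of maximally mixed states of `A` is weak* closed,
then every primitive ideal of `A` containing the strong radical is maximal.
Conversely, if `A` is weakly central (distinct maximal ideals meet the center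
in distinct ideals) and every primitive ideal containing the strong radical is
maximal, then the maximally mixed states are exactly the states annihilating
the strong radical. -/
theorem maximallyMixed_weakStarClosed_iff_primitive_above_radical_maximal :
    ((∀ ρ : A →L[ℂ] ℂ, InWeakStarClosure {ω : A →L[ℂ] ℂ | IsMaximallyMixed ω} ρ →
        IsMaximallyMixed ρ) →
      ∀ P : Set A, IsPrimitiveIdeal P → strongRadical A ⊆ P → IsMaximalIdeal P) ∧
    ((∀ N N' : Set A, IsMaximalIdeal N → IsMaximalIdeal N' →
        N ∩ Set.center A = N' ∩ Set.center A → N = N') →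
      (∀ P : Set A, IsPrimitiveIdeal P → strongRadical A ⊆ P → IsMaximalIdeal P) →
      {ω : A →L[ℂ] ℂ | IsMaximallyMixed ω} =
        {ω : A →L[ℂ] ℂ | IsState ω ∧ ∀ x ∈ strongRadical A, ω x = 0}) := by
  letI : CStarAlgebra A := {}
  letI := CStarAlgebra.spectralOrder A
  haveI := CStarAlgebra.spectralOrderedRing A
  exact MM.main' (B := A)

end
end
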